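/- There are exactly 9 fundamental discriminants D with −3.1·10^20 ≤ D < 0 such that the class group Cl(D) of ℚ(√D) is trivial (i.e., E(D) = 1), and among these the one of largest absolute value is D = −163. -/

import Mathlib

open NumberField

/-- `D` is a fundamental discriminant: either `D ≡ 1 (mod 4)` and `D` is squarefree,
or `D = 4m` for a squarefree integer `m ≡ 2` or `3 (mod 4)`. (We exclude the degenerate
case `D = 1`, so that `D` is the discriminant of a quadratic number field.) -/
def IsFundamentalDiscriminant (D : ℤ) : Prop :=
  D ≠ 1 ∧ ((D % 4 = 1 ∧ Squarefree D) ∨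
    ∃ m : ℤ, D = 4 * m ∧ Squarefree m ∧ (m % 4 = 2 ∨ m % 4 = 3))

/-- A quadratic field has an integral basis of the form `1, ω`. -/
theorem exists_one_omega_span (K : Type) [Field K] [NumberField K]
    (hK : Module.finrank ℚ K = 2) :
    ∃ ω : 𝓞 K, (∀ α : 𝓞 K, ∃ x y : ℤ, α = x + y * ω) ∧
      ∀ x y : ℤ, (x : 𝓞 K) + y * ω = 0 → x = 0 ∧ y = 0 := by
  have hr : Module.finrank ℤ (𝓞 K) = 2 := by rw [RingOfIntegers.rank, hK]
  let b : Module.Basis (Fin 2) ℤ (𝓞 K) := (Module.finBasis ℤ (𝓞 K)).reindex (finCongr hr)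
  have hb : ∀ α : 𝓞 K, ∃ u v : ℤ, α = u * b 0 + v * b 1 := fun α =>
    ⟨b.repr α 0, b.repr α 1, by
      conv_lhs => rw [← b.sum_repr α]
      simp [Fin.sum_univ_two]⟩
  have hind : ∀ u v : ℤ, (u : 𝓞 K) * b 0 + v * b 1 = 0 → u = 0 ∧ v = 0 := by
    intro u v h
    have := (Fintype.linearIndependent_iff.mp b.linearIndependent) ![u, v]
      (by simpa [Fin.sum_univ_two] using h)
    exact ⟨by simpa using this 0, by simpa using this 1⟩
  obtain ⟨u, v, huv⟩ := hb 1
  have hcop : IsCoprime u v := by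
    rw [Int.isCoprime_iff_gcd_eq_one]
    set g := Int.gcd u v
    obtain ⟨u', hu⟩ : (g : ℤ) ∣ u := Int.gcd_dvd_left _ _
    obtain ⟨v', hv⟩ : (g : ℤ) ∣ v := Int.gcd_dvd_right _ _
    have h1 : (1 : 𝓞 K) = (g : ℤ) * (u' * b 0 + v' * b 1) := by
      rw [huv, hu, hv]; push_cast; ring
    have h2 := congrArg (Algebra.norm ℤ) h1
    rw [map_one, map_mul] at h2
    have h3 : Algebra.norm ℤ (((g : ℤ) : 𝓞 K)) = (g : ℤ) ^ 2 := by
      have := Algebra.norm_algebraMap_of_basis b (g : ℤ)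
      simpa using this
    rw [h3] at h2
    have : IsUnit ((g : ℤ) ^ 2) := IsUnit.of_mul_eq_one _ h2.symm
    have := (isUnit_pow_iff (two_ne_zero)).mp this
    simpa using Int.isUnit_iff_natAbs_eq.mp this
  obtain ⟨r, s, hrs⟩ := hcop
  have hrs' : (r : 𝓞 K) * u + s * v = 1 := by exact_mod_cast hrs
  refine ⟨-s * b 0 + r * b 1, fun α => ?_, fun x y hxy => ?_⟩
  · obtain ⟨c, d, rfl⟩ := hb α
    refine ⟨c * r + d * s, -c * v + d * u, ?_⟩
    push_cast
    have e : (c : 𝓞 K) * r + d * s = (c * r + d * s) * (u * b 0 + v * b 1) := by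
      rw [← huv, mul_one]
    rw [e]
    linear_combination (-(c * b 0) - d * b 1) * hrs'
  · have h : ((x * u - y * s : ℤ) : 𝓞 K) * b 0 + ((x * v + y * r : ℤ) : 𝓞 K) * b 1 = 0 := by
      rw [← hxy]
      push_cast
      linear_combination -(x : 𝓞 K) * huv
    obtain ⟨h1, h2⟩ := hind _ _ h
    exact ⟨by linear_combination r * h1 + s * h2 - x * hrs, by
      linear_combination -v * h1 + u * h2 - y * hrs⟩

theorem discr_eq_of_one_omega_span (K : Type) [Field K] [NumberField K] (ω : 𝓞 K) (t n : ℤ)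
    (hω : ω ^ 2 = t * ω - n) (hspan : ∀ α : 𝓞 K, ∃ x y : ℤ, α = x + y * ω)
    (hind : ∀ x y : ℤ, (x : 𝓞 K) + y * ω = 0 → x = 0 ∧ y = 0) :
    NumberField.discr K = t ^ 2 - 4 * n := by
  have hli : LinearIndependent ℤ ![(1 : 𝓞 K), ω] := by
    rw [LinearIndependent.pair_iff]
    intro x y h
    exact hind x y (by simpa using h)
  have hsp : ⊤ ≤ Submodule.span ℤ (Set.range ![(1 : 𝓞 K), ω]) := by
    intro α _
    obtain ⟨x, y, rfl⟩ := hspan α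
    simp only [Matrix.range_cons, Matrix.range_empty, Set.union_empty, Set.singleton_union]
    exact Submodule.mem_span_pair.mpr ⟨x, y, by simp⟩
  let b : Module.Basis (Fin 2) ℤ (𝓞 K) := Module.Basis.mk hli hsp
  have hb0 : b 0 = 1 := by simp [b]
  have hb1 : b 1 = ω := by simp [b]
  have hrepr : ∀ x y : ℤ, b.repr (x + y * ω) = Finsupp.single 0 x + Finsupp.single 1 y := by
    intro x y
    have : (x + y * ω : 𝓞 K) = x • b 0 + y • b 1 := by simp [hb0, hb1]
    rw [this, map_add, map_smul, map_smul, b.repr_self, b.repr_self]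
    simp
  have htr : ∀ x y : ℤ, Algebra.trace ℤ (𝓞 K) (x + y * ω) = 2 * x + t * y := by
    intro x y
    rw [Algebra.trace_eq_matrix_trace b, Matrix.trace_fin_two, Algebra.leftMulMatrix_eq_repr_mul,
      Algebra.leftMulMatrix_eq_repr_mul, hb0, hb1]
    have e : (x + y * ω) * ω = ((-y * n : ℤ) : 𝓞 K) + ((x + t * y : ℤ) : 𝓞 K) * ω := by
      push_cast; linear_combination (y : 𝓞 K) * hω
    rw [mul_one, e, hrepr, hrepr]
    simp
    ring
  rw [← NumberField.discr_eq_discr K b, Algebra.discr_def, Matrix.det_fin_two]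
  simp only [Algebra.traceMatrix_apply, Algebra.traceForm_apply, hb0, hb1]
  have e0 := htr 1 0
  have e1 := htr 0 1
  have e2 := htr (-n) t
  simp only [Int.cast_one, Int.cast_zero, zero_mul, add_zero, one_mul, zero_add, mul_one] at *
  rw [show ω * ω = ((-n : ℤ) : 𝓞 K) + t * ω by push_cast; linear_combination hω, e0, e1, e2]
  ring

/-- A quadratic field of discriminant `t ^ 2 - 4 n` has an integral basis `1, ω` with
`ω ^ 2 = t ω - n` and `t ∈ {0, 1}`. -/
theorem exists_integral_basis (K : Type) [Field K] [NumberField K]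
    (hK : Module.finrank ℚ K = 2) :
    ∃ (ω : 𝓞 K) (t n : ℤ), (t = 0 ∨ t = 1) ∧ ω ^ 2 = t * ω - n ∧
      NumberField.discr K = t ^ 2 - 4 * n ∧ (∀ α : 𝓞 K, ∃ x y : ℤ, α = x + y * ω) ∧
      ∀ x y : ℤ, (x : 𝓞 K) + y * ω = 0 → x = 0 ∧ y = 0 := by
  obtain ⟨ω, hspan, hind⟩ := exists_one_omega_span K hK
  obtain ⟨n, t, hnt⟩ := hspan (ω ^ 2)
  have hω : (ω - (t / 2 : ℤ)) ^ 2 = (t % 2 : ℤ) * (ω - (t / 2 : ℤ)) -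
      ((-n - t * (t / 2) + (t / 2) ^ 2 : ℤ) : 𝓞 K) := by
    have h : (t : 𝓞 K) = (t % 2 : ℤ) + 2 * (t / 2 : ℤ) := by
      exact_mod_cast congrArg (Int.cast (R := 𝓞 K)) (Int.emod_add_mul_ediv t 2).symm
    push_cast
    linear_combination hnt + (ω - (t / 2 : ℤ)) * h
  have hspan' : ∀ α : 𝓞 K, ∃ x y : ℤ, α = x + y * (ω - (t / 2 : ℤ)) := fun α => by
    obtain ⟨x, y, rfl⟩ := hspan α
    exact ⟨x + y * (t / 2), y, by push_cast; ring⟩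
  have hind' : ∀ x y : ℤ, (x : 𝓞 K) + y * (ω - (t / 2 : ℤ)) = 0 → x = 0 ∧ y = 0 := by
    intro x y h
    obtain ⟨h1, h2⟩ := hind (x - y * (t / 2)) y (by rw [← h]; push_cast; ring)
    subst h2
    simpa using h1
  exact ⟨_, _, _, Int.emod_two_eq_zero_or_one t, hω,
    discr_eq_of_one_omega_span K _ _ _ hω hspan' hind', hspan', hind'⟩

/-- If `√D` generates the quadratic field `K`, the discriminant of `K` is `D` for every
negative fundamental discriminant `D`. -/
theorem discr_eq_of_sq_eq (K : Type) [Field K] [NumberField K] (hK : Module.finrank ℚ K = 2)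
    {D : ℤ} (hD : IsFundamentalDiscriminant D) (hneg : D < 0) (s : K) (hs : s ^ 2 = D) :
    NumberField.discr K = D := by
  obtain ⟨ω, t, n, ht, hω, hdisc, hspan, hind⟩ := exists_integral_basis K hK
  have key : ∀ (c : ℤ) (θ : 𝓞 K), 2 * (θ : K) = c + s → ∃ y : ℤ, D = y ^ 2 * (t ^ 2 - 4 * n) := by
    intro c θ hθ
    obtain ⟨x, y, rfl⟩ := hspan θ
    refine ⟨y, ?_⟩
    have h1 : (2 * (x + y * ω) - c : 𝓞 K) ^ 2 = D := by
      apply RingOfIntegers.coe_injective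
      simp only [map_add, map_mul, map_sub, map_pow, map_intCast, map_ofNat] at hθ ⊢
      rw [← hs, hθ]; ring
    have h2 : (((2 * x - c) ^ 2 - 4 * y ^ 2 * n - D : ℤ) : 𝓞 K) +
        ((4 * (2 * x - c) * y + 4 * y ^ 2 * t : ℤ) : 𝓞 K) * ω = 0 := by
      push_cast
      linear_combination h1 - 4 * (y : 𝓞 K) ^ 2 * hω
    obtain ⟨h3, h4⟩ := hind _ _ h2
    have hy : y ≠ 0 := by
      rintro rfl
      nlinarith [sq_nonneg (2 * x - c)]
    have h5 : 2 * x - c = -y * t := by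
      have : 4 * y * (2 * x - c + y * t) = 0 := by linear_combination h4
      rcases mul_eq_zero.mp this with h | h
      · omega
      · linarith
    rw [h5] at h3
    linear_combination -h3
  rw [hdisc]
  set D' := t ^ 2 - 4 * n with hD'
  have hmod : D' % 4 = 0 ∨ D' % 4 = 1 := by
    rcases ht with rfl | rfl <;> omega
  obtain ⟨-, ⟨h4, hsq⟩ | ⟨m, rfl, hsq, hm⟩⟩ := hD
  · have hs_int : IsIntegral ℤ ((1 + s) / 2) := by
      refine ⟨Polynomial.X ^ 2 - Polynomial.X - Polynomial.C (D / 4), by monicity!, ?_⟩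
      have h : (D : K) = 4 * ((D / 4 : ℤ) : K) + 1 := by
        have : D = 4 * (D / 4) + 1 := by omega
        exact_mod_cast congrArg (Int.cast (R := K)) this
      simp only [Polynomial.eval₂_sub, Polynomial.eval₂_pow, Polynomial.eval₂_X,
        Polynomial.eval₂_C]
      rw [eq_intCast]
      linear_combination (hs + h) / 4
    obtain ⟨y, hy⟩ := key 1 ⟨_, hs_int⟩ (by
      change 2 * ((1 + s) / 2) = ((1 : ℤ) : K) + s
      push_cast
      ring)
    have hu : IsUnit y := hsq y ⟨D', by rw [hy]; ring⟩
    rw [hy, Int.isUnit_sq hu, one_mul]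
  · have hs_int : IsIntegral ℤ (s / 2) := by
      refine ⟨Polynomial.X ^ 2 - Polynomial.C m, by monicity!, ?_⟩
      push_cast at hs
      simp only [Polynomial.eval₂_sub, Polynomial.eval₂_pow, Polynomial.eval₂_X,
        Polynomial.eval₂_C]
      rw [eq_intCast]
      linear_combination hs / 4
    obtain ⟨y, hy⟩ := key 0 ⟨_, hs_int⟩ (by
      change 2 * (s / 2) = ((0 : ℤ) : K) + s
      push_cast
      ring)
    rcases Int.even_or_odd' y with ⟨z, rfl | rfl⟩
    · have h1 : m = z ^ 2 * D' := by linarith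
      have hu : IsUnit z := hsq z ⟨D', by rw [h1]; ring⟩
      rw [Int.isUnit_sq hu, one_mul] at h1
      omega
    · have h4 : D' % 4 = 0 := by
        rcases hmod with h | h
        · exact h
        · exfalso
          obtain ⟨e, he⟩ : ∃ e, D' = 4 * e + 1 := ⟨D' / 4, by omega⟩
          rw [he] at hy
          ring_nf at hy
          omega
      obtain ⟨e, he⟩ : ∃ e, D' = 4 * e := ⟨D' / 4, by omega⟩
      have h1 : m = (2 * z + 1) ^ 2 * e := by rw [he] at hy; linarith
      have hu : IsUnit (2 * z + 1) := hsq _ ⟨e, by rw [h1]; ring⟩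
      rw [Int.isUnit_sq hu, one_mul] at h1
      rw [he, h1]

/-- Every negative fundamental discriminant is the discriminant of a quadratic field. -/
theorem IsFundamentalDiscriminant.exists_field {D : ℤ} (hD : IsFundamentalDiscriminant D)
    (hneg : D < 0) : ∃ (K : Type) (_ : Field K) (_ : NumberField K),
      Module.finrank ℚ K = 2 ∧ NumberField.discr K = D := by
  have hD0 : (D : ℚ) < 0 := by exact_mod_cast hneg
  have : Fact (∀ r : ℚ, r ^ 2 ≠ (D : ℚ) + 0 * r) := ⟨fun r h => by nlinarith [sq_nonneg r]⟩
  have hfr : Module.finrank ℚ (QuadraticAlgebra ℚ (D : ℚ) 0) = 2 := by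
    exact QuadraticAlgebra.finrank_eq_two _ _
  have : CharZero (QuadraticAlgebra ℚ (D : ℚ) 0) :=
    algebraRat.charZero _
  have : FiniteDimensional ℚ (QuadraticAlgebra ℚ (D : ℚ) 0) :=
    Module.finite_of_finrank_pos (by rw [hfr]; norm_num)
  have : NumberField (QuadraticAlgebra ℚ (D : ℚ) 0) := { }
  refine ⟨QuadraticAlgebra ℚ (D : ℚ) 0, inferInstance, inferInstance, hfr,
    discr_eq_of_sq_eq _ hfr hD hneg QuadraticAlgebra.omega ?_⟩
  rw [sq, QuadraticAlgebra.omega_mul_omega_eq_mk]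
  ext <;> simp

section ClassNumberOne

variable {K : Type} [Field K] [NumberField K] {ω : 𝓞 K} {t n : ℤ}

/-- In a quadratic field with principal ring of integers, a non-inert prime is a norm. -/
theorem exists_norm_eq_of_isPrincipalIdealRing [IsPrincipalIdealRing (𝓞 K)]
    (hω : ω ^ 2 = t * ω - n) (hneg : t ^ 2 - 4 * n < 0)
    (hspan : ∀ α : 𝓞 K, ∃ x y : ℤ, α = x + y * ω)
    (hind : ∀ x y : ℤ, (x : 𝓞 K) + y * ω = 0 → x = 0 ∧ y = 0)
    {p : ℕ} (hp : p.Prime) {a : ℤ} (ha : (p : ℤ) ∣ a ^ 2 + t * a + n) :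
    ∃ x y : ℤ, x ^ 2 + t * x * y + n * y ^ 2 = p := by
  have hpne : ¬ (p : ℤ) ∣ 1 := fun h => hp.one_lt.ne' (by
    simpa using Int.natAbs_dvd_natAbs.mpr h)
  have hdvd : ∀ x y : ℤ, ((p : 𝓞 K) ∣ x + y * ω) → (p : ℤ) ∣ x ∧ (p : ℤ) ∣ y := by
    rintro x y ⟨β, hβ⟩
    obtain ⟨z, w, rfl⟩ := hspan β
    obtain ⟨h1, h2⟩ := hind (x - p * z) (y - p * w) (by push_cast; linear_combination hβ)
    exact ⟨⟨z, by linarith⟩, ⟨w, by linarith⟩⟩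
  have hp0 : (p : 𝓞 K) ≠ 0 := by exact_mod_cast hp.ne_zero
  have hpu : ¬ IsUnit (p : 𝓞 K) := fun h =>
    hpne (hdvd 1 0 (by simpa using h.dvd)).1
  have hnp : ¬ Irreducible (p : 𝓞 K) := by
    intro h
    have hprime := h.prime
    obtain ⟨c, hc⟩ := ha
    have hc' : (a : 𝓞 K) ^ 2 + t * a + n = p * c := by
      exact_mod_cast congrArg (Int.cast (R := 𝓞 K)) hc
    have : (p : 𝓞 K) ∣ (((a : ℤ) : 𝓞 K) + ((1 : ℤ) : 𝓞 K) * ω) *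
        (((a + t : ℤ) : 𝓞 K) + ((-1 : ℤ) : 𝓞 K) * ω) :=
      ⟨c, by push_cast; linear_combination hc' - hω⟩
    rcases hprime.dvd_or_dvd this with h | h
    · exact hpne (hdvd _ _ h).2
    · exact hpne ((dvd_neg (b := (1 : ℤ))).mp (hdvd _ _ h).2)
  obtain ⟨α, β, hαβ, hα, hβ⟩ : ∃ α β : 𝓞 K, (p : 𝓞 K) = α * β ∧ ¬ IsUnit α ∧ ¬ IsUnit β := by
    by_contra! H
    exact hnp ⟨hpu, fun a b hab => by
      by_contra! h; exact h.2 (H a b hab h.1)⟩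
  obtain ⟨x, y, rfl⟩ := hspan α
  obtain ⟨z, w, rfl⟩ := hspan β
  have hmul : ∀ x y : ℤ, ((x : 𝓞 K) + y * ω) * (x + t * y - y * ω) =
      ((x ^ 2 + t * x * y + n * y ^ 2 : ℤ) : 𝓞 K) := fun x y => by
    push_cast; linear_combination -(y : 𝓞 K) ^ 2 * hω
  have hne1 : ∀ x y : ℤ, ¬ IsUnit ((x : 𝓞 K) + y * ω) → x ^ 2 + t * x * y + n * y ^ 2 ≠ 1 := by
    intro x y h h1
    have := hmul x y
    rw [h1, Int.cast_one] at this
    exact h (IsUnit.of_mul_eq_one _ this)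
  have hnonneg : ∀ x y : ℤ, 0 ≤ x ^ 2 + t * x * y + n * y ^ 2 := fun x y => by
    nlinarith [sq_nonneg (2 * x + t * y), sq_nonneg y,
      mul_nonneg (neg_nonneg.mpr hneg.le) (sq_nonneg y)]
  obtain ⟨h1, h2⟩ := hind (x * z - n * y * w - p) (x * w + y * z + t * y * w)
    (by push_cast; linear_combination -hαβ - (y * w : 𝓞 K) * hω)
  have hN : (x ^ 2 + t * x * y + n * y ^ 2) * (z ^ 2 + t * z * w + n * w ^ 2) = (p : ℤ) ^ 2 := by
    have h3 : x * z - n * y * w = p := by linarith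
    rw [← h3]
    linear_combination (t * (x * z - n * y * w) +
      n * (x * w + y * z + t * y * w)) * h2
  refine ⟨x, y, ?_⟩
  obtain ⟨A, hA⟩ := Int.eq_ofNat_of_zero_le (hnonneg x y)
  obtain ⟨B, hB⟩ := Int.eq_ofNat_of_zero_le (hnonneg z w)
  have hA1 := hne1 x y hα
  have hB1 := hne1 z w hβ
  rw [hA, hB] at hN
  rw [hA] at hA1 ⊢
  rw [hB] at hB1
  have := (hp.mul_eq_prime_sq_iff (x := A) (y := B) (by exact_mod_cast hA1)
    (by exact_mod_cast hB1)).mp (by exact_mod_cast hN)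
  rw [this.1]

/-- A quadratic field all of whose small primes are inert has class number one. -/
theorem isPrincipalIdealRing_of_inert (hK : Module.finrank ℚ K = 2)
    (hω : ω ^ 2 = t * ω - n) (hdisc : NumberField.discr K = t ^ 2 - 4 * n)
    (hspan : ∀ α : 𝓞 K, ∃ x y : ℤ, α = x + y * ω)
    (hinert : ∀ p : ℕ, p.Prime → 9 * (p : ℤ) ^ 2 ≤ 4 * |t ^ 2 - 4 * n| →
      ∀ a : ℤ, ¬ (p : ℤ) ∣ a ^ 2 + t * a + n) :
    IsPrincipalIdealRing (𝓞 K) := by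
  refine RingOfIntegers.isPrincipalIdealRing_of_isPrincipal_of_norm_le_of_isPrime ?_
  rintro ⟨P, hP0⟩ hP hle
  dsimp only at hP hle
  have hPbot : P ≠ ⊥ := by simpa using hP0
  set N := Ideal.absNorm P with hN
  have hN1 : N ≠ 1 := fun h => hP.ne_top (Ideal.absNorm_eq_one_iff.mp h)
  have hN0 : N ≠ 0 := fun h => hPbot (Ideal.absNorm_eq_zero_iff.mp h)
  have hNP : (N : 𝓞 K) ∈ P := Ideal.absNorm_mem P
  obtain ⟨p, hp, hpP, hpN⟩ : ∃ p : ℕ, p.Prime ∧ (p : 𝓞 K) ∈ P ∧ p ≤ N := by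
    clear_value N
    clear hle hN hN1
    induction N using induction_on_primes with
    | zero => exact absurd rfl hN0
    | one => exact absurd ((Ideal.eq_top_iff_one _).mpr (by simpa using hNP)) hP.ne_top
    | prime_mul q m hq ih =>
      rw [Nat.cast_mul] at hNP
      have hm0 : m ≠ 0 := right_ne_zero_of_mul hN0
      rcases hP.mem_or_mem hNP with h | h
      · exact ⟨q, hq, h, Nat.le_mul_of_pos_right _ (Nat.pos_of_ne_zero hm0)⟩
      · obtain ⟨p, hp, hpP, hpm⟩ := ih hm0 h
        exact ⟨p, hp, hpP, hpm.trans (Nat.le_mul_of_pos_left _ hq.pos)⟩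
  have hpb : 9 * (p : ℤ) ^ 2 ≤ 4 * |t ^ 2 - 4 * n| := by
    rw [hdisc, hK] at hle
    have hr2 : InfinitePlace.nrComplexPlaces K ≤ 1 := by
      have := InfinitePlace.card_add_two_mul_card_eq_rank K
      omega
    have h43 : (1 : ℝ) ≤ 4 / Real.pi := by
      rw [le_div_iff₀ Real.pi_pos]; linarith [Real.pi_le_four]
    have h2 : (4 / Real.pi) ^ InfinitePlace.nrComplexPlaces K ≤ 4 / 3 := by
      calc _ ≤ (4 / Real.pi) ^ 1 := pow_le_pow_right₀ h43 hr2
        _ ≤ 4 / 3 := by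
          rw [pow_one]
          exact div_le_div_of_nonneg_left (by norm_num) (by norm_num) Real.pi_gt_three.le
    have hpN' : (p : ℝ) ≤ N := by exact_mod_cast hpN
    set d : ℝ := |((t ^ 2 - 4 * n : ℤ) : ℝ)| with hd
    have h3 : (p : ℝ) ≤ 2 / 3 * Real.sqrt d := by
      calc (p : ℝ) ≤ _ := hpN'
        _ ≤ _ := hle
        _ ≤ 4 / 3 * (((2 : ℕ).factorial : ℝ) / ((2 : ℕ) : ℝ) ^ 2 * Real.sqrt d) := by
          gcongr
        _ = _ := by norm_num [Nat.factorial]; ring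
    have h4 : (p : ℝ) ^ 2 ≤ 4 / 9 * d := by
      calc (p : ℝ) ^ 2 ≤ (2 / 3 * Real.sqrt d) ^ 2 := by gcongr
        _ = _ := by rw [mul_pow, Real.sq_sqrt (hd ▸ abs_nonneg _)]; norm_num
    have h5 : 9 * (p : ℝ) ^ 2 ≤ 4 * d := by linarith
    rw [hd] at h5
    exact_mod_cast h5
  have hpi := hinert p hp hpb
  have hpZ : Prime (p : ℤ) := Nat.prime_iff_prime_int.mp hp
  have hs_int : ∀ m : ℤ, (m : 𝓞 K) ∈ P → (p : ℤ) ∣ m := by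
    intro m hm
    by_contra hc
    obtain ⟨r, s, hrs⟩ := (hpZ.coprime_iff_not_dvd).mpr hc
    apply hP.ne_top
    rw [Ideal.eq_top_iff_one]
    have : (1 : 𝓞 K) = r * p + s * m := by exact_mod_cast congrArg (Int.cast (R := 𝓞 K)) hrs.symm
    rw [this]
    exact P.add_mem (P.mul_mem_left _ hpP) (P.mul_mem_left _ hm)
  refine ⟨⟨(p : 𝓞 K), le_antisymm (fun α hα => ?_) ?_⟩⟩
  · obtain ⟨x, y, rfl⟩ := hspan α
    have h1 : (p : ℤ) ∣ x ^ 2 + t * x * y + n * y ^ 2 := by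
      apply hs_int
      have : ((x ^ 2 + t * x * y + n * y ^ 2 : ℤ) : 𝓞 K) =
          (x + t * y - y * ω) * (x + y * ω) := by
        push_cast; linear_combination (y : 𝓞 K) ^ 2 * hω
      rw [this]
      exact P.mul_mem_left _ hα
    have hy : (p : ℤ) ∣ y := by
      by_contra hc
      obtain ⟨r, s, hrs⟩ := (hpZ.coprime_iff_not_dvd).mpr hc
      apply hpi (s * x)
      obtain ⟨c, hc⟩ := h1
      refine ⟨c * s ^ 2 + t * s * x * r + n * r * (1 + s * y), ?_⟩
      linear_combination s ^ 2 * hc - (t * s * x + n * (1 + s * y)) * hrs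
    have hx : (p : ℤ) ∣ x := by
      obtain ⟨w, rfl⟩ := hy
      have : (p : ℤ) ∣ x ^ 2 := by
        obtain ⟨c, hc⟩ := h1
        exact ⟨c - t * x * w - n * p * w ^ 2, by linear_combination hc⟩
      exact hpZ.dvd_of_dvd_pow this
    obtain ⟨z, rfl⟩ := hx
    obtain ⟨w, rfl⟩ := hy
    exact Ideal.mem_span_singleton.mpr ⟨z + w * ω, by push_cast; ring⟩
  · exact (Ideal.span_singleton_le_iff_mem _).mpr hpP

end ClassNumberOne

theorem exponent_classGroup_eq_one_iff (K : Type) [Field K] [NumberField K] :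
    Monoid.exponent (ClassGroup (𝓞 K)) = 1 ↔ IsPrincipalIdealRing (𝓞 K) := by
  rw [Monoid.exp_eq_one_iff, ← card_classGroup_eq_one_iff]
  rw [Fintype.card_eq_one_iff_nonempty_unique]
  constructor
  · intro h
    exact ⟨⟨⟨1⟩, fun a => Subsingleton.elim _ _⟩⟩
  · rintro ⟨h⟩
    infer_instance

/-- The prime values that obstruct unique factorization are excluded by a residue computation. -/
theorem isPrincipalIdealRing_of_discr (K : Type) [Field K] [NumberField K]
    (hK : Module.finrank ℚ K = 2)
    (hD : NumberField.discr K ∈ ({-3, -4, -7, -8, -11, -19, -43, -67, -163} : Set ℤ)) :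
    IsPrincipalIdealRing (𝓞 K) := by
  obtain ⟨ω, t, n, ht, hω, hdisc, hspan, hind⟩ := exists_integral_basis K hK
  refine isPrincipalIdealRing_of_inert hK hω hdisc hspan ?_
  intro p hp hle a hdvd
  rw [← hdisc] at hle
  have h2 := hp.two_le
  have key (q : ℕ) (c : ℤ) (hpq : p = q) (hc : n = c) (ht : t = 1)
      (h : ∀ b : ZMod q, b ^ 2 + b + c ≠ 0) : False := by
    subst hpq hc ht
    refine h a ?_
    simpa using (ZMod.intCast_zmod_eq_zero_iff_dvd _ _).mpr hdvd
  have hp8 : p ≤ 8 := by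
    have hb : |NumberField.discr K| ≤ 163 := by
      rcases hD with h | h | h | h | h | h | h | h | h <;> rw [h] <;> norm_num
    nlinarith
  simp only [Set.mem_insert_iff, Set.mem_singleton_iff] at hD
  have hp' : p = 2 ∨ p = 3 ∨ p = 5 ∨ p = 7 := by
    clear * - hp hp8
    interval_cases p <;> revert hp <;> decide
  rcases hD with h | h | h | h | h | h | h | h | h <;>
  rcases ht with rfl | rfl <;>
  rw [h] at hle hdisc <;>
  first
  | (exfalso; omega)
  | rcases hp' with rfl | rfl | rfl | rfl <;> norm_num at hle
    all_goals first
      | exact key 2 3 rfl (by omega) rfl (by decide)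
      | exact key 2 5 rfl (by omega) rfl (by decide)
      | exact key 2 11 rfl (by omega) rfl (by decide)
      | exact key 3 11 rfl (by omega) rfl (by decide)
      | exact key 2 17 rfl (by omega) rfl (by decide)
      | exact key 3 17 rfl (by omega) rfl (by decide)
      | exact key 5 17 rfl (by omega) rfl (by decide)
      | exact key 2 41 rfl (by omega) rfl (by decide)
      | exact key 3 41 rfl (by omega) rfl (by decide)
      | exact key 5 41 rfl (by omega) rfl (by decide)
      | exact key 7 41 rfl (by omega) rfl (by decide)

/-- Primes `p` paired with a bit mask for the residues `r` such that `a ^ 2 + a + r` has a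
zero modulo `p`. -/
def sieveTable : List (ℕ × ℕ) :=
  [(11, 1581), (13, 3779), (17, 64049), (19, 434611), (23, 3352701), (29, 484942405),
    (31, 1656244699),
    (37, 41795129487), (41, 1769205706049), (43, 4272964856999),
    (47, 50910575337337), (53, 4173294823643165), (59, 500991108313177417),
    (61, 2057843934467986611)]

/-- The analogue of `sieveTable` for the primes below `10`. -/
def smallSieveTable : List (ℕ × ℕ) := [(2, 1), (3, 3), (5, 25), (7, 39)]

/-- Some `a ^ 2 + a + n` has a prime factor below `n` taken from the table. -/
def sieved (T : List (ℕ × ℕ)) (n : ℕ) : Bool :=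
  T.any fun e => decide (e.1 < n) && Nat.testBit e.2 (n % e.1)

def sieveBlock (s : ℕ) : Bool :=
  [11, 17, 41, 101, 137, 167].all fun r =>
    decide (210 * s + r ≤ 41) || sieved sieveTable (210 * s + r)

def sieveRange : ℕ → ℕ → Bool
  | 0, s => sieveBlock s
  | k + 1, s => sieveRange k s && sieveRange k (s + 2 ^ k)

theorem sieveBlock_of_sieveRange {k s : ℕ} (h : sieveRange k s = true) {i : ℕ} (hi : s ≤ i)
    (hi' : i < s + 2 ^ k) : sieveBlock i = true := by
  induction k generalizing s with
  | zero =>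
    obtain rfl : i = s := by simp at hi'; omega
    exact h
  | succ k ih =>
    simp only [sieveRange, Bool.and_eq_true] at h
    rw [pow_succ] at hi'
    by_cases hc : i < s + 2 ^ k
    · exact ih h.1 hi hc
    · exact ih h.2 (by omega) (by omega)

theorem sieveRange_thirteen : sieveRange 13 0 = true := by decide +kernel

theorem sieve_sound : ∀ e ∈ smallSieveTable ++ sieveTable, Nat.Prime e.1 ∧
    ∀ r < e.1, Nat.testBit e.2 r = true → ∃ a < e.1, e.1 ∣ a ^ 2 + a + r := by
  decide +kernel

theorem exists_prime_dvd_of_sieved {T : List (ℕ × ℕ)} {n : ℕ}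
    (hT : ∀ e ∈ T, e ∈ smallSieveTable ++ sieveTable) (h : sieved T n = true) :
    ∃ p : ℕ, p.Prime ∧ p < n ∧ ∃ a : ℤ, (p : ℤ) ∣ a ^ 2 + a + n := by
  simp only [sieved, List.any_eq_true, Bool.and_eq_true, decide_eq_true_eq] at h
  obtain ⟨e, he, hlt, hbit⟩ := h
  obtain ⟨hp, hs⟩ := sieve_sound e (hT e he)
  obtain ⟨a, -, ha⟩ := hs _ (Nat.mod_lt _ hp.pos) hbit
  refine ⟨e.1, hp, hlt, a, ?_⟩
  have h1 : (e.1 : ℤ) ∣ (a : ℤ) ^ 2 + a + (n % e.1 : ℕ) := by exact_mod_cast ha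
  have h2 : (n : ℤ) = (n % e.1 : ℕ) + e.1 * (n / e.1 : ℕ) := by
    exact_mod_cast (Nat.mod_add_div n e.1).symm
  rw [h2, ← add_assoc]
  exact dvd_add h1 (dvd_mul_right _ _)

theorem small_residues : ∀ r < 210, r ∈ [11, 17, 41, 101, 137, 167] ∨
    ∃ e ∈ smallSieveTable, Nat.testBit e.2 (r % e.1) = true ∧ e.1 ∣ 210 ∧ e.1 ≤ 7 := by
  decide +kernel

theorem exists_prime_dvd_of_le {n : ℕ} (h1 : 41 < n) (h2 : n ≤ 1000000) :
    ∃ p : ℕ, p.Prime ∧ p < n ∧ ∃ a : ℤ, (p : ℤ) ∣ a ^ 2 + a + n := by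
  rcases small_residues (n % 210) (Nat.mod_lt _ (by norm_num)) with h | ⟨e, he, hb, hd, hle⟩
  · have hb := sieveBlock_of_sieveRange sieveRange_thirteen (i := n / 210) (Nat.zero_le _)
      (by norm_num; omega)
    have := List.all_eq_true.mp hb _ h
    rw [Nat.div_add_mod] at this
    rcases (Bool.or_eq_true _ _).mp this with h | h
    · simp at h; omega
    · exact exists_prime_dvd_of_sieved (fun e he => List.mem_append_right _ he) h
  · refine exists_prime_dvd_of_sieved (T := smallSieveTable)
      (fun e he => List.mem_append_left _ he) ?_
    simp only [sieved, List.any_eq_true, Bool.and_eq_true, decide_eq_true_eq]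
    exact ⟨e, he, by omega, by rwa [Nat.mod_mod_of_dvd _ hd] at hb⟩

/-- The form `x ^ 2 + x y + n y ^ 2` represents every prime dividing one of the values
`a ^ 2 + a + n`. -/
def RepresentsPrimes (n : ℕ) : Prop :=
  ∀ p : ℕ, p.Prime → ∀ a : ℤ, (p : ℤ) ∣ a ^ 2 + a + n →
    ∃ x y : ℤ, x ^ 2 + x * y + n * y ^ 2 = p

theorem RepresentsPrimes.le {n : ℕ} (h : RepresentsPrimes n) {p : ℕ} (hp : p.Prime) {a : ℤ}
    (ha : (p : ℤ) ∣ a ^ 2 + a + n) : n ≤ p := by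
  obtain ⟨x, y, hxy⟩ := h p hp a ha
  rcases eq_or_ne y 0 with rfl | hy
  · exfalso
    have hx : x.natAbs ^ 2 = p := by
      zify
      rw [sq_abs]
      linarith
    exact (Nat.Prime.not_prime_pow le_rfl) (hx ▸ hp)
  · have hy1 : 1 ≤ y ^ 2 := by
      have := sq_pos_of_ne_zero hy
      omega
    have h4 : (4 * p : ℤ) ≥ 4 * n - 1 := by
      by_cases hn : n = 0
      · subst hn; push_cast; omega
      · have hn1 : (1 : ℤ) ≤ n := by exact_mod_cast Nat.one_le_iff_ne_zero.mpr hn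
        nlinarith [sq_nonneg (2 * x + y)]
    omega

theorem small_values : ∀ n ≤ 41, 1 ≤ n → n ∈ [1, 2, 3, 5, 11, 17, 41] ∨
    ∃ p < n, p.Prime ∧ ∃ a < p, p ∣ a ^ 2 + a + n := by
  decide +kernel

theorem RepresentsPrimes.cases {n : ℕ} (h : RepresentsPrimes n) (hn : 1 ≤ n) :
    n ∈ [1, 2, 3, 5, 11, 17, 41] ∨
      (1000000 < n ∧ n % 6 = 5 ∧ (4 * n - 1).Prime) := by
  by_cases h41 : n ≤ 41
  · rcases small_values n h41 hn with h1 | ⟨p, hpn, hp, a, -, ha⟩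
    · exact Or.inl h1
    · have := h.le hp (a := a) (by exact_mod_cast ha)
      omega
  by_cases h6 : n ≤ 1000000
  · obtain ⟨p, hp, hlt, a, ha⟩ := exists_prime_dvd_of_le (by omega) h6
    have := h.le hp ha
    omega
  refine Or.inr ⟨by omega, ?_, ?_⟩
  · by_contra hc
    have : n % 2 = 0 ∨ n % 3 = 0 ∨ n % 3 = 1 := by omega
    rcases this with h1 | h1 | h1
    · have := h.le Nat.prime_two (a := 0) (by omega)
      omega
    · have := h.le Nat.prime_three (a := 0) (by omega)
      omega
    · have := h.le Nat.prime_three (a := 1) (by omega)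
      omega
  · by_contra hc
    have hq := Nat.minFac_prime (n := 4 * n - 1) (by omega)
    have hsq := Nat.minFac_sq_le_self (by omega) hc
    have hd := Nat.minFac_dvd (4 * n - 1)
    set q := (4 * n - 1).minFac
    have hodd : q % 2 = 1 := by
      rcases hq.eq_two_or_odd with h2 | h2
      · rw [h2] at hd; omega
      · exact h2
    have hle : n ≤ q := by
      refine h.le hq (a := ((q / 2 : ℕ) : ℤ)) ?_
      have hco : IsCoprime (q : ℤ) 4 := by
        rw [show (4 : ℤ) = ((4 : ℕ) : ℤ) by norm_num, Nat.isCoprime_iff_coprime]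
        exact (Nat.Coprime.pow_right 2 (Nat.coprime_two_right.mpr (Nat.odd_iff.mpr hodd)))
      refine hco.dvd_of_dvd_mul_left ?_
      have hq2 : (q : ℤ) = 2 * ((q / 2 : ℕ) : ℤ) + 1 := by omega
      have h4 : ((4 * n - 1 : ℕ) : ℤ) = 4 * n - 1 := by omega
      have hd' : (q : ℤ) ∣ 4 * n - 1 := h4 ▸ Int.natCast_dvd_natCast.mpr hd
      have : (4 * (((q / 2 : ℕ) : ℤ) ^ 2 + ((q / 2 : ℕ) : ℤ) + n) : ℤ) = q * q + (4 * n - 1) := by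
        rw [hq2]; ring
      rw [this]
      exact dvd_add (dvd_mul_right _ _) hd'
    have : n * n ≤ 4 * n - 1 := le_trans (Nat.mul_le_mul hle hle) (by rw [← sq]; exact hsq)
    have : n * n ≥ 5 * n := Nat.mul_le_mul_right n (by omega)
    omega

/-- The norm form `x ^ 2 + x y + n y ^ 2`. -/
def normForm (n : ℕ) (z : ℤ × ℤ) : ℤ := z.1 ^ 2 + z.1 * z.2 + n * z.2 ^ 2

/-- Multiplication of `x + y ω` by `u + v ω`, where `ω ^ 2 = ω - n`. -/
def formMul (n : ℕ) (a z : ℤ × ℤ) : ℤ × ℤ :=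
  (z.1 * a.1 - n * z.2 * a.2, z.1 * a.2 + z.2 * a.1 + z.2 * a.2)

def formConj (a : ℤ × ℤ) : ℤ × ℤ := (a.1 + a.2, -a.2)

theorem normForm_formMul (n : ℕ) (a z : ℤ × ℤ) :
    normForm n (formMul n a z) = normForm n a * normForm n z := by
  simp only [normForm, formMul]; ring

theorem normForm_formConj (n : ℕ) (a : ℤ × ℤ) : normForm n (formConj a) = normForm n a := by
  simp only [normForm, formConj]; ring

theorem formMul_formConj (n : ℕ) (a z : ℤ × ℤ) :
    formMul n (formConj a) (formMul n a z) = (normForm n a * z.1, normForm n a * z.2) := by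
  simp only [normForm, formMul, formConj]; ext <;> ring

theorem formMul_formConj' (n : ℕ) (a z : ℤ × ℤ) :
    formMul n a (formMul n (formConj a) z) = (normForm n a * z.1, normForm n a * z.2) := by
  simp only [normForm, formMul, formConj]; ext <;> ring

theorem formMul_injective {n : ℕ} {a : ℤ × ℤ} (ha : normForm n a ≠ 0) :
    Function.Injective (formMul n a) := by
  intro z w h
  have := congrArg (formMul n (formConj a)) h
  rw [formMul_formConj, formMul_formConj, Prod.mk.injEq] at this
  exact Prod.ext (mul_left_cancel₀ ha this.1) (mul_left_cancel₀ ha this.2)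

theorem four_mul_normForm (n : ℕ) (z : ℤ × ℤ) :
    4 * normForm n z = (2 * z.1 + z.2) ^ 2 + (4 * n - 1) * z.2 ^ 2 := by
  simp only [normForm]; ring

/-- The representations of `N` by the norm form. -/
def repSet (n N : ℕ) : Set (ℤ × ℤ) := {z | normForm n z = N}

theorem repSet_finite {n : ℕ} (hn : 1 ≤ n) (N : ℕ) : (repSet n N).Finite := by
  refine ((Set.finite_Icc (-(4 * N + 4 * N) : ℤ) (4 * N + 4 * N)).prod
    (Set.finite_Icc (-(4 * N) : ℤ) (4 * N))).subset ?_
  rintro ⟨x, y⟩ h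
  have h4 := four_mul_normForm n (x, y)
  rw [show normForm n (x, y) = N from h] at h4
  dsimp only at h4
  have hn' : (1 : ℤ) ≤ n := by exact_mod_cast hn
  have hy : y ^ 2 ≤ 4 * N := by nlinarith [sq_nonneg (2 * x + y), sq_nonneg y]
  have hx : (2 * x + y) ^ 2 ≤ 4 * N := by nlinarith [sq_nonneg y]
  have hy' : |y| ≤ 4 * N := by
    refine le_trans ?_ hy
    rw [← sq_abs]
    exact Int.le_self_sq _
  have hx' : |2 * x + y| ≤ 4 * N := by
    refine le_trans ?_ hx
    rw [← sq_abs]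
    exact Int.le_self_sq _
  rw [abs_le] at hx' hy'
  rw [Set.mem_prod, Set.mem_Icc, Set.mem_Icc]
  dsimp only
  omega

section
variable {n p : ℕ}

theorem not_dvd_snd (hp : p.Prime) {a : ℤ × ℤ} (ha : normForm n a = p) : ¬ (p : ℤ) ∣ a.2 := by
  intro h
  have hpi := Nat.prime_iff_prime_int.mp hp
  have h1 : (p : ℤ) ∣ a.1 := by
    refine hpi.dvd_of_dvd_pow (n := 2) ?_
    have : a.1 ^ 2 = p - a.2 * (a.1 + n * a.2) := by
      rw [← ha]; simp only [normForm]; ring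
    rw [this]
    exact dvd_sub_self_left.mpr (h.mul_right _)
  obtain ⟨c, hc⟩ := h
  obtain ⟨b, hb⟩ := h1
  have h2 : (p : ℤ) * (p * (b ^ 2 + b * c + n * c ^ 2)) = p * 1 := by
    rw [mul_one]
    nth_rw 3 [← ha]
    simp only [normForm]
    rw [hb, hc]; ring
  have h3 := mul_left_cancel₀ hpi.ne_zero h2
  exact hpi.not_isUnit (IsUnit.of_mul_eq_one _ h3)

theorem exists_formMul_eq_of_dvd (hp : p.Prime) {a z : ℤ × ℤ} (ha : normForm n a = p)
    (h : (p : ℤ) ∣ z.2 * a.1 - z.1 * a.2) : ∃ w, z = formMul n a w := by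
  have hpi := Nat.prime_iff_prime_int.mp hp
  have h2 : (p : ℤ) ∣ z.1 * (a.1 + a.2) + n * z.2 * a.2 := by
    refine (hpi.dvd_mul.mp ?_).resolve_left (not_dvd_snd hp ha)
    have : a.2 * (z.1 * (a.1 + a.2) + n * z.2 * a.2) =
        p * z.2 - (z.2 * a.1 - z.1 * a.2) * (a.1 + a.2) := by
      rw [← ha]; simp only [normForm]; ring
    rw [this]
    exact dvd_sub (dvd_mul_right _ _) (h.mul_right _)
  obtain ⟨c, hc⟩ := h
  obtain ⟨b, hb⟩ := h2
  refine ⟨(b, c), ?_⟩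
  have hz : formMul n (formConj a) z = (p * b, p * c) := by
    rw [← hb, ← hc]
    simp only [formMul, formConj]; ext <;> ring
  have h3 := formMul_formConj' n a z
  rw [hz, ha] at h3
  have h4 : formMul n a (p * b, p * c) =
      (p * (formMul n a (b, c)).1, p * (formMul n a (b, c)).2) := by
    simp only [formMul]; ext <;> ring
  rw [h4, Prod.mk.injEq] at h3
  exact Prod.ext (mul_left_cancel₀ hpi.ne_zero h3.1.symm) (mul_left_cancel₀ hpi.ne_zero h3.2.symm)

theorem repSet_mul_eq_union (hp : p.Prime) {a : ℤ × ℤ} (ha : normForm n a = p) (N : ℕ) :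
    repSet n (p * N) = formMul n a '' repSet n N ∪ formMul n (formConj a) '' repSet n N := by
  have hpi := Nat.prime_iff_prime_int.mp hp
  have hac : normForm n (formConj a) = p := by rw [normForm_formConj, ha]
  have key : ∀ b w : ℤ × ℤ, normForm n b = p →
      (normForm n (formMul n b w) = (p * N : ℕ) ↔ normForm n w = N) := by
    intro b w hb
    rw [normForm_formMul, hb, Nat.cast_mul]
    exact mul_right_inj' hpi.ne_zero
  ext z
  constructor
  · intro hz
    have hz' : normForm n z = (p * N : ℕ) := hz
    have hprod : (p : ℤ) ∣ (z.2 * a.1 - z.1 * a.2) *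
        (z.2 * (formConj a).1 - z.1 * (formConj a).2) := by
      have : (z.2 * a.1 - z.1 * a.2) * (z.2 * (formConj a).1 - z.1 * (formConj a).2) =
          normForm n a * z.2 ^ 2 - a.2 ^ 2 * normForm n z := by
        simp only [normForm, formConj]; ring
      rw [this, ha, hz', Nat.cast_mul]
      exact dvd_sub (dvd_mul_right _ _) (Dvd.intro _ (by ring : (p : ℤ) * (N * a.2 ^ 2) = _))
    rcases hpi.dvd_mul.mp hprod with h | h
    · obtain ⟨w, rfl⟩ := exists_formMul_eq_of_dvd hp ha h
      exact Or.inl ⟨w, (key a w ha).mp hz', rfl⟩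
    · obtain ⟨w, rfl⟩ := exists_formMul_eq_of_dvd hp hac h
      exact Or.inr ⟨w, (key _ w hac).mp hz', rfl⟩
  · rintro (⟨w, hw, rfl⟩ | ⟨w, hw, rfl⟩)
    · exact (key a w ha).mpr hw
    · exact (key _ w hac).mpr hw

/-- The elements of `repSet n (p * N)` divisible by `p`. -/
theorem ncard_divisible (hp : p.Prime) (N : ℕ) :
    {z ∈ repSet n (p * N) | (p : ℤ) ∣ z.1 ∧ (p : ℤ) ∣ z.2}.ncard =
      if p ∣ N then (repSet n (N / p)).ncard else 0 := by
  have hpi := Nat.prime_iff_prime_int.mp hp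
  have key (x y : ℤ) : normForm n (p * x, p * y) = (p * N : ℕ) ↔ p * normForm n (x, y) = N := by
    rw [show normForm n (p * x, p * y) = p * (p * normForm n (x, y)) by
      simp only [normForm]; ring, Nat.cast_mul]
    exact mul_right_inj' hpi.ne_zero
  split_ifs with hpN
  · obtain ⟨M, rfl⟩ := hpN
    rw [Nat.mul_div_cancel_left _ hp.pos]
    have : {z ∈ repSet n (p * (p * M)) | (p : ℤ) ∣ z.1 ∧ (p : ℤ) ∣ z.2} =
        (fun z : ℤ × ℤ => (p * z.1, p * z.2)) '' repSet n M := by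
      ext ⟨x, y⟩
      constructor
      · rintro ⟨h, ⟨b, rfl⟩, ⟨c, rfl⟩⟩
        refine ⟨(b, c), ?_, rfl⟩
        have := (key b c).mp h
        rw [Nat.cast_mul] at this
        exact mul_left_cancel₀ hpi.ne_zero this
      · rintro ⟨⟨b, c⟩, h, hbc⟩
        obtain ⟨rfl, rfl⟩ := Prod.mk.inj hbc
        refine ⟨(key b c).mpr ?_, dvd_mul_right _ _, dvd_mul_right _ _⟩
        rw [show normForm n (b, c) = M from h, Nat.cast_mul]
    rw [this]
    refine Set.ncard_image_of_injective _ fun z w h => ?_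
    obtain ⟨h1, h2⟩ := Prod.mk.inj h
    exact Prod.ext (mul_left_cancel₀ hpi.ne_zero h1) (mul_left_cancel₀ hpi.ne_zero h2)
  · rw [show {z ∈ repSet n (p * N) | (p : ℤ) ∣ z.1 ∧ (p : ℤ) ∣ z.2} = ∅ from ?_, Set.ncard_empty]
    rw [Set.eq_empty_iff_forall_notMem]
    rintro ⟨x, y⟩ ⟨h, ⟨b, rfl⟩, ⟨c, rfl⟩⟩
    apply hpN
    have := (key b c).mp h
    exact Int.natCast_dvd_natCast.mp ⟨_, this.symm⟩

theorem ncard_repSet_split (hn : 1 ≤ n) (hp : p.Prime) {a : ℤ × ℤ} (ha : normForm n a = p)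
    (hpd : ¬ (p : ℤ) ∣ 4 * n - 1) (N : ℕ) :
    (repSet n (p * N)).ncard + (if p ∣ N then (repSet n (N / p)).ncard else 0) =
      2 * (repSet n N).ncard := by
  have hpi := Nat.prime_iff_prime_int.mp hp
  have hac : normForm n (formConj a) = p := by rw [normForm_formConj, ha]
  have hinter : {z ∈ repSet n (p * N) | (p : ℤ) ∣ z.1 ∧ (p : ℤ) ∣ z.2} =
      formMul n a '' repSet n N ∩ formMul n (formConj a) '' repSet n N := by
    ext z
    constructor
    · rintro ⟨hz, hz1, hz2⟩
      have hz' : normForm n z = p * N := by exact_mod_cast hz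
      constructor
      · obtain ⟨w, rfl⟩ := exists_formMul_eq_of_dvd hp ha
          (dvd_sub (hz2.mul_right _) (hz1.mul_right _))
        rw [normForm_formMul, ha] at hz'
        exact ⟨w, mul_left_cancel₀ hpi.ne_zero hz', rfl⟩
      · obtain ⟨w, rfl⟩ := exists_formMul_eq_of_dvd hp hac
          (dvd_sub (hz2.mul_right _) (hz1.mul_right _))
        rw [normForm_formMul, hac] at hz'
        exact ⟨w, mul_left_cancel₀ hpi.ne_zero hz', rfl⟩
    · intro hz
      refine ⟨by rw [repSet_mul_eq_union hp ha]; exact Or.inl hz.1, ?_⟩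
      obtain ⟨⟨w, -, h1⟩, ⟨w', -, h2⟩⟩ := hz
      have e1 : (p : ℤ) ∣ z.2 * a.1 - z.1 * a.2 := by
        refine ⟨w.2, ?_⟩
        rw [← h1, ← ha]; simp only [normForm, formMul]; ring
      have e2 : (p : ℤ) ∣ z.2 * (a.1 + a.2) + z.1 * a.2 := by
        refine ⟨w'.2, ?_⟩
        rw [← h2, ← ha]; simp only [normForm, formMul, formConj]; ring
      have hv := not_dvd_snd hp ha
      have e3 : ¬ (p : ℤ) ∣ 2 * a.1 + a.2 := by
        intro h
        have h4 : (p : ℤ) ∣ (4 * n - 1) * a.2 ^ 2 := by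
          have : (4 * n - 1) * a.2 ^ 2 = p * 4 - (2 * a.1 + a.2) * (2 * a.1 + a.2) := by
            rw [← ha]; simp only [normForm]; ring
          rw [this]
          exact dvd_sub (dvd_mul_right _ _) (h.mul_right _)
        rcases hpi.dvd_mul.mp h4 with h5 | h5
        · exact hpd h5
        · exact hv (hpi.dvd_of_dvd_pow h5)
      have e4 : (p : ℤ) ∣ z.2 := by
        refine (hpi.dvd_mul.mp ?_).resolve_right e3
        have := dvd_add e1 e2
        rwa [show z.2 * a.1 - z.1 * a.2 + (z.2 * (a.1 + a.2) + z.1 * a.2) =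
          z.2 * (2 * a.1 + a.2) by ring] at this
      refine ⟨(hpi.dvd_mul.mp ?_).resolve_right hv, e4⟩
      have := dvd_sub (e4.mul_right a.1) e1
      rwa [sub_sub_cancel] at this
  have hf := repSet_finite hn N
  have hp0 : (p : ℤ) ≠ 0 := hpi.ne_zero
  rw [← ncard_divisible hp N, hinter, repSet_mul_eq_union hp ha,
    Set.ncard_union_add_ncard_inter _ _ (hf.image _) (hf.image _),
    Set.ncard_image_of_injective _ (formMul_injective (ha ▸ hp0)),
    Set.ncard_image_of_injective _ (formMul_injective (hac ▸ hp0)), two_mul]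

theorem ncard_repSet_inert (hp : p.Prime) (h : ∀ a : ℤ, ¬ (p : ℤ) ∣ a ^ 2 + a + n) (N : ℕ) :
    (repSet n (p * N)).ncard = if p ∣ N then (repSet n (N / p)).ncard else 0 := by
  have hpi := Nat.prime_iff_prime_int.mp hp
  rw [← ncard_divisible hp N]
  congr 1
  ext ⟨x, y⟩
  refine ⟨fun hz => ⟨hz, ?_⟩, fun hz => hz.1⟩
  have hz' : x ^ 2 + x * y + n * y ^ 2 = p * N := by exact_mod_cast hz
  have hy : (p : ℤ) ∣ y := by
    by_contra hy
    have hco : IsCoprime (p : ℤ) y := (Prime.coprime_iff_not_dvd hpi).mpr hy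
    obtain ⟨r, s, hrs⟩ := hco
    apply h (x * s)
    have h1 : (x * s) ^ 2 + x * s + n = s ^ 2 * (x ^ 2 + x * y + n * y ^ 2) +
        p * (r * x * s + n * r * (1 + s * y)) := by
      linear_combination (-(x * s) - n * (1 + s * y)) * hrs
    rw [h1, hz']
    exact dvd_add (Dvd.intro _ (by ring : (p : ℤ) * (N * s ^ 2) = _)) (dvd_mul_right _ _)
  refine ⟨hpi.dvd_of_dvd_pow (n := 2) ?_, hy⟩
  change (p : ℤ) ∣ x ^ 2
  have : x ^ 2 = p * N - y * (x + n * y) := by linear_combination hz'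
  rw [this]
  exact dvd_sub (dvd_mul_right _ _) (hy.mul_right _)

theorem ncard_repSet_ramified (hp : p.Prime) (hd : p = 4 * n - 1) (N : ℕ) :
    (repSet n (p * N)).ncard = (repSet n N).ncard := by
  have hpi := Nat.prime_iff_prime_int.mp hp
  have hd' : (p : ℤ) = 4 * n - 1 := by have := hp.pos; omega
  have ha : normForm n (-1, 2) = p := by rw [hd']; simp only [normForm]; ring
  have hp0 : (p : ℤ) ≠ 0 := hpi.ne_zero
  have : formMul n (formConj (-1, 2)) '' repSet n N = formMul n (-1, 2) '' repSet n N := by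
    ext z
    constructor <;>
    · rintro ⟨w, hw, rfl⟩
      refine ⟨(-w.1, -w.2), ?_, by simp only [formMul, formConj]; ext <;> ring⟩
      change normForm n (-w.1, -w.2) = N
      rw [← show normForm n w = N from hw]
      simp only [normForm]
      ring
  rw [repSet_mul_eq_union hp ha, this, Set.union_self,
    Set.ncard_image_of_injective _ (formMul_injective (ha ▸ hp0))]

theorem ncard_repSet_one (hn : 2 ≤ n) : (repSet n 1).ncard = 2 := by
  have : repSet n 1 = {(1, 0), (-1, 0)} := by
    ext ⟨x, y⟩
    simp only [repSet, Set.mem_ofPred_eq, Set.mem_insert_iff, Set.mem_singleton_iff, Prod.mk.injEq]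
    constructor
    · intro h
      have h4 := four_mul_normForm n (x, y)
      rw [h] at h4
      push_cast at h4
      have hn' : (2 : ℤ) ≤ n := by exact_mod_cast hn
      have hy : y = 0 := by
        by_contra hy
        have : 1 ≤ y ^ 2 := by have := sq_pos_of_ne_zero hy; omega
        nlinarith [sq_nonneg (2 * x + y)]
      subst hy
      have : x ^ 2 = 1 := by linarith
      rcases sq_eq_sq_iff_eq_or_eq_neg.mp (this.trans (one_pow 2).symm) with h | h <;> simp [h]
    · rintro (⟨rfl, rfl⟩ | ⟨rfl, rfl⟩) <;> simp [normForm]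
  rw [this, Set.ncard_pair (by decide)]

end

theorem sum_divisors_prime_mul {d : ℕ} (χ : MulChar (ZMod d) ℤ) {p N : ℕ} (hp : p.Prime)
    (hN : N ≠ 0) :
    ∑ e ∈ (p * N).divisors, χ (e : ZMod d) + χ (p : ZMod d) *
      (if p ∣ N then ∑ e ∈ (N / p).divisors, χ (e : ZMod d) else 0) =
    (1 + χ (p : ZMod d)) * ∑ e ∈ N.divisors, χ (e : ZMod d) := by
  have hmul : ∀ M : ℕ, M ≠ 0 → ∑ e ∈ (p * M).divisors with p ∣ e, χ (e : ZMod d) =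
      χ (p : ZMod d) * ∑ e ∈ M.divisors, χ (e : ZMod d) := by
    intro M hM
    rw [Finset.mul_sum]
    symm
    refine Finset.sum_bij (fun e _ => p * e) ?_ ?_ ?_ ?_
    · intro e he
      rw [Finset.mem_filter, Nat.mem_divisors]
      exact ⟨⟨Nat.mul_dvd_mul_left p (Nat.dvd_of_mem_divisors he), mul_ne_zero hp.ne_zero hM⟩,
        dvd_mul_right _ _⟩
    · intro a _ b _ h
      exact Nat.eq_of_mul_eq_mul_left hp.pos h
    · intro b hb
      rw [Finset.mem_filter, Nat.mem_divisors] at hb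
      obtain ⟨⟨h1, -⟩, c, rfl⟩ := hb
      exact ⟨c, Nat.mem_divisors.mpr ⟨Nat.dvd_of_mul_dvd_mul_left hp.pos h1, hM⟩, rfl⟩
    · intro e _
      rw [Nat.cast_mul, map_mul]
  have hnot : ∑ e ∈ (p * N).divisors with ¬ p ∣ e, χ (e : ZMod d) =
      ∑ e ∈ N.divisors with ¬ p ∣ e, χ (e : ZMod d) := by
    refine Finset.sum_congr ?_ fun _ _ => rfl
    ext e
    simp only [Finset.mem_filter, Nat.mem_divisors]
    constructor
    · rintro ⟨⟨h1, -⟩, h2⟩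
      exact ⟨⟨((Nat.Prime.coprime_iff_not_dvd hp).mpr h2).symm.dvd_of_dvd_mul_left h1, hN⟩, h2⟩
    · rintro ⟨⟨h1, -⟩, h2⟩
      exact ⟨⟨h1.mul_left p, mul_ne_zero hp.ne_zero hN⟩, h2⟩
  have hdiv : ∑ e ∈ N.divisors with p ∣ e, χ (e : ZMod d) = χ (p : ZMod d) *
      (if p ∣ N then ∑ e ∈ (N / p).divisors, χ (e : ZMod d) else 0) := by
    split_ifs with h
    · obtain ⟨M, rfl⟩ := h
      rw [Nat.mul_div_cancel_left _ hp.pos, hmul M (right_ne_zero_of_mul hN)]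
    · rw [mul_zero]
      refine Finset.sum_eq_zero fun e he => ?_
      rw [Finset.mem_filter, Nat.mem_divisors] at he
      exact absurd (he.2.trans he.1.1) h
  rw [← hdiv, ← Finset.sum_filter_add_sum_filter_not (p * N).divisors (fun e => p ∣ e),
    hmul N hN, hnot]
  have := Finset.sum_filter_add_sum_filter_not N.divisors (fun e => p ∣ e)
    (fun e => χ (e : ZMod d))
  linear_combination this

section
variable {n d p : ℕ} [Fact d.Prime]

theorem quadraticChar_eq_legendreSym (hn : 4 * n = d + 1) [Fact p.Prime] (hp2 : p ≠ 2) :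
    quadraticChar (ZMod d) (p : ZMod d) = legendreSym p (-d) := by
  have hd2 : d ≠ 2 := by omega
  have h1 : quadraticChar (ZMod d) (p : ZMod d) = legendreSym d p := by
    simp [legendreSym]
  have h2 := legendreSym.quadratic_reciprocity' (p := p) (q := d) hp2 hd2
  rw [h1, h2, neg_eq_neg_one_mul (d : ℤ), legendreSym.mul, legendreSym.at_neg_one hp2,
    ZMod.χ₄_eq_neg_one_pow ((Nat.Prime.mod_two_eq_one_iff_ne_two Fact.out).mpr hp2)]
  congr 1
  have : Odd (d / 2) := by rw [Nat.odd_iff]; omega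
  rw [mul_comm, pow_mul, this.neg_one_pow]

theorem quadraticChar_eq_one (hn : 4 * n = d + 1) (hodd : n % 2 = 1) (hp : p.Prime) (hpd : p ≠ d)
    {a : ℤ} (ha : (p : ℤ) ∣ a ^ 2 + a + n) : quadraticChar (ZMod d) (p : ZMod d) = 1 := by
  have := Fact.mk hp
  have hp2 : p ≠ 2 := by
    rintro rfl
    have h1 : (a ^ 2 + a) % 2 = 0 := by
      have := Int.even_mul_succ_self a
      rw [Int.even_iff] at this
      rwa [show a * (a + 1) = a ^ 2 + a by ring] at this
    omega
  rw [quadraticChar_eq_legendreSym hn hp2]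
  have hd' : (d : ℤ) = 4 * n - 1 := by omega
  have hz : ((-d : ℤ) : ZMod p) = (2 * a + 1) ^ 2 := by
    have := (ZMod.intCast_zmod_eq_zero_iff_dvd _ _).mpr ha
    push_cast at this
    rw [hd']
    push_cast
    linear_combination -4 * this
  have hne : ((-d : ℤ) : ZMod p) ≠ 0 := by
    rw [Ne, ZMod.intCast_zmod_eq_zero_iff_dvd, dvd_neg, Int.natCast_dvd_natCast]
    intro h
    exact hpd ((Nat.prime_dvd_prime_iff_eq hp Fact.out).mp h)
  rw [legendreSym.eq_one_iff p hne]
  exact ⟨2 * a + 1, by rw [hz, sq]⟩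

theorem quadraticChar_eq_neg_one (hn : 4 * n = d + 1) (hodd : n % 2 = 1) (hp : p.Prime)
    (h : ∀ a : ℤ, ¬ (p : ℤ) ∣ a ^ 2 + a + n) :
    quadraticChar (ZMod d) (p : ZMod d) = -1 := by
  have := Fact.mk hp
  rcases eq_or_ne p 2 with rfl | hp2
  · have h1 : quadraticChar (ZMod d) ((2 : ℕ) : ZMod d) = legendreSym d 2 := by
      simp [legendreSym]
    rw [h1, legendreSym.at_two (by omega), ZMod.χ₈_nat_eq_if_mod_eight]
    rw [if_neg (by omega), if_neg (by omega)]
  rw [quadraticChar_eq_legendreSym hn hp2, legendreSym.eq_neg_one_iff]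
  rintro ⟨b, hb⟩
  have hd' : (d : ℤ) = 4 * n - 1 := by omega
  have h2 : (2 : ZMod p) ≠ 0 := by
    have : ((2 : ℕ) : ZMod p) ≠ 0 := by
      rw [Ne, ZMod.natCast_eq_zero_iff]
      exact fun h => hp2 ((Nat.prime_dvd_prime_iff_eq hp Nat.prime_two).mp h)
    simpa using this
  obtain ⟨a, ha⟩ := ZMod.intCast_surjective ((b - 1) / 2 : ZMod p)
  apply h a
  rw [← ZMod.intCast_zmod_eq_zero_iff_dvd]
  push_cast
  rw [hd'] at hb
  push_cast at hb
  rw [ha]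
  field_simp
  linear_combination -hb

/-- The number of representations of `N` by the norm form, when every prime value condition
holds. -/
theorem ncard_repSet (h : RepresentsPrimes n) (hn : 4 * n = d + 1) (hodd : n % 2 = 1)
    (hn2 : 2 ≤ n) {N : ℕ} (hN : N ≠ 0) :
    ((repSet n N).ncard : ℤ) = 2 * ∑ e ∈ N.divisors, quadraticChar (ZMod d) (e : ZMod d) := by
  induction N using Nat.strong_induction_on with
  | _ N ih =>
  rcases eq_or_ne N 1 with rfl | hN1
  · rw [ncard_repSet_one hn2]; simp
  obtain ⟨p, hp, M, rfl⟩ := Nat.exists_prime_and_dvd hN1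
  have hM : M ≠ 0 := right_ne_zero_of_mul hN
  have hMlt : M < p * M := by have := hp.two_le; nlinarith [Nat.pos_of_ne_zero hM]
  have ih1 := ih M hMlt hM
  have ih2 : ((if p ∣ M then (repSet n (M / p)).ncard else 0 : ℕ) : ℤ) = 2 *
      if p ∣ M then ∑ e ∈ (M / p).divisors, quadraticChar (ZMod d) (e : ZMod d) else 0 := by
    split_ifs with hpM
    · exact ih _ (lt_of_le_of_lt (Nat.div_le_self _ _) hMlt)
        (Nat.div_pos (Nat.le_of_dvd (Nat.pos_of_ne_zero hM) hpM) hp.pos).ne'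
    · simp
  have hrec := sum_divisors_prime_mul (quadraticChar (ZMod d)) hp hM
  by_cases hin : ∀ a : ℤ, ¬ (p : ℤ) ∣ a ^ 2 + a + n
  · have hχ := quadraticChar_eq_neg_one hn hodd hp hin
    rw [ncard_repSet_inert hp hin, ih2]
    rw [hχ] at hrec
    linear_combination -2 * hrec
  push Not at hin
  obtain ⟨a, ha⟩ := hin
  obtain ⟨x, y, hxy⟩ := h p hp a ha
  rcases eq_or_ne p d with rfl | hpd
  · have hχ : quadraticChar (ZMod p) (p : ZMod p) = 0 := by simp
    rw [ncard_repSet_ramified hp (by omega), ih1]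
    rw [hχ] at hrec
    linear_combination -2 * hrec
  · have hχ := quadraticChar_eq_one hn hodd hp hpd ha
    have hs := ncard_repSet_split (by omega) hp (a := (x, y)) hxy (fun hd => hpd <| by
      have hd' : (4 * n - 1 : ℤ) = d := by omega
      rw [hd', Int.natCast_dvd_natCast] at hd
      exact (Nat.prime_dvd_prime_iff_eq hp Fact.out).mp hd) M
    have hs' : ((repSet n (p * M)).ncard : ℤ) +
        ((if p ∣ M then (repSet n (M / p)).ncard else 0 : ℕ) : ℤ) = 2 * (repSet n M).ncard := by
      exact_mod_cast hs
    rw [ih1, ih2] at hs'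
    rw [hχ] at hrec
    linear_combination hs' - 2 * hrec

end

theorem HasSum.of_forall_eq {ι α : Type*} [AddCommMonoid α] [TopologicalSpace α] {f g : ι → α}
    {a : α} (h : HasSum g a)
    (e : ∀ i, f i = g i) : HasSum f a := by
  rwa [funext e]

theorem LSeries_term_ofReal (f : ℕ → ℝ) {s : ℝ} (hs : s ≠ 0) (n : ℕ) :
    LSeries.term (fun n => (f n : ℂ)) s n = ((f n * (n : ℝ) ^ (-s) : ℝ) : ℂ) := by
  rcases eq_or_ne n 0 with rfl | hn
  · simp [Real.zero_rpow (neg_ne_zero.mpr hs)]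
  · rw [LSeries.term_of_ne_zero hn, Complex.ofReal_mul, Complex.ofReal_cpow (Nat.cast_nonneg n),
      Complex.ofReal_neg, Complex.ofReal_natCast, Complex.cpow_neg, div_eq_mul_inv]

theorem hasSum_convolution {f g : ℕ → ℝ} (hf : ∀ n, |f n| ≤ 1) (hg : ∀ n, |g n| ≤ 1) {s : ℝ}
    (hs : 1 < s) :
    HasSum (fun n : ℕ => (∑ p ∈ n.divisorsAntidiagonal, f p.1 * g p.2) * (n : ℝ) ^ (-s))
      ((∑' n : ℕ, f n * (n : ℝ) ^ (-s)) * ∑' n : ℕ, g n * (n : ℝ) ^ (-s)) := by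
  have hs0 : s ≠ 0 := by linarith
  have key : ∀ h : ℕ → ℝ, (∀ n, |h n| ≤ 1) →
      LSeriesHasSum (fun n => (h n : ℂ)) s ((∑' n : ℕ, h n * (n : ℝ) ^ (-s) : ℝ) : ℂ) := by
    intro h hh
    have h1 : LSeriesSummable (fun n => (h n : ℂ)) s :=
      LSeriesSummable_of_bounded_of_one_lt_re (m := 1)
        (fun n _ => by simpa using hh n) (by simpa using hs)
    have h2 := h1.hasSum
    rw [tsum_congr fun n => LSeries_term_ofReal h hs0 n, ← Complex.ofReal_tsum] at h2
    exact h2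
  have h2 := LSeriesHasSum.convolution (key f hf) (key g hg)
  rw [← Complex.ofReal_mul] at h2
  rw [← Complex.hasSum_ofReal]
  refine HasSum.of_forall_eq h2 fun n => ?_
  refine (LSeries_term_ofReal (fun n => ∑ p ∈ n.divisorsAntidiagonal, f p.1 * g p.2)
    hs0 n).symm.trans ?_
  congr 1
  funext m
  rw [LSeries.convolution_def]
  push_cast
  rfl

theorem abs_mulChar_le_one {k : ℕ} [NeZero k] (χ : MulChar (ZMod k) ℤ) (a : ZMod k) :
    |(χ a : ℝ)| ≤ 1 := by
  by_cases ha : IsUnit a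
  · have h1 := (ha.map χ)
    rcases Int.isUnit_iff.mp h1 with h | h <;> simp [h]
  · simp [χ.map_nonunit ha]

/-- A sum over the integer points, grouped by the value of the norm form. -/
theorem hasSum_normForm {n : ℕ} (hn : 1 ≤ n) {g : ℕ → ℝ} {S : ℝ}
    (h : HasSum (fun N : ℕ => (repSet n N).ncard * g N) S)
    (habs : Summable (fun N : ℕ => (repSet n N).ncard * |g N|)) :
    HasSum (fun z : ℤ × ℤ => g (normForm n z).toNat) S ∧
      Summable (fun z : ℤ × ℤ => |g (normForm n z).toNat|) := by
  set Q : ℤ × ℤ → ℕ := fun z => (normForm n z).toNat with hQ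
  have hpos : ∀ z, 0 ≤ normForm n z := by
    intro z
    have h4 := four_mul_normForm n z
    have hn' : (1 : ℤ) ≤ n := by exact_mod_cast hn
    nlinarith [sq_nonneg (2 * z.1 + z.2), sq_nonneg z.2]
  have hfib : ∀ N, {z | Q z = N} = repSet n N := by
    intro N
    ext z
    change (normForm n z).toNat = N ↔ normForm n z = N
    have := hpos z
    omega
  have hfin : ∀ N, Finite {z // Q z = N} := fun N => by
    have := repSet_finite hn N
    rw [← hfib] at this
    exact this
  have hsum : ∀ (f : ℕ → ℝ) N, HasSum (fun z : {z // Q z = N} => f (Q z))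
      ((repSet n N).ncard * f N) := by
    intro f N
    have := hfin N
    have := Fintype.ofFinite {z // Q z = N}
    have h1 : (fun z : {z // Q z = N} => f (Q z)) = fun _ => f N := by
      funext z; rw [z.2]
    rw [h1]
    convert hasSum_fintype (fun _ : {z // Q z = N} => f N)
    rw [Finset.sum_const, nsmul_eq_mul, ← hfib, Finset.card_univ, ← Nat.card_eq_fintype_card]
    rfl
  have hab : Summable (fun z : ℤ × ℤ => |g (Q z)|) := by
    rw [← (Equiv.sigmaFiberEquiv Q).summable_iff]
    change Summable (fun x : (N : ℕ) × {z // Q z = N} => |g (Q x.2)|)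
    refine (summable_sigma_of_nonneg (fun _ => abs_nonneg _)).mpr
      ⟨fun N => (hsum (fun N => |g N|) N).summable, ?_⟩
    convert habs with N
    exact (hsum (fun N => |g N|) N).tsum_eq
  refine ⟨?_, hab⟩
  have h1 := (Equiv.sigmaFiberEquiv Q).hasSum_iff.mpr hab.of_abs.hasSum
  have h2 := h1.sigma (fun N => hsum g N)
  have := h2.unique h
  rw [← this]
  exact hab.of_abs.hasSum

section
variable {n d k : ℕ} [Fact d.Prime] [NeZero k]

theorem hasSum_lattice (h : RepresentsPrimes n) (hn : 4 * n = d + 1) (hodd : n % 2 = 1)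
    (hn2 : 2 ≤ n) (ψ : MulChar (ZMod k) ℤ) {s : ℝ} (hs : 1 < s) :
    HasSum (fun z : ℤ × ℤ => (ψ (normForm n z : ZMod k) : ℝ) * (normForm n z : ℝ) ^ (-s))
      (2 * ((∑' m : ℕ, (ψ (m : ZMod k) : ℝ) * (m : ℝ) ^ (-s)) *
        ∑' m : ℕ, ((ψ (m : ZMod k) : ℝ) * (quadraticChar (ZMod d) (m : ZMod d) : ℝ)) *
          (m : ℝ) ^ (-s))) ∧
    Summable (fun z : ℤ × ℤ => (normForm n z : ℝ) ^ (-s)) := by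
  have : NeZero d := ⟨(Fact.out : d.Prime).ne_zero⟩
  have hs0 : -s ≠ 0 := by linarith
  have hpos : ∀ z, 0 ≤ normForm n z := by
    intro z
    have h4 := four_mul_normForm n z
    have hn' : (2 : ℤ) ≤ n := by exact_mod_cast hn2
    nlinarith [sq_nonneg (2 * z.1 + z.2), sq_nonneg z.2]
  have hcast : ∀ z, (((normForm n z).toNat : ℕ) : ℤ) = normForm n z := fun z =>
    Int.toNat_of_nonneg (hpos z)
  have hconv := hasSum_convolution (f := fun m => (ψ (m : ZMod k) : ℝ))
    (g := fun m => (ψ (m : ZMod k) : ℝ) * (quadraticChar (ZMod d) (m : ZMod d) : ℝ))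
    (fun m => abs_mulChar_le_one ψ _) (fun m => by
      rw [abs_mul]
      exact mul_le_one₀ (abs_mulChar_le_one ψ _) (abs_nonneg _) (abs_mulChar_le_one _ _)) hs
  have hone := hasSum_convolution (f := fun _ => 1)
    (g := fun m => (quadraticChar (ZMod d) (m : ZMod d) : ℝ))
    (fun m => by simp) (fun m => abs_mulChar_le_one _ _) hs
  have hcard : ∀ N : ℕ, N ≠ 0 → ((repSet n N).ncard : ℝ) =
      2 * ∑ p ∈ N.divisorsAntidiagonal, (quadraticChar (ZMod d) (p.2 : ZMod d) : ℝ) := by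
    intro N hN
    rw [Nat.sum_divisorsAntidiagonal' (fun _ b => (quadraticChar (ZMod d) (b : ZMod d) : ℝ))]
    exact_mod_cast ncard_repSet h hn hodd hn2 hN
  have habs : Summable (fun N : ℕ => (repSet n N).ncard * (N : ℝ) ^ (-s)) := by
    refine (hone.mul_left 2).summable.congr fun N => ?_
    rcases eq_or_ne N 0 with rfl | hN
    · simp [Real.zero_rpow hs0]
    · rw [hcard N hN, mul_assoc]; simp
  have hmain : HasSum (fun N : ℕ => (repSet n N).ncard *
      ((ψ (N : ZMod k) : ℝ) * (N : ℝ) ^ (-s)))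
      (2 * ((∑' m : ℕ, (ψ (m : ZMod k) : ℝ) * (m : ℝ) ^ (-s)) *
        ∑' m : ℕ, ((ψ (m : ZMod k) : ℝ) * (quadraticChar (ZMod d) (m : ZMod d) : ℝ)) *
          (m : ℝ) ^ (-s))) := by
    refine HasSum.of_forall_eq (hconv.mul_left 2) fun N => ?_
    rcases eq_or_ne N 0 with rfl | hN
    · simp [Real.zero_rpow hs0]
    · rw [hcard N hN]
      have : ∑ p ∈ N.divisorsAntidiagonal, (ψ (p.1 : ZMod k) : ℝ) *
          ((ψ (p.2 : ZMod k) : ℝ) * (quadraticChar (ZMod d) (p.2 : ZMod d) : ℝ)) =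
          (ψ (N : ZMod k) : ℝ) *
            ∑ p ∈ N.divisorsAntidiagonal, (quadraticChar (ZMod d) (p.2 : ZMod d) : ℝ) := by
        rw [Finset.mul_sum]
        refine Finset.sum_congr rfl fun p hp => ?_
        rw [← (Nat.mem_divisorsAntidiagonal.mp hp).1, Nat.cast_mul, map_mul]
        push_cast
        ring
      rw [this]
      ring
  have h1 := hasSum_normForm (by omega : 1 ≤ n)
    (g := fun N => (ψ (N : ZMod k) : ℝ) * (N : ℝ) ^ (-s)) hmain
    (Summable.of_nonneg_of_le (fun N => by positivity) (fun N => by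
      rw [abs_mul]
      refine mul_le_mul_of_nonneg_left ?_ (Nat.cast_nonneg _)
      rw [abs_of_nonneg (Real.rpow_nonneg (Nat.cast_nonneg N) _)]
      exact mul_le_of_le_one_left (Real.rpow_nonneg (Nat.cast_nonneg N) _)
        (abs_mulChar_le_one ψ _)) habs)
  have h2 := hasSum_normForm (by omega : 1 ≤ n)
    (g := fun N => (N : ℝ) ^ (-s)) habs.hasSum
    (habs.congr fun N => by
      rw [abs_of_nonneg (Real.rpow_nonneg (Nat.cast_nonneg N) _)])
  constructor
  · refine HasSum.of_forall_eq h1.1 fun z => ?_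
    have e1 : ((normForm n z).toNat : ℝ) = normForm n z := by exact_mod_cast hcast z
    have e2 : ((normForm n z).toNat : ZMod k) = normForm n z := by
      exact_mod_cast congrArg (Int.cast (R := ZMod k)) (hcast z)
    rw [e1, e2]
  · refine h2.1.summable.congr fun z => ?_
    have e1 : ((normForm n z).toNat : ℝ) = normForm n z := by exact_mod_cast hcast z
    rw [← e1]

end

open Filter Topology in
theorem abs_rpow_neg_sub_le {x y s : ℝ} (hx : 1 ≤ x) (hy : 1 ≤ y) (hs : 1 ≤ s) (hs2 : s ≤ 2) :
    |x ^ (-s) - y ^ (-s)| ≤ 2 * |x⁻¹ - y⁻¹| := by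
  wlog h : x ≤ y generalizing x y
  · rw [abs_sub_comm, abs_sub_comm x⁻¹]
    exact this hy hx (le_of_not_ge h)
  have hx0 : 0 < x := by linarith
  have hy0 : 0 < y := by linarith
  set t := x / y with ht
  have ht0 : 0 < t := by positivity
  have ht1 : t ≤ 1 := (div_le_one hy0).mpr h
  have e1 : y ^ (-s) = x ^ (-s) * t ^ s := by
    rw [ht, Real.div_rpow hx0.le hy0.le, Real.rpow_neg hx0.le, Real.rpow_neg hy0.le]
    field_simp
  have e2 : y⁻¹ = x⁻¹ * t := by rw [ht]; field_simp
  have h1 : t ^ s ≤ 1 := Real.rpow_le_one ht0.le ht1 (by linarith)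
  have h2 : t ^ 2 ≤ t ^ s := by
    rw [← Real.rpow_natCast]
    exact Real.rpow_le_rpow_of_exponent_ge ht0 ht1 (by simpa using hs2)
  have h3 : x ^ (-s) ≤ x⁻¹ := by
    rw [← Real.rpow_neg_one]
    exact Real.rpow_le_rpow_of_exponent_le hx (by linarith)
  have h4 : 0 ≤ x ^ (-s) := Real.rpow_nonneg hx0.le _
  have h5 : 0 < x⁻¹ := inv_pos.mpr hx0
  rw [e1, e2, abs_of_nonneg (by nlinarith), abs_of_nonneg (by nlinarith)]
  have h6 : x ^ (-s) * (1 - t ^ s) ≤ x⁻¹ * (1 - t ^ s) :=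
    mul_le_mul_of_nonneg_right h3 (by linarith)
  have h7 : x⁻¹ * (1 - t ^ s) ≤ x⁻¹ * (2 * (1 - t)) :=
    mul_le_mul_of_nonneg_left (by nlinarith) h5.le
  linarith

open Filter Topology in
/-- If the weights `w` sum to zero and the entries of each row of `A` are close to each other, the
limit as `s → 1` may be taken row by row. -/
theorem tendsto_tsum_rpow_neg {ι κ : Type*} [Fintype κ] {w : κ → ℝ} (hw : ∑ c, w c = 0)
    {A : ι → κ → ℝ} {R : ι → ℝ} (hA : ∀ i c, 1 ≤ A i c) (hR : ∀ i, 1 ≤ R i) {B : ι → ℝ}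
    (hB : Summable B) (hAB : ∀ i c, |(A i c)⁻¹ - (R i)⁻¹| ≤ B i) :
    Summable (fun i => ∑ c, w c * (A i c)⁻¹) ∧
    Tendsto (fun s : ℝ => ∑' i, ∑ c, w c * A i c ^ (-s)) (𝓝[>] 1)
      (𝓝 (∑' i, ∑ c, w c * (A i c)⁻¹)) := by
  have key : ∀ s : ℝ, 1 ≤ s → s ≤ 2 → ∀ i,
      ‖∑ c, w c * A i c ^ (-s)‖ ≤ (∑ c, |w c|) * 2 * B i := by
    intro s hs hs2 i
    have h1 : ∑ c, w c * A i c ^ (-s) = ∑ c, w c * (A i c ^ (-s) - R i ^ (-s)) := by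
      simp_rw [mul_sub, Finset.sum_sub_distrib, ← Finset.sum_mul, hw]
      ring
    rw [h1, mul_assoc, Finset.sum_mul]
    refine norm_sum_le_of_le _ fun c _ => ?_
    rw [norm_mul, Real.norm_eq_abs, Real.norm_eq_abs]
    refine mul_le_mul_of_nonneg_left ?_ (abs_nonneg _)
    exact (abs_rpow_neg_sub_le (hA i c) (hR i) hs hs2).trans
      (mul_le_mul_of_nonneg_left (hAB i c) (by norm_num))
  have hBs : Summable (fun i => (∑ c, |w c|) * 2 * B i) := hB.mul_left _
  refine ⟨Summable.of_norm_bounded hBs fun i => ?_, ?_⟩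
  · simpa [Real.rpow_neg_one] using key 1 le_rfl (by norm_num) i
  · refine tendsto_tsum_of_dominated_convergence hBs (fun i => ?_) ?_
    · refine tendsto_finsetSum _ fun c _ => Tendsto.const_mul _ ?_
      have h0 : A i c ≠ 0 := by have := hA i c; linarith
      have : ContinuousAt (fun s : ℝ => A i c ^ (-s)) 1 :=
        (Real.continuousAt_const_rpow h0).comp continuous_neg.continuousAt
      have h2 := this.tendsto
      rw [Real.rpow_neg_one] at h2
      exact h2.mono_left nhdsWithin_le_nhds
    · have : Set.Ioc (1 : ℝ) 2 ∈ 𝓝[>] (1 : ℝ) := Ioc_mem_nhdsGT (by norm_num)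
      filter_upwards [this] with s hs i
      exact key s hs.1.le hs.2 i

open Filter Topology in
/-- The value at `1` of the Dirichlet series of a periodic function with mean zero. -/
theorem tendsto_tsum_periodic {N : ℕ} (hN : N ≠ 0) {f : ℕ → ℝ} (hf : f.Periodic N)
    (hsum : ∑ a : Fin N, f (a + 1) = 0) :
    Summable (fun m : ℕ => ∑ a : Fin N, f (a + 1) * ((N * m + (a + 1) : ℝ))⁻¹) ∧
    Tendsto (fun s : ℝ => ∑' m : ℕ, f m * (m : ℝ) ^ (-s)) (𝓝[>] 1)
      (𝓝 (∑' m : ℕ, ∑ a : Fin N, f (a + 1) * ((N * m + (a + 1) : ℝ))⁻¹)) := by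
  have hN1 : (1 : ℝ) ≤ N := by exact_mod_cast Nat.one_le_iff_ne_zero.mpr hN
  have hB : Summable (fun m : ℕ => 1 / ((m : ℝ) + 1) ^ 2) := by
    simpa using (summable_nat_add_iff 1).mpr (Real.summable_one_div_nat_pow.mpr one_lt_two)
  have h := tendsto_tsum_rpow_neg (ι := ℕ) (w := fun a : Fin N => f (a + 1)) hsum
    (A := fun m a => (N * m + (a + 1) : ℝ)) (R := fun m => (N * m + N : ℝ))
    (fun m a => by
      have : (0 : ℝ) ≤ N * m := by positivity
      have : (0 : ℝ) ≤ (a : ℕ) := by positivity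
      linarith)
    (fun m => by
      have : (0 : ℝ) ≤ N * m := by positivity
      linarith)
    hB
    (fun m a => by
      have h0 : (0 : ℝ) ≤ m := by positivity
      have h1 : (0 : ℝ) ≤ N * m := by positivity
      have h2 : (0 : ℝ) ≤ (a : ℕ) := by positivity
      have h3 : ((a : ℕ) + 1 : ℝ) ≤ N := by exact_mod_cast a.2
      have h4 : (m : ℝ) ≤ N * m := le_mul_of_one_le_left h0 hN1
      rw [abs_of_nonneg (sub_nonneg.mpr (inv_anti₀ (by linarith) (by linarith))),
        inv_sub_inv (by linarith) (by linarith), div_le_div_iff₀ (by nlinarith) (by positivity)]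
      have h5 : (N * m + N - (N * m + (a + 1)) : ℝ) ≤ N := by linarith
      rw [one_mul]
      have h6 : ((m : ℝ) + 1) * (m + 1) * N ≤ (N * m + (a + 1)) * (N * m + N) := by
        rw [mul_assoc, show ((m : ℝ) + 1) * N = N * m + N by ring]
        exact mul_le_mul_of_nonneg_right (by linarith) (by linarith)
      nlinarith [mul_le_mul_of_nonneg_right h5 (sq_nonneg ((m : ℝ) + 1))])
  refine ⟨h.1, h.2.congr' ?_⟩
  filter_upwards [self_mem_nhdsWithin] with s hs
  have hs1 : 1 < s := hs
  have : NeZero N := ⟨hN⟩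
  obtain ⟨C, hC⟩ : ∃ C, ∀ n, |f n| ≤ C := by
    refine ⟨∑ a ∈ Finset.range N, |f a|, fun n => ?_⟩
    rw [← hf.map_mod_nat n]
    exact Finset.single_le_sum (f := fun a => |f a|) (fun _ _ => abs_nonneg _)
      (Finset.mem_range.mpr (Nat.mod_lt _ (Nat.pos_of_ne_zero hN)))
  have hsm : Summable (fun m : ℕ => f m * (m : ℝ) ^ (-s)) := by
    refine Summable.of_norm_bounded (g := fun m : ℕ => C * (m : ℝ) ^ (-s))
      ((Real.summable_nat_rpow.mpr (by linarith)).mul_left C) fun m => ?_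
    rw [norm_mul, Real.norm_eq_abs, Real.norm_of_nonneg (Real.rpow_nonneg (Nat.cast_nonneg m) _)]
    exact mul_le_mul_of_nonneg_right (hC m) (Real.rpow_nonneg (Nat.cast_nonneg m) _)
  rw [hsm.tsum_eq_zero_add]
  have h0 : f 0 * ((0 : ℕ) : ℝ) ^ (-s) = 0 := by
    rw [Nat.cast_zero, Real.zero_rpow (by linarith), mul_zero]
  rw [h0, zero_add]
  have hsm1 := (summable_nat_add_iff 1).mpr hsm
  have e1 := (Nat.divModEquiv N).symm.summable_iff.mpr hsm1
  symm
  rw [← (Nat.divModEquiv N).symm.tsum_eq]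
  refine e1.tsum_prod.trans ?_
  refine tsum_congr fun m => ?_
  rw [tsum_fintype]
  refine Finset.sum_congr rfl fun a _ => ?_
  simp only [Function.comp_apply]
  have e2 : (Nat.divModEquiv N).symm (m, a) = m * N + a := rfl
  simp only [e2]
  have e3 : f (m * N + a + 1) = f (a + 1) := by
    have := hf.nat_mul m (a + 1)
    rw [← this]
    congr 1
    rw [Nat.cast_id]
    ring
  rw [e3]
  push_cast
  congr 2
  ring

theorem summable_inv_sq_add_sq (β : ℝ) {v : ℝ} (hv : 0 < v) :
    Summable (fun j : ℤ => (((j : ℝ) + β) ^ 2 + v ^ 2)⁻¹) := by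
  have h := (Real.summable_one_div_int_pow (p := 2)).mpr one_lt_two
  refine Summable.of_norm_bounded_eventually (h.mul_left (2 + 2 * β ^ 2 / v ^ 2)) ?_
  have : {0}ᶜ ∈ (Filter.cofinite : Filter ℤ) := (Set.finite_singleton 0).compl_mem_cofinite
  filter_upwards [this] with j hj
  have hj' : (j : ℝ) ≠ 0 := by exact_mod_cast hj
  rw [Real.norm_of_nonneg (by positivity), mul_one_div, inv_le_iff_one_le_mul₀ (by positivity),
    div_mul_eq_mul_div, le_div_iff₀ (by positivity), one_mul]
  have h1 : 2 * β ^ 2 / v ^ 2 * v ^ 2 = 2 * β ^ 2 := by field_simp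
  have h2 : 0 ≤ 2 * β ^ 2 / v ^ 2 * ((j : ℝ) + β) ^ 2 := by positivity
  nlinarith [sq_nonneg ((j : ℝ) + 2 * β), sq_nonneg v]

open Complex in
theorem abs_tsum_inv_sub_le (β : ℝ) {v q : ℝ} (hv : 0 < v) (hq : Real.exp (-(2 * Real.pi * v)) ≤ q)
    (hq2 : q ≤ 1 / 2) :
    |∑' j : ℤ, (((j : ℝ) + β) ^ 2 + v ^ 2)⁻¹ - Real.pi / v| ≤ 4 * Real.pi / v * q := by
  have hsm := summable_inv_sq_add_sq β hv
  set z : UpperHalfPlane := ⟨β + v * I, by simpa using hv⟩ with hz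
  have hz' : (z : ℂ) = β + v * I := rfl
  have hzc : (z : ℂ) ∈ Complex.integerComplement := UpperHalfPlane.coe_mem_integerComplement z
  have him : ∀ j : ℝ, ((z : ℂ) + j)⁻¹.im = -v * ((j + β) ^ 2 + v ^ 2)⁻¹ := by
    intro j
    rw [inv_im, normSq_apply, hz']
    simp
    ring
  have hS : ∑' j : ℤ, (((j : ℝ) + β) ^ 2 + v ^ 2)⁻¹ =
      -(1 / v) * (Real.pi * cot (Real.pi * z)).im := by
    have e1 := sub_eq_iff_eq_add.mp (cot_series_rep' hzc)
    have e2 := hsm.hasSum.nat_add_neg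
    have e3 := e2.tsum_eq
    rw [e2.summable.tsum_eq_zero_add] at e3
    have e4 := summable_cotTerm hzc
    unfold cotTerm at e4
    rw [e1, add_im, im_tsum e4, mul_add, ← tsum_mul_left]
    have i0 := him 0
    rw [ofReal_zero, add_zero] at i0
    rw [one_div (z : ℂ), i0]
    have hpart : ∀ n : ℕ, -(1 / v) * (1 / ((z : ℂ) - (n + 1)) + 1 / ((z : ℂ) + (n + 1))).im =
        ((((n + 1 : ℕ) : ℤ) + β) ^ 2 + v ^ 2)⁻¹ +
          (((-((n + 1 : ℕ) : ℤ) : ℤ) + β) ^ 2 + v ^ 2)⁻¹ := by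
      intro n
      have i1 := him (n + 1)
      have i2 := him (-(n + 1))
      push_cast at i1 i2
      rw [add_im, one_div (_ - _), one_div (_ + _), i1, sub_eq_add_neg, i2]
      push_cast
      field_simp
      ring
    rw [tsum_congr hpart]
    have e5 : -(1 / v) * (-v * ((0 + β) ^ 2 + v ^ 2)⁻¹) = ((0 + β) ^ 2 + v ^ 2)⁻¹ := by
      field_simp
    rw [e5]
    push_cast at e3 ⊢
    norm_num at e3 ⊢
    linarith
  have hQ : ‖cexp (2 * Real.pi * I * z)‖ ≤ q := by
    rw [norm_exp, hz']
    refine le_of_eq_of_le (congrArg Real.exp ?_) hq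
    simp
  set Q := cexp (2 * Real.pi * I * z) with hQd
  have hQ1 : ‖Q‖ < 1 := by linarith
  have h1Q : 1 - ‖Q‖ ≤ ‖1 - Q‖ := by
    have := norm_sub_norm_le 1 Q
    rwa [norm_one] at this
  have hne : 1 - Q ≠ 0 := norm_pos_iff.mp (by linarith)
  have hgeo : ∑' n : ℕ, Q ^ n = 1 + Q / (1 - Q) := by
    rw [tsum_geometric_of_norm_lt_one hQ1]
    field_simp
    ring
  have hfin : (Real.pi * I - 2 * Real.pi * I * (1 + Q / (1 - Q))).im =
      -Real.pi - 2 * Real.pi * (Q / (1 - Q)).re := by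
    have : Real.pi * I - 2 * Real.pi * I * (1 + Q / (1 - Q)) =
        ((-Real.pi : ℝ) : ℂ) * I + (((-2 * Real.pi : ℝ) : ℂ) * (Q / (1 - Q))) * I := by
      push_cast
      ring
    rw [this, add_im, mul_I_im, mul_I_im, ofReal_re, re_ofReal_mul]
    ring
  rw [hS, pi_mul_cot_pi_q_exp, hgeo, hfin]
  have e6 : -(1 / v) * (-Real.pi - 2 * Real.pi * (Q / (1 - Q)).re) - Real.pi / v =
      2 * Real.pi / v * (Q / (1 - Q)).re := by
    field_simp
    ring
  have h7 : |(Q / (1 - Q)).re| ≤ 2 * q := by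
    refine (abs_re_le_norm _).trans ?_
    rw [norm_div, div_le_iff₀ (by linarith)]
    have h0 := norm_nonneg Q
    nlinarith
  rw [e6, abs_mul, abs_of_nonneg (by positivity)]
  calc _ ≤ 2 * Real.pi / v * (2 * q) := by gcongr
    _ = _ := by ring

theorem normForm_cast (n : ℕ) (x y : ℤ) :
    (normForm n (x, y) : ℝ) = (x : ℝ) ^ 2 + x * y + n * (y : ℝ) ^ 2 := by
  simp [normForm]

theorem one_le_normForm {n : ℕ} (hn : 1 ≤ n) (x : ℤ) {y : ℤ} (hy : 1 ≤ y) :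
    (1 : ℝ) ≤ normForm n (x, y) := by
  have h4 := four_mul_normForm n (x, y)
  have hn' : (1 : ℤ) ≤ n := by exact_mod_cast hn
  have h1 : 0 < 4 * normForm n (x, y) := by
    rw [h4]
    have : 0 < (4 * (n : ℤ) - 1) * y ^ 2 := by
      have := pow_pos (by omega : 0 < y) 2
      nlinarith
    nlinarith [sq_nonneg (2 * x + y)]
  exact_mod_cast (by omega : 1 ≤ normForm n (x, y))

theorem abs_inv_normForm_sub_le {n : ℕ} (hn : 1 ≤ n) {D : ℝ} (hD0 : 0 ≤ D) {x y a b : ℤ}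
    (hy : 1 ≤ y) (hy' : 1 ≤ y + b) (hD : (normForm n (a, b) : ℝ) ≤ D) :
    |(normForm n (x + a, y + b) : ℝ)⁻¹ - (normForm n (x, y) : ℝ)⁻¹| ≤
      (2 * √D + D) * (2 + 2 * D) * (normForm n (x, y) : ℝ) ^ (-(3 / 2 : ℝ)) := by
  set R : ℝ := (normForm n (x, y) : ℝ) with hR
  set A : ℝ := (normForm n (x + a, y + b) : ℝ) with hA
  set δ : ℝ := (normForm n (a, b) : ℝ) with hδ
  have hR1 : 1 ≤ R := one_le_normForm hn x hy
  have hA1 : 1 ≤ A := one_le_normForm hn _ hy'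
  have hn' : (1 : ℝ) ≤ n := by exact_mod_cast hn
  have eR : R = (x : ℝ) ^ 2 + x * y + n * (y : ℝ) ^ 2 := normForm_cast n x y
  have eA : A = ((x : ℝ) + a) ^ 2 + (x + a) * (y + b) + n * ((y : ℝ) + b) ^ 2 := by
    rw [hA, normForm_cast]; push_cast; ring
  have eδ : δ = (a : ℝ) ^ 2 + a * b + n * (b : ℝ) ^ 2 := normForm_cast n a b
  have form_nonneg : ∀ u v : ℝ, 0 ≤ u ^ 2 + u * v + n * v ^ 2 := fun u v => by
    nlinarith [sq_nonneg (2 * u + v), sq_nonneg v]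
  have hδ0 : 0 ≤ δ := eδ ▸ form_nonneg a b
  have h1 : R ≤ (2 + 2 * D) * A := by
    have := form_nonneg (x + 2 * a) (y + 2 * b)
    have h3 : R ≤ 2 * A + 2 * δ := by rw [eR, eA, eδ]; nlinarith
    nlinarith
  have h2 : |A - R| ≤ (2 * √D + D) * √R := by
    have hB : (A - R - δ) ^ 2 ≤ 4 * R * D := by
      have : (A - R - δ) ^ 2 ≤ 4 * R * δ := by
        rw [eR, eA, eδ]
        nlinarith [mul_nonneg (by linarith : (0 : ℝ) ≤ 4 * n - 1) (sq_nonneg ((x : ℝ) * b - y * a))]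
      nlinarith
    have hB' : |A - R - δ| ≤ 2 * √D * √R := by
      refine abs_le_of_sq_le_sq (hB.trans (le_of_eq ?_)) (by positivity)
      rw [mul_pow, mul_pow, Real.sq_sqrt hD0, Real.sq_sqrt (by linarith)]
      ring
    have hs : 1 ≤ √R := Real.one_le_sqrt.mpr hR1
    have := abs_le.mp hB'
    rw [abs_le]
    constructor <;> nlinarith
  have hR0 : 0 < R := by linarith
  have hA0 : 0 < A := by linarith
  have e3 : R ^ (-(3 / 2 : ℝ)) = √R / R ^ 2 := by
    rw [Real.sqrt_eq_rpow, ← Real.rpow_natCast, ← Real.rpow_sub hR0]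
    norm_num
  rw [e3, inv_sub_inv hA0.ne' hR0.ne', abs_div, abs_sub_comm, abs_of_pos (mul_pos hA0 hR0),
    ← mul_div_assoc, div_le_div_iff₀ (by positivity) (by positivity)]
  have h5 : 0 ≤ (2 * √D + D) * √R := by positivity
  calc |A - R| * R ^ 2 ≤ ((2 * √D + D) * √R) * R ^ 2 := by gcongr
    _ = ((2 * √D + D) * √R) * (R * R) := by ring
    _ ≤ ((2 * √D + D) * √R) * (((2 + 2 * D) * A) * R) := by gcongr
    _ = _ := by ring

/-- The sum of `ψ` over the values of the norm form in row `y`, over one period. -/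
def rowSum {k : ℕ} (n : ℕ) (ψ : ZMod k → ℤ) (y : ℕ) : ℝ :=
  ∑ b : Fin k, (ψ (normForm n ((b : ℕ), y) : ZMod k) : ℝ)

theorem rowSum_periodic {k : ℕ} (n : ℕ) (ψ : ZMod k → ℤ) : (rowSum n ψ).Periodic k := by
  intro y
  unfold rowSum
  simp [normForm]

section
variable {n d k : ℕ} [NeZero k]

theorem row_estimate (hn : 4 * n = d + 1) {q : ℝ}
    (hq : Real.exp (-(Real.pi * √d / k)) = q) (hq2 : q ≤ 1 / 2)
    (b : ℤ) {y : ℕ} (hy : 1 ≤ y) :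
    Summable (fun j : ℤ => (normForm n (k * j + b, y) : ℝ)⁻¹) ∧
    |∑' j : ℤ, (normForm n (k * j + b, y) : ℝ)⁻¹ - 2 * Real.pi / (k * √d) * (y : ℝ)⁻¹| ≤
      8 * Real.pi / (k * √d) * q ^ y := by
  have hd : (0 : ℝ) < d := by
    have : 0 < d := by omega
    exact_mod_cast this
  have hk : (0 : ℝ) < k := by exact_mod_cast Nat.pos_of_ne_zero (NeZero.ne k)
  have hy' : (1 : ℝ) ≤ y := by exact_mod_cast hy
  have hn' : (4 * n : ℝ) = d + 1 := by exact_mod_cast hn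
  set v : ℝ := √d * y / (2 * k) with hv
  set β : ℝ := (b + y / 2) / k with hβ
  have hv0 : 0 < v := by positivity
  have hv2 : v ^ 2 = d * y ^ 2 / (4 * k ^ 2) := by
    rw [hv, div_pow, mul_pow, Real.sq_sqrt hd.le]; ring
  have e : ∀ j : ℤ, (normForm n (k * j + b, y) : ℝ)⁻¹ =
      ((k : ℝ) ^ 2)⁻¹ * (((j : ℝ) + β) ^ 2 + v ^ 2)⁻¹ := by
    intro j
    rw [← mul_inv, normForm_cast, hv2, hβ]
    congr 1
    push_cast
    have : (n : ℝ) = (d + 1) / 4 := by linarith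
    rw [this]
    field_simp
    ring
  have hq0 : 0 < q := hq ▸ Real.exp_pos _
  have hexp : Real.exp (-(2 * Real.pi * v)) ≤ q ^ y := by
    rw [← hq, ← Real.exp_nat_mul, hv]
    refine le_of_eq (congrArg Real.exp ?_)
    field_simp
  have hqy : q ^ y ≤ q := pow_le_of_le_one hq0.le (by linarith) (by omega)
  have h := abs_tsum_inv_sub_le β hv0 hexp (by linarith)
  have hs := summable_inv_sq_add_sq β hv0
  simp_rw [e]
  refine ⟨hs.mul_left _, ?_⟩
  rw [tsum_mul_left]
  have e2 : 2 * Real.pi / (k * √d) * (y : ℝ)⁻¹ = ((k : ℝ) ^ 2)⁻¹ * (Real.pi / v) := by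
    rw [hv]; field_simp
  rw [e2, ← mul_sub, abs_mul, abs_of_pos (by positivity)]
  refine (mul_le_mul_of_nonneg_left h (by positivity)).trans ?_
  have e3 : ((k : ℝ) ^ 2)⁻¹ * (4 * Real.pi / v * q ^ y) =
      8 * Real.pi / (k * √d) * (q ^ y) * (y : ℝ)⁻¹ := by
    rw [hv]; field_simp; ring
  rw [e3]
  exact mul_le_of_le_one_right (by positivity) (inv_le_one_of_one_le₀ hy')

open Filter Topology in
theorem tendsto_lattice_upper (hn : 4 * n = d + 1) {q : ℝ}
    (hq : Real.exp (-(Real.pi * √d / k)) = q) (hq2 : q ≤ 1 / 2) (hn1 : 1 ≤ n)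
    (hkd : 16 * Real.pi * k ≤ √d) {ψ : ZMod k → ℤ} (hψ : ∀ a, |(ψ a : ℝ)| ≤ 1)
    (hsm : ∀ s : ℝ, 1 < s → Summable (fun z : ℤ × ℤ => (normForm n z : ℝ) ^ (-s)))
    (hc : ∑ r : Fin k, rowSum n ψ (r + 1) = 0)
    (hc0 : ∑' m : ℕ, ∑ r : Fin k, rowSum n ψ (r + 1) * ((k * m + (r + 1) : ℝ))⁻¹ = 0) :
    ∃ E : ℝ, |E| ≤ q ∧ Tendsto (fun s : ℝ => ∑' z : ℤ × ℕ,
      (ψ (normForm n (z.1, (z.2 + 1 : ℕ)) : ZMod k) : ℝ) *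
        (normForm n (z.1, (z.2 + 1 : ℕ)) : ℝ) ^ (-s)) (𝓝[>] 1) (𝓝 E) := by
  have hkN : 0 < k := Nat.pos_of_ne_zero (NeZero.ne k)
  have hk : (0 : ℝ) < k := by exact_mod_cast hkN
  let A : ℤ × ℕ → Fin k × Fin k → ℝ := fun i c =>
    (normForm n (k * i.1 + (c.1 : ℕ), (k * i.2 + (c.2 + 1) : ℕ)) : ℝ)
  let w : Fin k × Fin k → ℝ := fun c => (ψ (normForm n ((c.1 : ℕ), (c.2 + 1 : ℕ)) : ZMod k) : ℝ)
  let R : ℤ × ℕ → ℝ := fun i => (normForm n (k * i.1, (k * i.2 + 1 : ℕ)) : ℝ)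
  have hw : ∑ c, w c = 0 := by
    rw [Fintype.sum_prod_type_right]
    exact hc
  have hA : ∀ i c, 1 ≤ A i c := fun i c => one_le_normForm hn1 _
    (by exact_mod_cast (by omega : 1 ≤ k * i.2 + (c.2 + 1)))
  have hR : ∀ i, 1 ≤ R i := fun i => one_le_normForm hn1 _
    (by exact_mod_cast Nat.le_add_left 1 _)
  obtain ⟨D, hD0, hD⟩ : ∃ D : ℝ, 0 ≤ D ∧ ∀ c : Fin k × Fin k,
      (normForm n ((c.1 : ℕ), (c.2 : ℕ)) : ℝ) ≤ D := by
    refine ⟨∑ c : Fin k × Fin k, |(normForm n ((c.1 : ℕ), (c.2 : ℕ)) : ℝ)|,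
      Finset.sum_nonneg fun _ _ => abs_nonneg _, fun c => (le_abs_self _).trans ?_⟩
    exact Finset.single_le_sum
      (f := fun c : Fin k × Fin k => |(normForm n ((c.1 : ℕ), (c.2 : ℕ)) : ℝ)|)
      (fun _ _ => abs_nonneg _) (Finset.mem_univ c)
  have hinj : Function.Injective
      (fun i : ℤ × ℕ => ((k * i.1, (k * i.2 + 1 : ℕ)) : ℤ × ℤ)) := by
    rintro ⟨j, m⟩ ⟨j', m'⟩ h
    simp only [Prod.mk.injEq] at h
    have hk0 : (k : ℤ) ≠ 0 := by exact_mod_cast hkN.ne'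
    have h2 : k * m + 1 = k * m' + 1 := by exact_mod_cast h.2
    exact Prod.ext (mul_left_cancel₀ hk0 h.1)
      (Nat.eq_of_mul_eq_mul_left hkN (Nat.succ_injective h2))
  have hB := ((hsm (3 / 2) (by norm_num)).comp_injective hinj).mul_left
    ((2 * √D + D) * (2 + 2 * D))
  have h := tendsto_tsum_rpow_neg hw hA hR hB (fun i c => by
    have := abs_inv_normForm_sub_le hn1 hD0 (x := k * i.1) (y := (k * i.2 + 1 : ℕ))
      (a := (c.1 : ℕ)) (b := (c.2 : ℕ)) (by exact_mod_cast Nat.le_add_left 1 _)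
      (by exact_mod_cast (by omega : 1 ≤ k * i.2 + 1 + c.2)) (hD c)
    have e : ((k * i.2 + 1 : ℕ) : ℤ) + (c.2 : ℕ) = (k * i.2 + (c.2 + 1) : ℕ) := by
      push_cast; ring
    rw [e] at this
    exact this)
  obtain ⟨h1, h2⟩ := h
  refine ⟨_, ?_, h2.congr' ?_⟩
  · have hq0 : 0 < q := hq ▸ Real.exp_pos _
    set K : ℝ := 2 * Real.pi / (k * √d) with hK
    let G : ℕ → ℝ := fun m => ∑ c, w c * ∑' j : ℤ, (A (j, m) c)⁻¹
    let L : ℕ → ℝ := fun m => K * ∑ r : Fin k, rowSum n ψ (r + 1) * ((k * m + (r + 1) : ℝ))⁻¹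
    have hrow := fun (m : ℕ) (c : Fin k × Fin k) =>
      row_estimate hn hq hq2 (c.1 : ℕ) (y := k * m + (c.2 + 1)) (by omega)
    have hswap := (Equiv.prodComm ℕ ℤ).summable_iff.mpr h1
    have hG : ∀ m, ∑' j : ℤ, ∑ c, w c * (A (j, m) c)⁻¹ = G m := fun m => by
      rw [Summable.tsum_finsetSum fun c _ => ((hrow m c).1.mul_left (w c))]
      exact Finset.sum_congr rfl fun c _ => tsum_mul_left
    have hGs : Summable G := hswap.prod.congr fun m => (hG m)
    have htot : ∑' i, ∑ c, w c * (A i c)⁻¹ = ∑' m, G m := by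
      rw [← (Equiv.prodComm ℕ ℤ).tsum_eq]
      exact hswap.tsum_prod.trans (tsum_congr hG)
    have hL : ∀ m, L m = ∑ c : Fin k × Fin k, w c * (K * ((k * m + (c.2 + 1) : ℕ) : ℝ)⁻¹) := by
      intro m
      rw [Fintype.sum_prod_type_right]
      simp only [L, Finset.mul_sum, rowSum, Finset.sum_mul, w]
      refine Finset.sum_congr rfl fun r _ => Finset.sum_congr rfl fun b _ => ?_
      push_cast
      ring
    have hdiff : ∀ m, |G m - L m| ≤ 1 / 2 * q ^ (m + 1) := by
      intro m
      rw [hL, ← Finset.sum_sub_distrib]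
      refine (Finset.abs_sum_le_sum_abs _ _).trans ?_
      have hterm : ∀ c ∈ (Finset.univ : Finset (Fin k × Fin k)),
          |w c * ∑' j : ℤ, (A (j, m) c)⁻¹ - w c * (K * ((k * m + (c.2 + 1) : ℕ) : ℝ)⁻¹)| ≤
            8 * Real.pi / (k * √d) * q ^ (m + 1) := by
        intro c _
        rw [← mul_sub, abs_mul]
        refine (mul_le_of_le_one_left (abs_nonneg _) (hψ _)).trans ((hrow m c).2.trans ?_)
        have : m + 1 ≤ k * m + (c.2 + 1) := by
          have := Nat.le_mul_of_pos_left m hkN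
          omega
        exact mul_le_mul_of_nonneg_left (pow_le_pow_of_le_one hq0.le (by linarith) this)
          (by positivity)
      refine (Finset.sum_le_sum hterm).trans ?_
      rw [Finset.sum_const, nsmul_eq_mul, ← mul_assoc]
      refine mul_le_mul_of_nonneg_right ?_ (by positivity)
      have hd0 : 0 < √(d : ℝ) := lt_of_lt_of_le (by positivity) hkd
      rw [Finset.card_univ, Fintype.card_prod, Fintype.card_fin, Nat.cast_mul, ← mul_div_assoc,
        div_le_div_iff₀ (by positivity) (by norm_num)]
      nlinarith
    have hgeo : HasSum (fun m : ℕ => 1 / 2 * q ^ (m + 1)) (1 / 2 * (q * (1 - q)⁻¹)) := by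
      simp_rw [pow_succ']
      exact ((hasSum_geometric_of_lt_one hq0.le (by linarith)).mul_left q).mul_left _
    have hGL : Summable fun m => G m - L m :=
      Summable.of_norm_bounded hgeo.summable fun m => hdiff m
    have hLs : Summable L := (hGs.sub hGL).congr fun m => by ring
    have hL0 : ∑' m, L m = 0 := by
      simp only [L]
      rw [tsum_mul_left, hc0, mul_zero]
    have hfin : ∑' m, G m = ∑' m, (G m - L m) := by
      rw [hGs.tsum_sub hLs, hL0, sub_zero]
    rw [htot, hfin]
    have h4 := tsum_of_norm_bounded (f := fun m => G m - L m) hgeo (fun m => hdiff m)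
    rw [Real.norm_eq_abs] at h4
    refine h4.trans ?_
    have : (1 - q)⁻¹ ≤ 2 := by
      rw [inv_le_comm₀ (by linarith) (by norm_num)]
      linarith
    nlinarith
  · filter_upwards [self_mem_nhdsWithin] with s hs
    have hs1 : 1 < s := hs
    let g : ℤ × ℕ → ℝ := fun z => (ψ (normForm n (z.1, (z.2 + 1 : ℕ)) : ZMod k) : ℝ) *
        (normForm n (z.1, (z.2 + 1 : ℕ)) : ℝ) ^ (-s)
    have hinj' : Function.Injective (fun z : ℤ × ℕ => ((z.1, (z.2 + 1 : ℕ)) : ℤ × ℤ)) := by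
      rintro ⟨j, m⟩ ⟨j', m'⟩ h
      simp only [Prod.mk.injEq] at h
      have h2 : m + 1 = m' + 1 := by exact_mod_cast h.2
      exact Prod.ext h.1 (Nat.succ_injective h2)
    have hg : Summable g := by
      refine Summable.of_norm_bounded ((hsm s hs1).comp_injective hinj') fun z => ?_
      have h0 : (0 : ℝ) ≤ (normForm n (z.1, (z.2 + 1 : ℕ)) : ℝ) ^ (-s) :=
        Real.rpow_nonneg (zero_le_one.trans
          (one_le_normForm hn1 _ (by exact_mod_cast Nat.le_add_left 1 _))) _
      rw [norm_mul, Real.norm_eq_abs, Real.norm_of_nonneg h0]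
      exact mul_le_of_le_one_left h0 (hψ _)
    let e : (ℤ × ℕ) × (Fin k × Fin k) ≃ ℤ × ℕ := (Equiv.prodProdProdComm _ _ _ _).trans
      (Equiv.prodCongr (Int.divModEquiv k).symm (Nat.divModEquiv k).symm)
    have he := e.summable_iff.mpr hg
    change _ = ∑' z, g z
    symm
    rw [← e.tsum_eq]
    refine (he.tsum_prod.trans (tsum_congr fun i => ?_))
    rw [tsum_fintype]
    refine Finset.sum_congr rfl fun c _ => ?_
    have e1 : e (i, c) = (i.1 * k + (c.1 : ℕ), i.2 * k + c.2) := rfl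
    have e2 : normForm n ((e (i, c)).1, ((e (i, c)).2 + 1 : ℕ)) =
        normForm n (k * i.1 + (c.1 : ℕ), (k * i.2 + (c.2 + 1) : ℕ)) := by
      rw [e1]
      congr 2
      · ring
      · push_cast; ring
    have e3 : ((normForm n (k * i.1 + (c.1 : ℕ), (k * i.2 + (c.2 + 1) : ℕ)) : ℤ) : ZMod k) =
        (normForm n ((c.1 : ℕ), (c.2 + 1 : ℕ)) : ℤ) := by
      simp [normForm]
    simp only [Function.comp_apply, g, e2, e3, A, w]

end

/-- The values of the even primitive quadratic character modulo 12. -/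
def psi12Fun : ZMod 12 → ℤ := ![0, 1, 0, 0, 0, -1, 0, -1, 0, 0, 0, 1]

/-- The values of the even primitive quadratic character modulo 24 that is trivial on 5. -/
def psi24Fun : ZMod 24 → ℤ :=
  ![0, 1, 0, 0, 0, 1, 0, -1, 0, 0, 0, -1, 0, -1, 0, 0, 0, -1, 0, 1, 0, 0, 0, 1]

/-- The even primitive quadratic character modulo 12. -/
def psi12 : MulChar (ZMod 12) ℤ where
  toFun := psi12Fun
  map_one' := rfl
  map_mul' := by decide
  map_nonunit' a ha := by
    have h : ∀ a : ZMod 12, psi12Fun a ≠ 0 → a * a = 1 := by decide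
    by_contra h0
    exact ha (IsUnit.of_mul_eq_one a (h a h0))

/-- The even primitive quadratic character modulo 24 that is trivial on 5. -/
def psi24 : MulChar (ZMod 24) ℤ where
  toFun := psi24Fun
  map_one' := rfl
  map_mul' := by decide +kernel
  map_nonunit' a ha := by
    have h : ∀ a : ZMod 24, psi24Fun a ≠ 0 → a * a = 1 := by decide
    by_contra h0
    exact ha (IsUnit.of_mul_eq_one a (h a h0))

theorem psi12_sq_eq (x : ℤ) : psi12 ((x ^ 2 : ℤ) : ZMod 12) = psi24 ((x ^ 2 : ℤ) : ZMod 24) := by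
  have h : ∀ a : ZMod 24, psi12 (((a.val ^ 2 : ℕ)) : ZMod 12) = psi24 (a ^ 2) := by decide +kernel
  have := h x
  rw [Int.cast_pow, Int.cast_pow, ← this]
  congr 1
  have e : ((x : ZMod 24).val : ℤ) = x % 24 := ZMod.val_intCast x
  have e2 : (((x : ZMod 24).val : ℕ) : ZMod 12) = (x : ZMod 12) := by
    have h3 : (((x : ZMod 24).val : ℤ) : ZMod 12) = (x : ZMod 12) := by
      rw [e, ZMod.intCast_eq_intCast_iff]
      exact Int.ModEq.of_mul_left 2 (Int.mod_modEq x 24)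
    exact_mod_cast h3
  rw [Nat.cast_pow, e2]

theorem rowSum_eq {k : ℕ} [NeZero k] (n : ℕ) (ψ : ZMod k → ℤ) (y : ℕ) :
    rowSum n ψ y =
      ((∑ b : ZMod k, ψ (b ^ 2 + b * (y : ZMod k) + n * (y : ZMod k) ^ 2) : ℤ) : ℝ) := by
  have e : ∀ b : Fin k, (normForm n ((b : ℕ), y) : ZMod k) =
      ((b : ℕ) : ZMod k) ^ 2 + ((b : ℕ) : ZMod k) * (y : ZMod k) + n * (y : ZMod k) ^ 2 := by
    intro b; simp [normForm]
  simp only [rowSum, e]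
  push_cast
  obtain ⟨k, rfl⟩ := Nat.exists_eq_succ_of_ne_zero (NeZero.ne k)
  refine Finset.sum_congr rfl fun b _ => ?_
  have : ((b : ℕ) : ZMod (k + 1)) = b := Fin.cast_val_eq_self b
  simp only [this]

theorem rowSum_psi12 {n : ℕ} (hn : n % 6 = 5) : ∀ r : Fin 12, rowSum n psi12 (r + 1) =
    ((![0, 2, 0, -2, 0, -4, 0, -2, 0, 2, 0, 4] r : ℤ) : ℝ) := by
  intro r
  rw [rowSum_eq]
  have h : ∀ a : ZMod 12, a.val % 6 = 5 → ∀ r : Fin 12,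
      ∑ b : ZMod 12, psi12 (b ^ 2 + b * ((r + 1 : ℕ) : ZMod 12) + a * ((r + 1 : ℕ) : ZMod 12) ^ 2) =
      ![0, 2, 0, -2, 0, -4, 0, -2, 0, 2, 0, 4] r := by decide +kernel
  exact congrArg _ (h n (by rw [ZMod.val_natCast]; omega) r)

theorem rowSum_psi24 {n : ℕ} (hn : n % 6 = 5) : ∀ r : Fin 24, rowSum n psi24 (r + 1) =
    ((![0, 0, 0, 4, 0, 0, 0, -4, 0, 0, 0, -8, 0, 0, 0, -4, 0, 0, 0, 4, 0, 0, 0, 8] r : ℤ) : ℝ) := by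
  intro r
  rw [rowSum_eq]
  have h : ∀ a : ZMod 24, a.val % 6 = 5 → ∀ r : Fin 24,
      ∑ b : ZMod 24, psi24 (b ^ 2 + b * ((r + 1 : ℕ) : ZMod 24) + a * ((r + 1 : ℕ) : ZMod 24) ^ 2) =
      ![0, 0, 0, 4, 0, 0, 0, -4, 0, 0, 0, -8, 0, 0, 0, -4, 0, 0, 0, 4, 0, 0, 0, 8] r := by
    decide +kernel
  exact congrArg _ (h n (by rw [ZMod.val_natCast]; omega) r)

theorem sum_rowSum_psi12 {n : ℕ} (hn : n % 6 = 5) :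
    ∑ r : Fin 12, rowSum n psi12 (r + 1) = 0 := by
  simp_rw [rowSum_psi12 hn]
  rw [← Int.cast_sum]
  exact_mod_cast (by decide)

theorem sum_rowSum_psi24 {n : ℕ} (hn : n % 6 = 5) :
    ∑ r : Fin 24, rowSum n psi24 (r + 1) = 0 := by
  simp_rw [rowSum_psi24 hn]
  rw [← Int.cast_sum]
  exact_mod_cast (by decide)

open Filter Topology in
theorem tendsto_harmonic_comb :
    Tendsto (fun m : ℕ =>
      ((harmonic m - harmonic (2 * m) - harmonic (3 * m) + harmonic (6 * m) : ℚ) : ℝ))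
      atTop (𝓝 0) := by
  have h := Real.tendsto_harmonic_sub_log
  have hc : ∀ c : ℕ, 0 < c → Tendsto (fun m : ℕ => c * m) atTop atTop := fun c hc =>
    tendsto_id.const_mul_atTop' hc
  have h2 := ((h.sub (h.comp (hc 2 (by norm_num)))).sub (h.comp (hc 3 (by norm_num)))).add
    (h.comp (hc 6 (by norm_num)))
  have e0 : ∀ γ : ℝ, γ - γ - γ + γ = 0 := fun γ => by ring
  rw [e0] at h2
  refine h2.congr' ?_
  filter_upwards [eventually_ge_atTop 1] with m hm
  have hm' : (m : ℝ) ≠ 0 := by positivity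
  simp only [Function.comp_apply]
  push_cast
  rw [Real.log_mul (by norm_num) hm', Real.log_mul (by norm_num) hm',
    Real.log_mul (by norm_num) hm', show (6 : ℝ) = 2 * 3 by norm_num,
    Real.log_mul (by norm_num) (by norm_num)]
  ring

theorem harmonic_comb_succ (m : ℕ) :
    ((harmonic (m + 1) - harmonic (2 * (m + 1)) - harmonic (3 * (m + 1)) +
         harmonic (6 * (m + 1)) : ℚ) : ℝ) -
    ((harmonic m - harmonic (2 * m) - harmonic (3 * m) + harmonic (6 * m) : ℚ) : ℝ) =
    (6 * m + 1 : ℝ)⁻¹ - (6 * m + 2 : ℝ)⁻¹ - 2 * (6 * m + 3 : ℝ)⁻¹ - (6 * m + 4 : ℝ)⁻¹ +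
      (6 * m + 5 : ℝ)⁻¹ + 2 * (6 * m + 6 : ℝ)⁻¹ := by
  rw [show 2 * (m + 1) = 2 * m + 1 + 1 by ring, show 3 * (m + 1) = 3 * m + 1 + 1 + 1 by ring,
    show 6 * (m + 1) = 6 * m + 1 + 1 + 1 + 1 + 1 + 1 by ring]
  simp only [harmonic_succ]
  push_cast
  have e1 : ((m : ℝ) + 1)⁻¹ = 6 * (6 * m + 6 : ℝ)⁻¹ := by field_simp
  have e2 : (2 * (m : ℝ) + 1)⁻¹ = 3 * (6 * m + 3 : ℝ)⁻¹ := by field_simp; ring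
  have e3 : (2 * (m : ℝ) + 1 + 1)⁻¹ = 3 * (6 * m + 6 : ℝ)⁻¹ := by field_simp; ring
  have e4 : (3 * (m : ℝ) + 1)⁻¹ = 2 * (6 * m + 2 : ℝ)⁻¹ := by field_simp; ring
  have e5 : (3 * (m : ℝ) + 1 + 1)⁻¹ = 2 * (6 * m + 4 : ℝ)⁻¹ := by field_simp; ring
  have e6 : (3 * (m : ℝ) + 2 + 1)⁻¹ = 2 * (6 * m + 6 : ℝ)⁻¹ := by field_simp; ring
  rw [e1, e2, e3, e4, e5, e6]
  ring_nf

open Filter Topology in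
theorem tsum_eq_zero_of_harmonic {f : ℕ → ℝ} (hf : Summable f)
    (h : ∀ m : ℕ, f m = (6 * m + 1 : ℝ)⁻¹ - (6 * m + 2 : ℝ)⁻¹ - 2 * (6 * m + 3 : ℝ)⁻¹ -
      (6 * m + 4 : ℝ)⁻¹ + (6 * m + 5 : ℝ)⁻¹ + 2 * (6 * m + 6 : ℝ)⁻¹) : ∑' m, f m = 0 := by
  refine tendsto_nhds_unique hf.hasSum.tendsto_sum_nat (tendsto_harmonic_comb.congr fun M => ?_)
  simp_rw [h, ← harmonic_comb_succ]
  rw [Finset.sum_range_sub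
    (fun m : ℕ => ((harmonic m - harmonic (2 * m) - harmonic (3 * m) + harmonic (6 * m) : ℚ) : ℝ))]
  simp

theorem tsum_rowSum_psi12 {n : ℕ} (hn : n % 6 = 5) :
    ∑' m : ℕ, ∑ r : Fin 12, rowSum n psi12 (r + 1) * (((12 : ℕ) * m + (r + 1) : ℝ))⁻¹ = 0 := by
  refine tsum_eq_zero_of_harmonic
    (tendsto_tsum_periodic (by norm_num) (rowSum_periodic n psi12) (sum_rowSum_psi12 hn)).1
    fun m => ?_
  simp_rw [rowSum_psi12 hn]
  simp [Fin.sum_univ_succ]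
  have e : ∀ t : ℝ, t⁻¹ = 2 * (2 * t)⁻¹ := fun t => by
    rw [mul_inv, mul_inv_cancel_left₀ (by norm_num)]
  rw [e (6 * m + 1), e (6 * m + 2), e (6 * m + 3), e (6 * m + 4), e (6 * m + 5), e (6 * m + 6)]
  ring

theorem tsum_rowSum_psi24 {n : ℕ} (hn : n % 6 = 5) :
    ∑' m : ℕ, ∑ r : Fin 24, rowSum n psi24 (r + 1) * (((24 : ℕ) * m + (r + 1) : ℝ))⁻¹ = 0 := by
  refine tsum_eq_zero_of_harmonic
    (tendsto_tsum_periodic (by norm_num) (rowSum_periodic n psi24) (sum_rowSum_psi24 hn)).1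
    fun m => ?_
  simp_rw [rowSum_psi24 hn]
  simp [Fin.sum_univ_succ]
  have e : ∀ t : ℝ, t⁻¹ = 4 * (4 * t)⁻¹ := fun t => by
    rw [mul_inv, mul_inv_cancel_left₀ (by norm_num)]
  rw [e (6 * m + 1), e (6 * m + 2), e (6 * m + 3), e (6 * m + 4), e (6 * m + 5), e (6 * m + 6)]
  ring

section
variable {n d k : ℕ} [Fact d.Prime] [NeZero k]

open Filter Topology in
/-- The product of the values at `1` of two `L`-functions, up to a tiny error. -/
theorem tendsto_LSeries_mul_sub (h : RepresentsPrimes n) (hn : 4 * n = d + 1) (hodd : n % 2 = 1)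
    (hn2 : 2 ≤ n) {q : ℝ} (hq : Real.exp (-(Real.pi * √d / k)) = q) (hq2 : q ≤ 1 / 2)
    (hkd : 16 * Real.pi * k ≤ √d) (ψ : MulChar (ZMod k) ℤ)
    (hc : ∑ r : Fin k, rowSum n ψ (r + 1) = 0)
    (hc0 : ∑' m : ℕ, ∑ r : Fin k, rowSum n ψ (r + 1) * ((k * m + (r + 1) : ℝ))⁻¹ = 0) :
    ∃ E : ℝ, |E| ≤ q ∧ Tendsto (fun s : ℝ => ((∑' m : ℕ, (ψ (m : ZMod k) : ℝ) * (m : ℝ) ^ (-s)) *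
        ∑' m : ℕ, ((ψ (m : ZMod k) : ℝ) * (quadraticChar (ZMod d) (m : ZMod d) : ℝ)) *
          (m : ℝ) ^ (-s)) -
        (∑' x : ℤ, (ψ ((x ^ 2 : ℤ) : ZMod k) : ℝ) * ((x ^ 2 : ℤ) : ℝ) ^ (-s)) / 2)
      (𝓝[>] 1) (𝓝 E) := by
  obtain ⟨E, hE, hlim⟩ := tendsto_lattice_upper (k := k) hn hq hq2 (by omega) hkd
    (ψ := ψ) (abs_mulChar_le_one ψ) (fun s hs => (hasSum_lattice h hn hodd hn2 ψ hs).2) hc hc0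
  refine ⟨E, hE, hlim.congr' ?_⟩
  filter_upwards [self_mem_nhdsWithin] with s hs
  have hs1 : 1 < s := hs
  have hl := (hasSum_lattice h hn hodd hn2 ψ hs1).1
  let g : ℤ × ℤ → ℝ := fun z => (ψ (normForm n z : ZMod k) : ℝ) * (normForm n z : ℝ) ^ (-s)
  have hg : Summable g := hl.summable
  have hneg : ∀ x y : ℤ, g (-x, -y) = g (x, y) := fun x y => by
    have : normForm n (-x, -y) = normForm n (x, y) := by simp [normForm]
    simp only [g, this]
  let G : ℤ → ℝ := fun y => ∑' x : ℤ, g (x, y)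
  have hswap : Summable (fun z : ℤ × ℤ => g z.swap) := (Equiv.prodComm ℤ ℤ).summable_iff.mpr hg
  have hGs : Summable G := hswap.prod
  have hGeven : ∀ y, G (-y) = G y := fun y => by
    simp only [G]
    rw [← (Equiv.neg ℤ).tsum_eq]
    exact tsum_congr fun x => hneg x y
  have htot : ∑' z, g z = ∑' y, G y := by
    rw [← (Equiv.prodComm ℤ ℤ).tsum_eq]
    exact hswap.tsum_prod
  have hZ : ∑' y, G y = G 0 + 2 * ∑' m : ℕ, G ((m + 1 : ℕ) : ℤ) := by
    have e2 := hGs.hasSum.nat_add_neg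
    have e3 := e2.tsum_eq
    rw [e2.summable.tsum_eq_zero_add] at e3
    have e4 : ∀ m : ℕ, G ((m + 1 : ℕ) : ℤ) + G (-((m + 1 : ℕ) : ℤ)) = 2 * G ((m + 1 : ℕ) : ℤ) :=
      fun m => by rw [hGeven]; ring
    rw [tsum_congr e4, tsum_mul_left] at e3
    simp only [Nat.cast_zero, neg_zero] at e3
    linarith
  have hinj : Function.Injective (fun z : ℤ × ℕ => ((z.1, (z.2 + 1 : ℕ)) : ℤ × ℤ)) := by
    rintro ⟨j, m⟩ ⟨j', m'⟩ h
    simp only [Prod.mk.injEq] at h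
    have h2 : m + 1 = m' + 1 := by exact_mod_cast h.2
    exact Prod.ext h.1 (Nat.succ_injective h2)
  have hup : ∑' z : ℤ × ℕ, g (z.1, (z.2 + 1 : ℕ)) = ∑' m : ℕ, G ((m + 1 : ℕ) : ℤ) := by
    have h1 : Summable (fun z : ℕ × ℤ => g (z.2, (z.1 + 1 : ℕ))) :=
      (Equiv.prodComm ℕ ℤ).summable_iff.mpr (hg.comp_injective hinj)
    rw [← (Equiv.prodComm ℕ ℤ).tsum_eq]
    exact h1.tsum_prod
  have hrow : ∑' x : ℤ, (ψ ((x ^ 2 : ℤ) : ZMod k) : ℝ) * ((x ^ 2 : ℤ) : ℝ) ^ (-s) = G 0 := by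
    refine tsum_congr fun x => ?_
    have : normForm n (x, 0) = x ^ 2 := by simp [normForm]
    simp only [g, this]
  rw [hrow]
  change ∑' z : ℤ × ℕ, g (z.1, (z.2 + 1 : ℕ)) = _
  have := hl.tsum_eq
  change ∑' z, g z = _ at this
  rw [hup]
  linarith

end

theorem one_le_row {s : ℝ} (hs : 1 < s) :
    1 ≤ (∑' x : ℤ, (psi12 ((x ^ 2 : ℤ) : ZMod 12) : ℝ) * ((x ^ 2 : ℤ) : ℝ) ^ (-s)) / 2 := by
  have hnn : ∀ a : ZMod 12, 0 ≤ psi12 (a ^ 2) ∧ psi12 (a ^ 2) ≤ 1 := by decide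
  have h0 : ∀ x : ℤ, (0 : ℝ) ≤ (psi12 ((x ^ 2 : ℤ) : ZMod 12) : ℝ) * ((x ^ 2 : ℤ) : ℝ) ^ (-s) := by
    intro x
    refine mul_nonneg ?_ (Real.rpow_nonneg (by positivity) _)
    rw [Int.cast_pow]
    exact_mod_cast (hnn x).1
  have hsum : Summable (fun x : ℤ =>
      (psi12 ((x ^ 2 : ℤ) : ZMod 12) : ℝ) * ((x ^ 2 : ℤ) : ℝ) ^ (-s)) := by
    refine Summable.of_nonneg_of_le h0 (fun x => ?_)
      (Real.summable_abs_int_rpow (b := 2 * s) (by linarith))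
    have h1 : (psi12 ((x ^ 2 : ℤ) : ZMod 12) : ℝ) ≤ 1 := by
      rw [Int.cast_pow]
      exact_mod_cast (hnn x).2
    refine (mul_le_of_le_one_left (Real.rpow_nonneg (by positivity) _) h1).trans (le_of_eq ?_)
    push_cast
    rw [← sq_abs, ← Real.rpow_natCast, ← Real.rpow_mul (abs_nonneg _)]
    congr 1
    push_cast
    ring
  have h2 := hsum.sum_le_tsum ({1, -1} : Finset ℤ) (fun x _ => h0 x)
  rw [Finset.sum_pair (by norm_num)] at h2
  have h3 : psi12 1 = 1 := rfl
  have h4 : ((-1 : ℤ) ^ 2) = 1 := by norm_num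
  have h5 : (psi12 (((1 : ℤ)) : ZMod 12) : ℝ) * ((1 : ℤ) : ℝ) ^ (-s) = 1 := by simp [h3]
  rw [h4, one_pow, h5] at h2
  linarith

open Filter Topology in
theorem product_estimates {n d : ℕ} [Fact d.Prime] (h : RepresentsPrimes n) (hn : 4 * n = d + 1)
    (hn6 : n % 6 = 5) (hn1 : 1000000 < n) {l12 l24 m12 m24 : ℝ}
    (hl12 : Tendsto (fun s : ℝ => ∑' m : ℕ, (psi12 (m : ZMod 12) : ℝ) * (m : ℝ) ^ (-s))
      (𝓝[>] 1) (𝓝 l12))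
    (hl24 : Tendsto (fun s : ℝ => ∑' m : ℕ, (psi24 (m : ZMod 24) : ℝ) * (m : ℝ) ^ (-s))
      (𝓝[>] 1) (𝓝 l24))
    (hm12 : Tendsto (fun s : ℝ => ∑' m : ℕ, ((psi12 (m : ZMod 12) : ℝ) *
      (quadraticChar (ZMod d) (m : ZMod d) : ℝ)) * (m : ℝ) ^ (-s)) (𝓝[>] 1) (𝓝 m12))
    (hm24 : Tendsto (fun s : ℝ => ∑' m : ℕ, ((psi24 (m : ZMod 24) : ℝ) *
      (quadraticChar (ZMod d) (m : ZMod d) : ℝ)) * (m : ℝ) ^ (-s)) (𝓝[>] 1) (𝓝 m24)) :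
    |l12 * m12 - l24 * m24| ≤ 2 * Real.exp (-(Real.pi * √d / 24)) ∧ 1 / 2 ≤ l12 * m12 := by
  have hd : (2000 : ℝ) ≤ √d := by
    refine Real.le_sqrt_of_sq_le ?_
    have : 4000000 ≤ d := by omega
    calc (2000 : ℝ) ^ 2 = 4000000 := by norm_num
      _ ≤ d := by exact_mod_cast this
  have hpi := Real.pi_lt_d2
  have hpi3 := Real.pi_gt_three
  have hle : Real.exp (-(Real.pi * √d / (12 : ℕ))) ≤ Real.exp (-(Real.pi * √d / 24)) := by
    refine Real.exp_le_exp.mpr (neg_le_neg ?_)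
    push_cast
    have : 0 ≤ Real.pi * √d := by positivity
    linarith
  have hq24 : Real.exp (-(Real.pi * √d / 24)) ≤ 1 / 2 := by
    have h1 : (1 : ℝ) ≤ Real.pi * √d / 24 := by nlinarith
    have h2 : Real.exp (-(Real.pi * √d / 24)) ≤ Real.exp (-1) := Real.exp_le_exp.mpr (by linarith)
    have h3 := Real.exp_neg_one_lt_d9
    linarith
  obtain ⟨E, hE, hEl⟩ := tendsto_LSeries_mul_sub (k := 12) h hn (by omega) (by omega) rfl
    (hle.trans hq24) (by push_cast; nlinarith) psi12 (sum_rowSum_psi12 hn6)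
    (tsum_rowSum_psi12 hn6)
  obtain ⟨F, hF, hFl⟩ := tendsto_LSeries_mul_sub (k := 24) h hn (by omega) (by omega) rfl
    hq24 (by push_cast; nlinarith) psi24 (sum_rowSum_psi24 hn6) (tsum_rowSum_psi24 hn6)
  have h12 := hl12.mul hm12
  have h24 := hl24.mul hm24
  simp_rw [← psi12_sq_eq] at hFl
  have hdiff : l12 * m12 - l24 * m24 = E - F := by
    refine tendsto_nhds_unique (h12.sub h24) ((hEl.sub hFl).congr fun s => ?_)
    ring
  constructor
  · rw [hdiff]
    refine (abs_sub _ _).trans ?_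
    push_cast at hF
    linarith
  · have h1 : 1 ≤ l12 * m12 - E := by
      refine ge_of_tendsto (h12.sub hEl) ?_
      filter_upwards [self_mem_nhdsWithin] with s hs
      have := one_le_row hs
      linarith
    have := abs_le.mp (hE.trans (hle.trans hq24))
    linarith

open Filter Topology intervalIntegral in
/-- The value at `1` of a series with periodic coefficients, as the integral of a rational
function whose primitive is `F`. -/
theorem tsum_blocks_eq_sub {k : ℕ} (hk : 0 < k) {f : Fin k → ℝ} {R F : ℝ → ℝ}
    (hR : ContinuousOn R (Set.Icc 0 1))
    (hfR : ∀ x ∈ Set.Icc (0 : ℝ) 1, ∑ a : Fin k, f a * x ^ (a : ℕ) = R x * (1 - x ^ k))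
    (hF : ∀ x ∈ Set.Icc (0 : ℝ) 1, HasDerivAt F (R x) x)
    (hs : Summable fun m : ℕ => ∑ a : Fin k, f a * ((k * m + (a + 1) : ℝ))⁻¹) :
    ∑' m : ℕ, ∑ a : Fin k, f a * ((k * m + (a + 1) : ℝ))⁻¹ = F 1 - F 0 := by
  obtain ⟨C, hC⟩ := isCompact_Icc.exists_bound_of_continuousOn hR
  have hC0 : 0 ≤ C := (norm_nonneg _).trans (hC 0 (by simp))
  set b : ℕ → ℝ := fun m => ∑ a : Fin k, f a * ((k * m + (a + 1) : ℝ))⁻¹ with hb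
  have key : ∀ M : ℕ, |F 1 - F 0 - ∑ m ∈ Finset.range M, b m| ≤ C / (k * M + 1) := by
    intro M
    set G : ℝ → ℝ := fun x => F x - ∑ m ∈ Finset.range M, ∑ a : Fin k,
      f a * ((k * m + (a + 1) : ℝ))⁻¹ * x ^ (k * m + (a + 1)) with hG
    have hderiv : ∀ x ∈ Set.uIcc (0 : ℝ) 1, HasDerivAt G (R x * x ^ (k * M)) x := by
      intro x hx
      rw [Set.uIcc_of_le zero_le_one] at hx
      have h1 : HasDerivAt (fun x : ℝ => ∑ m ∈ Finset.range M, ∑ a : Fin k,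
          f a * ((k * m + (a + 1) : ℝ))⁻¹ * x ^ (k * m + (a + 1)))
          (∑ m ∈ Finset.range M, ∑ a : Fin k, f a * x ^ (a : ℕ) * x ^ (k * m)) x := by
        refine HasDerivAt.fun_sum fun m _ => HasDerivAt.fun_sum fun a _ => ?_
        have := (hasDerivAt_pow (k * m + (a + 1)) x).const_mul (f a * ((k * m + (a + 1) : ℝ))⁻¹)
        refine this.congr_deriv ?_
        have h0 : ((k * m + (a + 1) : ℝ)) ≠ 0 := by positivity
        have e : k * m + ((a : ℕ) + 1) - 1 = a + k * m := by omega
        rw [e, pow_add]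
        push_cast
        field_simp
      refine ((hF x hx).sub h1).congr_deriv ?_
      have h2 : ∀ m, ∑ a : Fin k, f a * x ^ (a : ℕ) * x ^ (k * m) =
          R x * (x ^ (k * m) - x ^ (k * (m + 1))) := by
        intro m
        rw [← Finset.sum_mul, hfR x hx]
        ring
      simp only [h2]
      rw [← Finset.mul_sum, Finset.sum_range_sub' (fun m => x ^ (k * m))]
      simp
      ring
    have hcont : ContinuousOn (fun x => R x * x ^ (k * M)) (Set.uIcc (0 : ℝ) 1) := by
      rw [Set.uIcc_of_le zero_le_one]
      fun_prop
    have hI := integral_eq_sub_of_hasDerivAt hderiv hcont.intervalIntegrable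
    have hG1 : G 1 - G 0 = F 1 - F 0 - ∑ m ∈ Finset.range M, b m := by
      simp [hG, hb]
      ring
    rw [← hG1, ← hI]
    have := norm_integral_le_of_norm_le (μ := MeasureTheory.volume) (a := (0 : ℝ)) (b := 1)
      (f := fun x => R x * x ^ (k * M)) (g := fun x => C * x ^ (k * M)) zero_le_one
      (Filter.Eventually.of_forall fun t ht => by
        rw [norm_mul, norm_pow, Real.norm_of_nonneg ht.1.le]
        exact mul_le_mul_of_nonneg_right (hC t ⟨ht.1.le, ht.2⟩) (pow_nonneg ht.1.le _))
      (Continuous.intervalIntegrable (by fun_prop) _ _)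
    rw [Real.norm_eq_abs] at this
    refine this.trans (le_of_eq ?_)
    rw [intervalIntegral.integral_const_mul, integral_pow]
    simp
    ring
  have hlim : Tendsto (fun M : ℕ => F 1 - F 0 - ∑ m ∈ Finset.range M, b m) atTop (𝓝 0) := by
    refine squeeze_zero_norm key ?_
    refine Tendsto.div_atTop tendsto_const_nhds ?_
    refine tendsto_atTop_add_const_right _ _ ?_
    exact Tendsto.const_mul_atTop (by exact_mod_cast hk) tendsto_natCast_atTop_atTop
  have h2 := tendsto_const_nhds.sub hs.hasSum.tendsto_sum_nat (a := F 1 - F 0)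
  have := tendsto_nhds_unique hlim h2
  linarith

open Filter Topology in
theorem tendsto_tsum_psi12 :
    Tendsto (fun s : ℝ => ∑' m : ℕ, (psi12 (m : ZMod 12) : ℝ) * (m : ℝ) ^ (-s)) (𝓝[>] 1)
      (𝓝 (Real.log (2 + √3) / √3)) := by
  have hval : ∀ a : Fin 12, ((psi12 (((a : ℕ) + 1 : ℕ) : ZMod 12) : ℤ) : ℝ) =
      ((![1, 0, 0, 0, -1, 0, -1, 0, 0, 0, 1, 0] a : ℤ) : ℝ) := by
    intro a; norm_cast; revert a; decide
  have h := tendsto_tsum_periodic (N := 12) (by norm_num)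
    (f := fun m : ℕ => (psi12 (m : ZMod 12) : ℝ))
    (fun m => by
      have : ((m + 12 : ℕ) : ZMod 12) = m := by
        rw [Nat.cast_add, ZMod.natCast_self, add_zero]
      simp only [this])
    (by simp only [hval]; norm_cast)
  simp only [hval] at h
  have h3 : √3 ^ 2 = 3 := Real.sq_sqrt (by norm_num)
  have h3p : 0 < √3 := by positivity
  have hP : ∀ x : ℝ, 0 < x ^ 2 + √3 * x + 1 := fun x => by nlinarith [sq_nonneg (2 * x + √3)]
  have hQ : ∀ x : ℝ, 0 < x ^ 2 - √3 * x + 1 := fun x => by nlinarith [sq_nonneg (2 * x - √3)]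
  have hPQ : ∀ x : ℝ, (x ^ 2 + √3 * x + 1) * (x ^ 2 - √3 * x + 1) = x ^ 4 - x ^ 2 + 1 := fun x => by
    linear_combination (-x ^ 2) * h3
  have hD : ∀ x : ℝ, x ^ 4 - x ^ 2 + 1 ≠ 0 := fun x => by
    rw [← hPQ]; exact (mul_pos (hP x) (hQ x)).ne'
  have h1 := tsum_blocks_eq_sub (k := 12) (by norm_num)
    (R := fun x => (1 - x ^ 2) / (x ^ 4 - x ^ 2 + 1))
    (F := fun x => (2 * √3)⁻¹ * (Real.log (x ^ 2 + √3 * x + 1) - Real.log (x ^ 2 - √3 * x + 1)))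
    (Continuous.continuousOn (by fun_prop (disch := exact hD _)))
    (f := fun a : Fin 12 => ((![1, 0, 0, 0, -1, 0, -1, 0, 0, 0, 1, 0] a : ℤ) : ℝ))
    (fun x _ => by
      rw [div_mul_eq_mul_div, eq_div_iff (hD x)]
      simp [Fin.sum_univ_succ]
      ring)
    (fun x _ => by
      have d1 : HasDerivAt (fun x : ℝ => x ^ 2 + √3 * x + 1) (2 * x + √3) x := by
        refine (((hasDerivAt_pow 2 x).add ((hasDerivAt_id x).const_mul √3)).add_const
          1).congr_deriv ?_
        simp
      have d2 : HasDerivAt (fun x : ℝ => x ^ 2 - √3 * x + 1) (2 * x - √3) x := by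
        refine (((hasDerivAt_pow 2 x).sub ((hasDerivAt_id x).const_mul √3)).add_const
          1).congr_deriv ?_
        simp
      refine (((d1.log (hP x).ne').sub (d2.log (hQ x).ne')).const_mul _).congr_deriv ?_
      rw [← hPQ]
      have hP' := (hP x).ne'
      have hQ' := (hQ x).ne'
      rw [div_sub_div _ _ hP' hQ', inv_mul_eq_div, div_div, div_eq_div_iff (by positivity)
        (mul_ne_zero hP' hQ')]
      ring)
    (by exact_mod_cast h.1)
  have h2 := h.2
  push_cast at h2 h1
  rw [h1] at h2
  refine h2.congr' (Eventually.of_forall fun s => by rfl) |>.trans (le_of_eq ?_)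
  congr 1
  have hp : (0 : ℝ) < 2 + √3 := by positivity
  have e : (1 : ℝ) ^ 2 - √3 * 1 + 1 = (2 + √3)⁻¹ := by
    refine eq_inv_of_mul_eq_one_left ?_
    linear_combination -h3
  rw [e, Real.log_inv]
  have e2 : (1 : ℝ) ^ 2 + √3 * 1 + 1 = 2 + √3 := by ring
  rw [e2]
  simp
  field_simp
  ring

open Filter Topology in
theorem tendsto_tsum_psi24 :
    Tendsto (fun s : ℝ => ∑' m : ℕ, (psi24 (m : ZMod 24) : ℝ) * (m : ℝ) ^ (-s)) (𝓝[>] 1)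
      (𝓝 (Real.log (5 + 2 * √6) / √6)) := by
  have hval : ∀ a : Fin 24, ((psi24 (((a : ℕ) + 1 : ℕ) : ZMod 24) : ℤ) : ℝ) =
      ((![1, 0, 0, 0, 1, 0, -1, 0, 0, 0, -1, 0,
        -1, 0, 0, 0, -1, 0, 1, 0, 0, 0, 1, 0] a : ℤ) : ℝ) := by
    intro a; norm_cast; revert a; decide
  have h := tendsto_tsum_periodic (N := 24) (by norm_num)
    (f := fun m : ℕ => (psi24 (m : ZMod 24) : ℝ))
    (fun m => by
      have : ((m + 24 : ℕ) : ZMod 24) = m := by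
        rw [Nat.cast_add, ZMod.natCast_self, add_zero]
      simp only [this])
    (by simp only [hval]; norm_cast)
  simp only [hval] at h
  have h6 : √6 ^ 2 = 6 := Real.sq_sqrt (by norm_num)
  have h6p : 0 < √6 := by positivity
  have hPQ : ∀ x : ℝ, (x ^ 4 + √6 * x ^ 3 + 3 * x ^ 2 + √6 * x + 1) *
      (x ^ 4 - √6 * x ^ 3 + 3 * x ^ 2 - √6 * x + 1) = x ^ 8 - x ^ 4 + 1 := fun x => by
    linear_combination (-(x ^ 3 + x) ^ 2) * h6
  have hD' : ∀ x : ℝ, 0 < x ^ 8 - x ^ 4 + 1 := fun x => by nlinarith [sq_nonneg (2 * x ^ 4 - 1)]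
  have hD : ∀ x : ℝ, x ^ 8 - x ^ 4 + 1 ≠ 0 := fun x => (hD' x).ne'
  have hP : ∀ x ∈ Set.Icc (0 : ℝ) 1, 0 < x ^ 4 + √6 * x ^ 3 + 3 * x ^ 2 + √6 * x + 1 := by
    intro x hx
    have := hx.1
    positivity
  have hQ : ∀ x ∈ Set.Icc (0 : ℝ) 1, 0 < x ^ 4 - √6 * x ^ 3 + 3 * x ^ 2 - √6 * x + 1 := by
    intro x hx
    have := hD' x
    rw [← hPQ] at this
    exact pos_of_mul_pos_right this (hP x hx).le
  have h1 := tsum_blocks_eq_sub (k := 24) (by norm_num)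
    (R := fun x => (1 - x ^ 6) / (x ^ 8 - x ^ 4 + 1))
    (F := fun x => (2 * √6)⁻¹ * (Real.log (x ^ 4 + √6 * x ^ 3 + 3 * x ^ 2 + √6 * x + 1) -
      Real.log (x ^ 4 - √6 * x ^ 3 + 3 * x ^ 2 - √6 * x + 1)))
    (Continuous.continuousOn (by fun_prop (disch := exact hD _)))
    (f := fun a : Fin 24 => ((![1, 0, 0, 0, 1, 0, -1, 0, 0, 0, -1, 0, -1, 0, 0, 0, -1, 0, 1, 0, 0,
      0, 1, 0] a : ℤ) : ℝ))
    (fun x _ => by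
      rw [div_mul_eq_mul_div, eq_div_iff (hD x)]
      simp [Fin.sum_univ_succ]
      ring)
    (fun x hx => by
      have d1 : HasDerivAt (fun x : ℝ => x ^ 4 + √6 * x ^ 3 + 3 * x ^ 2 + √6 * x + 1)
          (4 * x ^ 3 + √6 * (3 * x ^ 2) + 3 * (2 * x) + √6) x := by
        refine (((((hasDerivAt_pow 4 x).add ((hasDerivAt_pow 3 x).const_mul √6)).add
          ((hasDerivAt_pow 2 x).const_mul 3)).add
          ((hasDerivAt_id x).const_mul √6)).add_const 1).congr_deriv ?_
        simp
      have d2 : HasDerivAt (fun x : ℝ => x ^ 4 - √6 * x ^ 3 + 3 * x ^ 2 - √6 * x + 1)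
          (4 * x ^ 3 - √6 * (3 * x ^ 2) + 3 * (2 * x) - √6) x := by
        refine (((((hasDerivAt_pow 4 x).sub ((hasDerivAt_pow 3 x).const_mul √6)).add
          ((hasDerivAt_pow 2 x).const_mul 3)).sub
          ((hasDerivAt_id x).const_mul √6)).add_const 1).congr_deriv ?_
        simp
      refine (((d1.log (hP x hx).ne').sub (d2.log (hQ x hx).ne')).const_mul _).congr_deriv ?_
      rw [← hPQ]
      have hP' := (hP x hx).ne'
      have hQ' := (hQ x hx).ne'
      rw [div_sub_div _ _ hP' hQ', inv_mul_eq_div, div_div, div_eq_div_iff (by positivity)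
        (mul_ne_zero hP' hQ')]
      ring)
    (by exact_mod_cast h.1)
  have h2 := h.2
  push_cast at h2 h1
  rw [h1] at h2
  refine h2.congr' (Eventually.of_forall fun s => by rfl) |>.trans (le_of_eq ?_)
  congr 1
  have hp : (0 : ℝ) < 5 + 2 * √6 := by positivity
  have e : (1 : ℝ) ^ 4 - √6 * 1 ^ 3 + 3 * 1 ^ 2 - √6 * 1 + 1 = (5 + 2 * √6)⁻¹ := by
    refine eq_inv_of_mul_eq_one_left ?_
    linear_combination -4 * h6
  rw [e, Real.log_inv]
  have e2 : (1 : ℝ) ^ 4 + √6 * 1 ^ 3 + 3 * 1 ^ 2 + √6 * 1 + 1 = 5 + 2 * √6 := by ring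
  rw [e2]
  simp
  field_simp
  ring

open Complex in
theorem sum_mul_pow_of_pow_eq_one {x : ℂ} {n : ℕ} (hn : x ^ n = 1) (hx : x ≠ 1) :
    (∑ r ∈ Finset.range n, (r : ℂ) * x ^ r) * (x - 1) = n := by
  have h : ∀ m : ℕ, (∑ r ∈ Finset.range m, (r : ℂ) * x ^ r) * (x - 1) =
      m * x ^ m - ∑ r ∈ Finset.range m, x ^ (r + 1) := by
    intro m
    induction m with
    | zero => simp
    | succ m ih =>
      rw [Finset.sum_range_succ, Finset.sum_range_succ, add_mul, ih]
      push_cast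
      ring
  rw [h, hn]
  have h2 : (∑ r ∈ Finset.range n, x ^ (r + 1)) = 0 := by
    have := mul_neg_geom_sum x n
    simp only [pow_succ]
    rw [← Finset.sum_mul]
    have h3 : 1 - x ≠ 0 := sub_ne_zero.mpr (Ne.symm hx)
    rw [hn, sub_self] at this
    rw [(mul_eq_zero.mp this).resolve_left h3, zero_mul]
  rw [h2]
  ring

theorem sum_range_eq_sum_zmod {M : Type*} [AddCommMonoid M] {N : ℕ} [NeZero N] (g : ℕ → M) :
    ∑ j ∈ Finset.range N, g j = ∑ z : ZMod N, g z.val := by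
  obtain ⟨n, rfl⟩ := Nat.exists_eq_succ_of_ne_zero (NeZero.ne N)
  exact (Fin.sum_univ_eq_sum_range g (n + 1)).symm

theorem natCast_div_mem_integerComplement {v N : ℕ} (hv : 0 < v) (hvN : v < N) :
    (v / N : ℂ) ∈ Complex.integerComplement := by
  rintro ⟨k, hk⟩
  have hN : (N : ℂ) ≠ 0 := by exact_mod_cast (by omega : N ≠ 0)
  rw [eq_div_iff hN] at hk
  have hk : k * N = v := by exact_mod_cast hk
  have h1 : 0 < k := by
    by_contra h
    nlinarith [mul_nonneg_of_nonpos_of_nonpos (not_lt.mp h) (by omega : -(N : ℤ) ≤ 0)]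
  nlinarith

open Filter Topology in
theorem tendsto_sum_inv_sub_inv {v N : ℕ} (hv : 0 < v) (hvN : v < N) :
    Tendsto (fun M : ℕ => ∑ m ∈ Finset.range M,
      (((N * m + v : ℂ))⁻¹ - ((N * m + (N - v) : ℂ))⁻¹)) atTop
      (𝓝 (Real.pi / N * Complex.cot (Real.pi * (v / N)))) := by
  have hx := natCast_div_mem_integerComplement hv hvN
  set x : ℂ := v / N with hxdef
  have hN : (N : ℂ) ≠ 0 := by exact_mod_cast (by omega : N ≠ 0)
  have hne : ∀ a : ℤ, x + a ≠ 0 := fun a => Complex.integerComplement_add_ne_zero hx a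
  have hvx : (v : ℂ) = N * x := by rw [hxdef]; field_simp
  have hS := (summable_cotTerm hx).hasSum.tendsto_sum_nat
  rw [← cot_series_rep' hx] at hS
  have hterm : ∀ M : ℕ, ∑ m ∈ Finset.range M,
      (((N * m + v : ℂ))⁻¹ - ((N * m + (N - v) : ℂ))⁻¹) =
      (N : ℂ)⁻¹ * (1 / x + ∑ m ∈ Finset.range M, cotTerm x m - 1 / (x + M)) := by
    intro M
    induction M with
    | zero => simp
    | succ M ih =>
      rw [Finset.sum_range_succ, ih, Finset.sum_range_succ, hvx]
      have h1 : (N * M + N * x : ℂ) = N * (x + M) := by ring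
      have h2 : (N * M + (N - N * x) : ℂ) = -(N * (x - (M + 1))) := by ring
      have e1 : x + M ≠ 0 := by exact_mod_cast hne M
      have e2 : x - (M + 1) ≠ 0 := by
        have := hne (-(M + 1)); push_cast at this; rwa [← sub_eq_add_neg] at this
      have e3 : x + (M + 1) ≠ 0 := by exact_mod_cast hne (M + 1)
      rw [h1, h2, cotTerm, inv_neg, mul_inv, mul_inv]
      push_cast
      ring
  simp only [hterm]
  have h0 : Tendsto (fun M : ℕ => 1 / (x + M)) atTop (𝓝 0) := by
    simp only [one_div]
    refine tendsto_inv₀_cobounded.comp ?_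
    refine (tendsto_const_add_cobounded x).comp ?_
    rw [← tendsto_norm_atTop_iff_cobounded]
    simpa using tendsto_natCast_atTop_atTop (R := ℝ)
  have := ((hS.const_add (1 / x)).sub h0).const_mul (N : ℂ)⁻¹
  refine this.congr' (Eventually.of_forall fun M => by simp) |>.trans (le_of_eq ?_)
  congr 1
  field_simp
  ring

section OddCharacter

variable {N : ℕ} {f : ZMod N →* ℤ}

theorem MonoidHom.map_nonunit_eq_zero
    (H : ∀ r : ZMod N, ¬IsUnit r → ∃ u, f u = -1 ∧ u * r = r) {r : ZMod N} (hr : ¬IsUnit r) :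
    f r = 0 := by
  obtain ⟨u, hu, hur⟩ := H r hr
  have := f.map_mul u r
  rw [hur, hu] at this
  omega

theorem MonoidHom.map_zero_of_odd (hodd : f (-1) = -1)
    (H : ∀ r : ZMod N, ¬IsUnit r → ∃ u, f u = -1 ∧ u * r = r) : f 0 = 0 := by
  refine f.map_nonunit_eq_zero H fun h => ?_
  have h01 : (0 : ZMod N) = 1 := isUnit_zero_iff.mp h
  have h2 : (-1 : ZMod N) = 1 := by
    rw [← h01]; simp
  rw [h2, map_one] at hodd
  omega

theorem MonoidHom.map_neg_of_odd (hodd : f (-1) = -1) (z : ZMod N) : f (-z) = -f z := by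
  rw [← neg_one_mul, map_mul, hodd, neg_one_mul]

variable [NeZero N]

theorem MonoidHom.sum_eq_zero_of_odd (hodd : f (-1) = -1) : ∑ z : ZMod N, f z = 0 := by
  have h := Equiv.sum_comp (Equiv.neg (ZMod N)) f
  simp only [Equiv.neg_apply, f.map_neg_of_odd hodd, Finset.sum_neg_distrib] at h
  omega

open ZMod in
/-- Gauss sums of a quadratic character twisted by an additive character. -/
theorem sum_mul_stdAddChar (H : ∀ r : ZMod N, ¬IsUnit r → ∃ u, f u = -1 ∧ u * r = r)
    (r : ZMod N) (hsq : ∀ r : ZMod N, IsUnit r → f r * f r = 1) :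
    ∑ z : ZMod N, (f z : ℂ) * stdAddChar (r * z) =
      f r * ∑ z : ZMod N, (f z : ℂ) * stdAddChar z := by
  by_cases hr : IsUnit r
  · obtain ⟨u, rfl⟩ := hr
    have h1 := Equiv.sum_comp (Units.mulLeft u) (fun z : ZMod N => (f z : ℂ) * stdAddChar z)
    rw [← h1]
    simp only [Units.mulLeft_apply, map_mul, Int.cast_mul, mul_assoc]
    rw [← Finset.mul_sum, ← mul_assoc]
    have := hsq u u.isUnit
    have h2 : (f u : ℂ) * f u = 1 := by exact_mod_cast this
    rw [h2, one_mul]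
  · rw [f.map_nonunit_eq_zero H hr, Int.cast_zero, zero_mul]
    obtain ⟨u, hu, hur⟩ := H r hr
    have huu : IsUnit u := by
      by_contra h
      rw [f.map_nonunit_eq_zero H h] at hu
      omega
    obtain ⟨u, rfl⟩ := huu
    have h1 := Equiv.sum_comp (Units.mulLeft u) (fun z : ZMod N => (f z : ℂ) * stdAddChar (r * z))
    simp only [Units.mulLeft_apply, map_mul, hu, Int.cast_mul, Int.cast_neg, Int.cast_one] at h1
    have h2 : ∀ z : ZMod N, r * (u * z) = r * z := fun z => by
      rw [← mul_assoc, mul_comm r, hur]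
    simp only [h2, neg_mul, one_mul, Finset.sum_neg_distrib] at h1
    exact self_eq_neg.mp h1.symm

open ZMod in
theorem gaussSum_sq_of_odd (hodd : f (-1) = -1)
    (H : ∀ r : ZMod N, ¬IsUnit r → ∃ u, f u = -1 ∧ u * r = r)
    (hsq : ∀ r : ZMod N, IsUnit r → f r * f r = 1) :
    (∑ z : ZMod N, (f z : ℂ) * stdAddChar z) ^ 2 = -N := by
  set τ := ∑ z : ZMod N, (f z : ℂ) * stdAddChar z with hτ
  set Φ : ZMod N → ℂ := fun z => f z with hΦ
  have h1 : dft Φ = (-τ) • Φ := by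
    ext k
    rw [dft_apply]
    have := sum_mul_stdAddChar H (-k) hsq
    rw [f.map_neg_of_odd hodd, ← hτ] at this
    simp only [Pi.smul_apply, smul_eq_mul, hΦ]
    rw [show -τ * (f k : ℂ) = ((-f k : ℤ) : ℂ) * τ by push_cast; ring, ← this]
    refine Finset.sum_congr rfl fun z _ => ?_
    rw [mul_comm]
    congr 2
    ring
  have h2 := congrFun (dft_dft Φ) 1
  rw [h1, _root_.map_smul, h1] at h2
  simp only [Pi.smul_apply, smul_eq_mul, hΦ, hodd, map_one] at h2
  push_cast at h2
  linear_combination h2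

open ZMod in
theorem sum_mul_cot (hodd : f (-1) = -1)
    (H : ∀ r : ZMod N, ¬IsUnit r → ∃ u, f u = -1 ∧ u * r = r)
    (hsq : ∀ r : ZMod N, IsUnit r → f r * f r = 1) :
    ∑ z : ZMod N, (f z : ℂ) * Complex.cot (Real.pi * (z.val / N)) =
      2 * Complex.I / N * ((∑ z : ZMod N, (f z : ℂ) * stdAddChar z) *
        ((∑ r : ZMod N, (r.val : ℤ) * f r : ℤ) : ℂ)) := by
  have hN : (N : ℂ) ≠ 0 := by exact_mod_cast NeZero.ne N
  have h0 := f.map_zero_of_odd hodd H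
  have hz : ∀ z : ZMod N, (f z : ℂ) * Complex.cot (Real.pi * (z.val / N)) =
      Complex.I * f z +
        2 * Complex.I / N * ∑ r : ZMod N, (r.val : ℂ) * ((f z : ℂ) * stdAddChar (r * z)) := by
    intro z
    rcases eq_or_ne z 0 with rfl | hz
    · simp [h0]
    have he : stdAddChar z = Complex.exp (2 * Real.pi * Complex.I * (z.val / N)) := by
      rw [stdAddChar_apply, toCircle_apply]
      congr 1
      ring
    rw [Complex.cot_pi_eq_exp_ratio, ← he]
    have hne : stdAddChar z ≠ (1 : ℂ) := fun h =>
      hz (injective_stdAddChar (by rw [h, AddChar.map_zero_eq_one]))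
    have hpow : stdAddChar z ^ N = (1 : ℂ) := by
      rw [← AddChar.map_nsmul_eq_pow]
      simp
    have hs := sum_mul_pow_of_pow_eq_one hpow hne
    have hs2 : ∑ r ∈ Finset.range N, (r : ℂ) * stdAddChar z ^ r =
        ∑ r : ZMod N, (r.val : ℂ) * stdAddChar (r * z) := by
      rw [sum_range_eq_sum_zmod]
      refine Finset.sum_congr rfl fun r _ => ?_
      rw [← AddChar.map_nsmul_eq_pow, nsmul_eq_mul, ZMod.natCast_zmod_val]
    rw [hs2] at hs
    have e : ∑ r : ZMod N, (r.val : ℂ) * ((f z : ℂ) * stdAddChar (r * z)) =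
        f z * ∑ r : ZMod N, (r.val : ℂ) * stdAddChar (r * z) := by
      rw [Finset.mul_sum]
      exact Finset.sum_congr rfl fun r _ => by ring
    rw [e]
    set w := ∑ r : ZMod N, (r.val : ℂ) * stdAddChar (r * z)
    set t := stdAddChar z
    have ht : 1 - t ≠ 0 := sub_ne_zero.mpr (Ne.symm hne)
    have hI := Complex.I_ne_zero
    have hII := Complex.I_sq
    field_simp
    linear_combination (f z : ℂ) * (-2) * hs + (f z : ℂ) * (N * (t - 1) + 2 * w * (t - 1)) * hII
  rw [Finset.sum_congr rfl fun z _ => hz z, Finset.sum_add_distrib, ← Finset.mul_sum,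
    ← Finset.mul_sum, Finset.sum_comm]
  have hsum : ∑ z : ZMod N, (f z : ℂ) = 0 := by exact_mod_cast f.sum_eq_zero_of_odd hodd
  rw [hsum, mul_zero, zero_add]
  congr 1
  push_cast
  rw [Finset.mul_sum]
  refine Finset.sum_congr rfl fun r _ => ?_
  rw [← Finset.mul_sum, sum_mul_stdAddChar H r hsq]
  ring

open Filter Topology in
/-- The value at `1` of the `L`-series of an odd primitive quadratic character. -/
theorem tendsto_tsum_oddCharacter (hodd : f (-1) = -1)
    (H : ∀ r : ZMod N, ¬IsUnit r → ∃ u, f u = -1 ∧ u * r = r)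
    (hsq : ∀ r : ZMod N, IsUnit r → f r * f r = 1) :
    ∃ ε : ℝ, (ε = 1 ∨ ε = -1) ∧
      Tendsto (fun s : ℝ => ∑' m : ℕ, (f (m : ZMod N) : ℝ) * (m : ℝ) ^ (-s)) (𝓝[>] 1)
        (𝓝 (ε * Real.pi * ((∑ r : ZMod N, (r.val : ℤ) * f r : ℤ) : ℝ) / (N * √N))) := by
  have hNpos : 0 < N := Nat.pos_of_ne_zero (NeZero.ne N)
  have hN : (N : ℂ) ≠ 0 := by exact_mod_cast NeZero.ne N
  have h0 := f.map_zero_of_odd hodd H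
  set τ := ∑ z : ZMod N, (f z : ℂ) * ZMod.stdAddChar z with hτ
  set S : ℤ := ∑ r : ZMod N, (r.val : ℤ) * f r with hS
  have hτ2 : τ ^ 2 = -N := gaussSum_sq_of_odd hodd H hsq
  obtain ⟨ε, hε, hετ⟩ : ∃ ε : ℝ, (ε = 1 ∨ ε = -1) ∧ Complex.I * τ = ε * (√N : ℝ) := by
    have : (Complex.I * τ) ^ 2 = ((√N : ℝ) : ℂ) ^ 2 := by
      rw [mul_pow, hτ2, Complex.I_sq, ← Complex.ofReal_pow, Real.sq_sqrt (Nat.cast_nonneg N)]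
      simp
    rcases sq_eq_sq_iff_eq_or_eq_neg.mp this with h | h
    · exact ⟨1, Or.inl rfl, by rw [h]; simp⟩
    · exact ⟨-1, Or.inr rfl, by rw [h]; simp⟩
  refine ⟨ε, hε, ?_⟩
  have hshift : ∀ g : ℕ → ℝ, g 0 = 0 → g N = 0 →
      ∑ a : Fin N, g (a + 1) = ∑ z : ZMod N, g z.val := by
    intro g hg0 hgN
    rw [Fin.sum_univ_eq_sum_range (fun a => g (a + 1)), ← sum_range_eq_sum_zmod]
    have h1 := Finset.sum_range_succ g N
    have h2 := Finset.sum_range_succ' g N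
    rw [hgN] at h1; rw [hg0] at h2
    linarith
  have hf0 : ((f ((0 : ℕ) : ZMod N) : ℤ) : ℝ) = 0 := by simp [h0]
  have hfN : ((f ((N : ℕ) : ZMod N) : ℤ) : ℝ) = 0 := by simp [h0]
  have h := tendsto_tsum_periodic (NeZero.ne N) (f := fun m : ℕ => (f (m : ZMod N) : ℝ))
    (fun m => by simp)
    (by
      have := hshift (fun m : ℕ => (f (m : ZMod N) : ℝ)) hf0 hfN
      simp only [ZMod.natCast_zmod_val] at this
      rw [this]
      exact_mod_cast f.sum_eq_zero_of_odd hodd)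
  refine h.2.trans (le_of_eq (congrArg 𝓝 ?_))
  set L := ∑' m : ℕ, ∑ a : Fin N, ((f ((a + 1 : ℕ) : ZMod N) : ℤ) : ℝ) * ((N * m + (a + 1) : ℝ))⁻¹
    with hL
  have hblock : ∀ m : ℕ,
      ∑ a : Fin N, ((f ((a + 1 : ℕ) : ZMod N) : ℤ) : ℝ) * ((N * m + (a + 1) : ℝ))⁻¹ =
      ∑ z : ZMod N, (f z : ℝ) * ((N * m + z.val : ℝ))⁻¹ := by
    intro m
    have := hshift (fun j : ℕ => (f (j : ZMod N) : ℝ) * ((N * m + j : ℝ))⁻¹)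
      (by rw [hf0, zero_mul]) (by rw [hfN, zero_mul])
    simp only [ZMod.natCast_zmod_val] at this
    rw [← this]
    push_cast
    rfl
  have hblock2 : ∀ m : ℕ, ((2 * ∑ z : ZMod N, (f z : ℝ) * ((N * m + z.val : ℝ))⁻¹ : ℝ) : ℂ) =
      ∑ z : ZMod N, (f z : ℂ) * (((N * m + z.val : ℂ))⁻¹ - ((N * m + (N - z.val) : ℂ))⁻¹) := by
    intro m
    have h1 := Equiv.sum_comp (Equiv.neg (ZMod N)) (fun z => (f z : ℂ) * ((N * m + z.val : ℂ))⁻¹)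
    have h2 : ∀ z : ZMod N, (f (-z) : ℂ) * ((N * m + (-z).val : ℂ))⁻¹ =
        -((f z : ℂ) * ((N * m + (N - z.val) : ℂ))⁻¹) := by
      intro z
      rcases eq_or_ne z 0 with rfl | hz
      · simp [h0]
      rw [f.map_neg_of_odd hodd, ZMod.neg_val, if_neg hz, Nat.cast_sub (ZMod.val_lt z).le]
      push_cast
      ring
    simp only [Equiv.neg_apply, h2, Finset.sum_neg_distrib] at h1
    push_cast
    simp only [mul_sub, Finset.sum_sub_distrib]
    rw [two_mul]
    nth_rewrite 2 [← h1]
    ring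
  have hlim : Tendsto (fun M : ℕ => ∑ m ∈ Finset.range M, ((2 *
      ∑ z : ZMod N, (f z : ℝ) * ((N * m + z.val : ℝ))⁻¹ : ℝ) : ℂ)) atTop
      (𝓝 (∑ z : ZMod N, (f z : ℂ) * (Real.pi / N * Complex.cot (Real.pi * (z.val / N))))) := by
    have : ∀ M : ℕ, ∑ m ∈ Finset.range M, ((2 *
        ∑ z : ZMod N, (f z : ℝ) * ((N * m + z.val : ℝ))⁻¹ : ℝ) : ℂ) = ∑ z : ZMod N, (f z : ℂ) *
          ∑ m ∈ Finset.range M, (((N * m + z.val : ℂ))⁻¹ - ((N * m + (N - z.val) : ℂ))⁻¹) := by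
      intro M
      rw [Finset.sum_congr rfl fun m _ => hblock2 m, Finset.sum_comm]
      simp only [Finset.mul_sum]
    simp only [this]
    refine tendsto_finsetSum _ fun z _ => ?_
    rcases eq_or_ne z 0 with rfl | hz
    · simp [h0]
    exact (tendsto_sum_inv_sub_inv (Nat.pos_of_ne_zero (by simpa using hz))
      (ZMod.val_lt z)).const_mul _
  have hlim2 : Tendsto (fun M : ℕ => ∑ m ∈ Finset.range M, ((2 *
      ∑ z : ZMod N, (f z : ℝ) * ((N * m + z.val : ℝ))⁻¹ : ℝ) : ℂ)) atTop (𝓝 ((2 * L : ℝ) : ℂ)) := by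
    have h1 := (h.1.hasSum.tendsto_sum_nat).const_mul 2
    have h2 := (Complex.continuous_ofReal.tendsto _).comp h1
    refine h2.congr' (Eventually.of_forall fun M => ?_)
    simp only [Function.comp, hblock, Finset.mul_sum]
    push_cast
    rfl
  have heq := tendsto_nhds_unique hlim2 hlim
  have e3 : ∑ z : ZMod N, (f z : ℂ) * (Real.pi / N * Complex.cot (Real.pi * (z.val / N))) =
      Real.pi / N * ∑ z : ZMod N, (f z : ℂ) * Complex.cot (Real.pi * (z.val / N)) := by
    rw [Finset.mul_sum]
    exact Finset.sum_congr rfl fun z _ => by ring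
  rw [e3, sum_mul_cot hodd H hsq, ← hτ, ← hS] at heq
  have hsqrt : ((√N : ℝ) : ℂ) ^ 2 = N := by
    rw [← Complex.ofReal_pow, Real.sq_sqrt (Nat.cast_nonneg N)]; simp
  have hsqrt0 : ((√N : ℝ) : ℂ) ≠ 0 := by
    intro h; rw [h] at hsqrt; exact hN (by rw [← hsqrt]; simp)
  have goalC : (L : ℂ) = ((ε * Real.pi * (S : ℝ) / (N * √N) : ℝ) : ℂ) := by
    push_cast
    have e4 : (2 : ℂ) * L = Real.pi / N * (2 / N * (Complex.I * τ * S)) := by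
      push_cast at heq
      rw [heq]; ring
    rw [hετ] at e4
    rw [eq_div_iff (mul_ne_zero hN hsqrt0)]
    field_simp at e4
    refine mul_right_cancel₀ hsqrt0 ?_
    linear_combination e4 + (L : ℂ) * N * hsqrt
  exact_mod_cast goalC

end OddCharacter

open Filter Topology in
/-- The value at `1` of the `L`-series of the product of an even primitive quadratic character
and an odd quadratic character of prime conductor. -/
theorem tendsto_tsum_mul_quadraticChar {k d : ℕ} [NeZero k] [Fact d.Prime] (hd : d % 4 = 3)
    (hkd : k.Coprime d) (ψ : MulChar (ZMod k) ℤ) (heven : ψ (-1) = 1)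
    (H : ∀ r : ZMod k, ¬IsUnit r → ∃ u, ψ u = -1 ∧ u * r = r)
    (hsq : ∀ r : ZMod k, IsUnit r → ψ r * ψ r = 1) :
    ∃ S : ℤ, |S| ≤ ((k * d : ℕ) : ℤ) ^ 2 ∧
      Tendsto (fun s : ℝ => ∑' m : ℕ, ((ψ (m : ZMod k) : ℝ) *
        (quadraticChar (ZMod d) (m : ZMod d) : ℝ)) * (m : ℝ) ^ (-s)) (𝓝[>] 1)
        (𝓝 (Real.pi * S / ((k * d : ℕ) * √((k * d : ℕ) : ℝ)))) := by
  have hprime : d.Prime := Fact.out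
  have : NeZero (k * d) := ⟨mul_ne_zero (NeZero.ne k) hprime.ne_zero⟩
  set χ := quadraticChar (ZMod d) with hχ
  have hchar : ringChar (ZMod d) ≠ 2 := by
    rw [ZMod.ringChar_zmod_n]; rintro rfl; omega
  set e : ZMod (k * d) ≃+* ZMod k × ZMod d := ZMod.chineseRemainder hkd with he
  let f : ZMod (k * d) →* ℤ :=
    { toFun := fun r => ψ (e r).1 * χ (e r).2
      map_one' := by simp
      map_mul' := fun a b => by
        rw [map_mul, Prod.fst_mul, Prod.snd_mul, map_mul, map_mul]
        ring }
  have hf : ∀ r, f r = ψ (e r).1 * χ (e r).2 := fun r => rfl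
  have hunit : ∀ r, IsUnit r ↔ IsUnit (e r).1 ∧ IsUnit (e r).2 := fun r => by
    rw [← Prod.isUnit_iff, MulEquiv.isUnit_map]
  have hodd : f (-1) = -1 := by
    rw [hf, map_neg, map_one, Prod.fst_neg, Prod.snd_neg, Prod.fst_one, Prod.snd_one, heven,
      one_mul,
      hχ, quadraticChar_neg_one hchar, ZMod.card, ZMod.χ₄_nat_three_mod_four hd]
  have hχsq : ∀ r : ZMod d, IsUnit r → χ r * χ r = 1 := fun r hr => by
    rw [← sq, quadraticChar_sq_one hr.ne_zero]
  have hfsq : ∀ r, IsUnit r → f r * f r = 1 := fun r hr => by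
    obtain ⟨h1, h2⟩ := (hunit r).mp hr
    rw [hf, mul_mul_mul_comm, hsq _ h1, hχsq _ h2, one_mul]
  have hfH : ∀ r : ZMod (k * d), ¬IsUnit r → ∃ u, f u = -1 ∧ u * r = r := by
    intro r hr
    by_cases h1 : IsUnit (e r).1
    · have h2 : (e r).2 = 0 := by
        by_contra h
        exact hr ((hunit r).mpr ⟨h1, isUnit_iff_ne_zero.mpr h⟩)
      obtain ⟨u, hu⟩ := quadraticChar_exists_neg_one hchar
      refine ⟨e.symm (1, u), ?_, ?_⟩
      · rw [hf, RingEquiv.apply_symm_apply, map_one, one_mul, hχ, hu]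
      · apply e.injective
        rw [map_mul, RingEquiv.apply_symm_apply]
        ext <;> simp [h2]
    · obtain ⟨u, hu, hur⟩ := H _ h1
      refine ⟨e.symm (u, 1), ?_, ?_⟩
      · rw [hf, RingEquiv.apply_symm_apply, hu, map_one, mul_one]
      · apply e.injective
        rw [map_mul, RingEquiv.apply_symm_apply]
        ext <;> simp [hur]
  have hfle : ∀ r, |f r| ≤ 1 := by
    intro r
    by_cases hr : IsUnit r
    · rcases mul_self_eq_one_iff.mp (hfsq r hr) with h | h <;> simp [h]
    · rw [f.map_nonunit_eq_zero hfH hr]; simp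
  obtain ⟨ε, hε, hlim⟩ := tendsto_tsum_oddCharacter hodd hfH hfsq
  set S : ℤ := ∑ r : ZMod (k * d), (r.val : ℤ) * f r with hS
  have hSle : |S| ≤ ((k * d : ℕ) : ℤ) ^ 2 := by
    refine (Finset.abs_sum_le_sum_abs _ _).trans ?_
    refine (Finset.sum_le_card_nsmul _ _ ((k * d : ℕ) : ℤ) fun r _ => ?_).trans (le_of_eq ?_)
    · rw [abs_mul, Nat.abs_cast]
      have h1 : (r.val : ℤ) ≤ ((k * d : ℕ) : ℤ) := by exact_mod_cast (ZMod.val_lt r).le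
      have h2 := hfle r
      nlinarith [abs_nonneg (f r), Int.natCast_nonneg r.val]
    · rw [Finset.card_univ, ZMod.card, nsmul_eq_mul, sq]
  have hlim' : ∀ T : ℝ, T = ε * S →
      Tendsto (fun s : ℝ => ∑' m : ℕ,
        ((ψ (m : ZMod k) : ℝ) * (χ (m : ZMod d) : ℝ)) * (m : ℝ) ^ (-s))
        (𝓝[>] 1) (𝓝 (Real.pi * T / ((k * d : ℕ) * √((k * d : ℕ) : ℝ)))) := by
    rintro T rfl
    have e1 : Real.pi * (ε * (S : ℝ)) = ε * Real.pi * S := by ring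
    rw [e1]
    refine hlim.congr' (Eventually.of_forall fun s => tsum_congr fun m => ?_)
    simp only [hf, map_natCast, Prod.fst_natCast, Prod.snd_natCast, Int.cast_mul]
  rcases hε with rfl | rfl
  · exact ⟨S, hSle, hlim' S (by simp)⟩
  · exact ⟨-S, by rwa [abs_neg], hlim' _ (by push_cast; ring)⟩

open Filter Topology in
theorem tendsto_tsum_psi12_mul {d : ℕ} [Fact d.Prime] (hd : d % 4 = 3) (h3 : 3 < d) :
    ∃ S : ℤ, |S| ≤ ((12 * d : ℕ) : ℤ) ^ 2 ∧
      Tendsto (fun s : ℝ => ∑' m : ℕ, ((psi12 (m : ZMod 12) : ℝ) *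
        (quadraticChar (ZMod d) (m : ZMod d) : ℝ)) * (m : ℝ) ^ (-s)) (𝓝[>] 1)
        (𝓝 (Real.pi * S / ((12 * d : ℕ) * √((12 * d : ℕ) : ℝ)))) := by
  have hprime : d.Prime := Fact.out
  refine tendsto_tsum_mul_quadraticChar hd ?_ psi12 (by decide) ?_ ?_
  · rw [Nat.coprime_comm, Nat.Prime.coprime_iff_not_dvd hprime]
    intro h
    have := Nat.le_of_dvd (by norm_num) h
    interval_cases d <;> omega
  · intro r hr
    have h : ∀ r : ZMod 12, r * r = 1 ∨ ∃ u, psi12 u = -1 ∧ u * r = r := by decide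
    exact (h r).resolve_left fun h => hr (IsUnit.of_mul_eq_one r h)
  · intro r hr
    have h : ∀ r u : ZMod 12, r * u = 1 → psi12 r * psi12 r = 1 := by decide
    obtain ⟨u, hu⟩ := hr.exists_right_inv
    exact h r u hu

open Filter Topology in
theorem tendsto_tsum_psi24_mul {d : ℕ} [Fact d.Prime] (hd : d % 4 = 3) (h3 : 3 < d) :
    ∃ S : ℤ, |S| ≤ ((24 * d : ℕ) : ℤ) ^ 2 ∧
      Tendsto (fun s : ℝ => ∑' m : ℕ, ((psi24 (m : ZMod 24) : ℝ) *
        (quadraticChar (ZMod d) (m : ZMod d) : ℝ)) * (m : ℝ) ^ (-s)) (𝓝[>] 1)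
        (𝓝 (Real.pi * S / ((24 * d : ℕ) * √((24 * d : ℕ) : ℝ)))) := by
  have hprime : d.Prime := Fact.out
  refine tendsto_tsum_mul_quadraticChar hd ?_ psi24 (by decide) ?_ ?_
  · rw [Nat.coprime_comm, Nat.Prime.coprime_iff_not_dvd hprime]
    intro h
    have := Nat.le_of_dvd (by norm_num) h
    have : d ∣ 3 := by
      have hc : Nat.Coprime d 8 := by
        have : ¬d ∣ 2 := fun h2 => by have := Nat.le_of_dvd (by norm_num) h2; omega
        exact ((Nat.Prime.coprime_iff_not_dvd hprime).mpr this).pow_right 3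
      exact hc.dvd_of_dvd_mul_left (m := 8) (n := 3) h
    have := Nat.le_of_dvd (by norm_num) this
    omega
  · intro r hr
    have h : ∀ r : ZMod 24, r * r = 1 ∨ ∃ u, psi24 u = -1 ∧ u * r = r := by decide +kernel
    exact (h r).resolve_left fun h => hr (IsUnit.of_mul_eq_one r h)
  · intro r hr
    have h : ∀ r u : ZMod 24, r * u = 1 → psi24 r * psi24 r = 1 := by decide +kernel
    obtain ⟨u, hu⟩ := hr.exists_right_inv
    exact h r u hu

/-- A fixed point approximation, with scale `T`, of `∑ j < n, (a / b) ^ j / (2 * j + 1)`. -/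
def atanhSum (a b T : ℕ) : ℕ → ℕ
  | 0 => 0
  | n + 1 => atanhSum a b T n + T * a ^ n / (b ^ n * (2 * n + 1))

theorem atanhSum_bounds {a b T : ℕ} (hb : 0 < b) (n : ℕ) :
    (atanhSum a b T n : ℝ) ≤ T * ∑ j ∈ Finset.range n, (a / b : ℝ) ^ j / (2 * j + 1) ∧
      T * ∑ j ∈ Finset.range n, (a / b : ℝ) ^ j / (2 * j + 1) ≤ atanhSum a b T n + n := by
  induction n with
  | zero => simp [atanhSum]
  | succ n ih =>
    have hpos : (0 : ℝ) < b ^ n * (2 * n + 1) := by positivity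
    have e : (T : ℝ) * ((a / b : ℝ) ^ n / (2 * n + 1)) =
        (T * a ^ n : ℕ) / (b ^ n * (2 * n + 1) : ℕ) := by
      push_cast
      rw [div_pow]
      field_simp
    have h1 : ((T * a ^ n / (b ^ n * (2 * n + 1)) : ℕ) : ℝ) ≤
        (T * a ^ n : ℕ) / (b ^ n * (2 * n + 1) : ℕ) := Nat.cast_div_le
    have h2 : ((T * a ^ n : ℕ) : ℝ) / (b ^ n * (2 * n + 1) : ℕ) ≤
        (T * a ^ n / (b ^ n * (2 * n + 1)) : ℕ) + 1 := by
      rw [← Nat.floor_div_eq_div (K := ℝ)]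
      exact (Nat.lt_floor_add_one _).le
    rw [Finset.sum_range_succ, mul_add, e, atanhSum]
    push_cast at h1 h2 ⊢
    constructor <;> linarith [ih.1, ih.2]

theorem tsum_atanh_bounds {a b T : ℕ} (hb : 0 < b) (hab : a < b) (n : ℕ)
    (hn : T * a ^ n ≤ b ^ n * (2 * n + 1) * (b - a) / b) {s : ℝ}
    (hs : HasSum (fun j : ℕ => (a / b : ℝ) ^ j / (2 * j + 1)) s) :
    (atanhSum a b T n : ℝ) ≤ T * s ∧ T * s ≤ atanhSum a b T n + n + 1 := by
  have hb' : (0 : ℝ) < b := by exact_mod_cast hb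
  have ht0 : (0 : ℝ) ≤ a / b := by positivity
  have ht1 : (a / b : ℝ) < 1 := by rw [div_lt_one hb']; exact_mod_cast hab
  obtain ⟨h1, h2⟩ := atanhSum_bounds (a := a) (T := T) hb n
  have hnonneg : ∀ j : ℕ, 0 ≤ (a / b : ℝ) ^ j / (2 * j + 1) := fun j => by positivity
  constructor
  · exact h1.trans (mul_le_mul_of_nonneg_left (sum_le_hasSum _ (fun j _ => hnonneg j) hs)
      (Nat.cast_nonneg T))
  have hsplit := hs.summable.sum_add_tsum_nat_add n
  rw [hs.tsum_eq] at hsplit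
  have htail : ∑' j : ℕ, (a / b : ℝ) ^ (j + n) / (2 * ((j + n : ℕ) : ℝ) + 1) ≤
      ∑' j : ℕ, (a / b : ℝ) ^ n / (2 * n + 1) * (a / b : ℝ) ^ j := by
    refine Summable.tsum_le_tsum (fun j => ?_) ((summable_nat_add_iff n).mpr hs.summable)
      ((summable_geometric_of_lt_one ht0 ht1).mul_left _)
    rw [pow_add, mul_comm, mul_div_right_comm]
    refine mul_le_mul_of_nonneg_right ?_ (pow_nonneg ht0 j)
    refine div_le_div_of_nonneg_left (pow_nonneg ht0 n) (by positivity) ?_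
    push_cast
    nlinarith [Nat.cast_nonneg (α := ℝ) j]
  rw [tsum_mul_left, tsum_geometric_of_lt_one ht0 ht1] at htail
  have hba : (0 : ℝ) < b - a := by rw [sub_pos]; exact_mod_cast hab
  have hsmall : (T : ℝ) * ((a / b : ℝ) ^ n / (2 * n + 1) * (1 - a / b : ℝ)⁻¹) ≤ 1 := by
    rw [Nat.le_div_iff_mul_le hb] at hn
    have hn' : (T : ℝ) * a ^ n * b ≤ b ^ n * (2 * n + 1) * (b - a) := by
      have := (Nat.cast_le (α := ℝ)).mpr hn
      push_cast [Nat.cast_sub hab.le] at this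
      exact this
    have e : (1 - a / b : ℝ)⁻¹ = b / (b - a) := by
      rw [one_sub_div hb'.ne', inv_div]
    rw [e, div_pow, div_div, div_mul_div_comm, ← mul_div_assoc, div_le_one (by positivity)]
    linarith
  have := mul_le_mul_of_nonneg_left htail (Nat.cast_nonneg (α := ℝ) T)
  rw [← hsplit, mul_add]
  linarith

theorem hasSum_log_div {x y : ℝ} (hx : 0 < x) (hx1 : x < 1) (hy : x ^ 2 = y) :
    HasSum (fun j : ℕ => y ^ j / (2 * j + 1)) (Real.log ((1 + x) / (1 - x)) / (2 * x)) := by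
  have h := Real.hasSum_log_sub_log_of_abs_lt_one (x := x) (by rw [abs_of_pos hx]; exact hx1)
  rw [← Real.log_div (by linarith) (by linarith)] at h
  convert! h.div_const (2 * x) using 1
  ext j
  rw [← hy]
  field_simp
  ring

theorem log_two_add_sqrt_three :
    HasSum (fun j : ℕ => ((1 : ℕ) / (3 : ℕ) : ℝ) ^ j / (2 * j + 1))
      (√3 / 2 * Real.log (2 + √3)) := by
  have h3 : √3 ^ 2 = 3 := Real.sq_sqrt (by norm_num)
  have h3p : 0 < √3 := by positivity
  have h3l : 1 < √3 := by nlinarith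
  have hx1 : (√3)⁻¹ < 1 := inv_lt_one_of_one_lt₀ h3l
  have h := hasSum_log_div (x := (√3)⁻¹) (y := ((1 : ℕ) / (3 : ℕ) : ℝ)) (by positivity)
    hx1 (by rw [inv_pow, h3]; norm_num)
  have e : (1 + (√3)⁻¹) / (1 - (√3)⁻¹) = 2 + √3 := by
    rw [div_eq_iff (by linarith)]
    field_simp
    linear_combination -h3
  rw [e] at h
  convert! h using 1
  field_simp

theorem log_five_add_two_mul_sqrt_six :
    HasSum (fun j : ℕ => ((2 : ℕ) / (3 : ℕ) : ℝ) ^ j / (2 * j + 1))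
      (√3 / 2 * Real.log (5 + 2 * √6) / √2) := by
  have h3 : √3 ^ 2 = 3 := Real.sq_sqrt (by norm_num)
  have h2 : √2 ^ 2 = 2 := Real.sq_sqrt (by norm_num)
  have h3p : 0 < √3 := by positivity
  have h2p : 0 < √2 := by positivity
  have h6 : √6 = √2 * √3 := by rw [← Real.sqrt_mul (by norm_num)]; norm_num
  have hx1 : √2 / √3 < 1 := by
    rw [div_lt_one h3p]
    exact Real.sqrt_lt_sqrt (by norm_num) (by norm_num)
  have h := hasSum_log_div (x := √2 / √3) (y := ((2 : ℕ) / (3 : ℕ) : ℝ)) (by positivity)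
    hx1 (by rw [div_pow, h3, h2]; norm_num)
  have e : (1 + √2 / √3) / (1 - √2 / √3) = 5 + 2 * √6 := by
    rw [div_eq_iff (by linarith), h6]
    field_simp
    linear_combination 2 * √3 * h2 - 2 * √2 * h3
  rw [e] at h
  convert! h using 1
  field_simp

theorem atanhSum_one_three : atanhSum 1 3 (10 ^ 93) 200 =
    1140518994451419521296641382320608736302441596420764640530856005390082683982366129542687547102 :=
  by decide +kernel

theorem atanhSum_two_three : atanhSum 2 3 (10 ^ 93) 530 =
    1403821965155355165730363738899610277480035328306657022070004557258486408137813480023002908215 :=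
  by decide +kernel

theorem abs_linear_form_log_ge {A B : ℤ} (hB : 0 < B) (hB2 : B < 6 * 10 ^ 43) :
    10⁻¹ ^ 44 ≤ |B * Real.log (5 + 2 * √6) - A * Real.log (2 + √3)| := by
  set L1 := Real.log (2 + √3) with hL1
  set L2 := Real.log (5 + 2 * √6) with hL2
  have h3 : √3 ^ 2 = 3 := Real.sq_sqrt (by norm_num)
  have h3p : 0 < √3 := by positivity
  have h3l : √3 / 2 ≤ 1 := by nlinarith
  have hb1 := tsum_atanh_bounds (T := 10 ^ 93) (by norm_num) (by norm_num) 200 (by decide +kernel)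
    log_two_add_sqrt_three
  have hb2 := tsum_atanh_bounds (T := 10 ^ 93) (by norm_num) (by norm_num) 530 (by decide +kernel)
    log_five_add_two_mul_sqrt_six
  rw [atanhSum_one_three, ← hL1] at hb1
  rw [atanhSum_two_three, ← hL2] at hb2
  set lo : ℝ :=
    1.4142135623730950488016887242096980785696718753769480731766797379907324784621070388503875343276
    with hlo
  set hi : ℝ :=
    1.4142135623730950488016887242096980785696718753769480731766797379907324784621070388503875343277
    with hhi
  set S : ℝ :=
    1403821965155355165730363738899610277480035328306657022070004557258486408137813480023002908215 / 10 ^ 93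
    with hS
  set S' : ℝ :=
    1403821965155355165730363738899610277480035328306657022070004557258486408137813480023002908746 / 10 ^ 93
    with hS'
  have h2lo : lo ≤ √2 :=
    Real.le_sqrt_of_sq_le (by norm_num [hlo])
  have h2hi : √2 ≤ hi := by
    rw [Real.sqrt_le_left (by norm_num [hhi])]; norm_num [hhi]
  have h2p : 0 < √2 := by positivity
  have hcancel : √2 * (√3 / 2 * L2 / √2) = √3 / 2 * L2 := by field_simp
  set s2 := √3 / 2 * L2 / √2
  push_cast at hb1 hb2
  set p₁ : ℝ := 38786092805191523573724972016119050970998067 with hp1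
  set q₁ : ℝ := 22281864226920915218108295695542471791104714 with hq1
  set p₂ : ℝ := 80109365805877194997228052260993167580473671 with hp2
  set q₂ : ℝ := 46021289670930093160137527707001297890133479 with hq2
  have hlo2 : lo * S ≤ √3 / 2 * L2 := by
    rw [← hcancel]
    refine mul_le_mul h2lo ?_ (by norm_num [hS]) h2p.le
    rw [hS, div_le_iff₀ (by norm_num)]
    linarith [hb2.1]
  have hs2 : s2 ≤ S' := by
    rw [hS', le_div_iff₀ (by norm_num)]
    linarith [hb2.2]
  have hs20 : 0 ≤ s2 := by
    have := hb2.1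
    by_contra h
    nlinarith
  have hhi2 : √3 / 2 * L2 ≤ hi * S' := by
    rw [← hcancel]
    exact mul_le_mul h2hi hs2 hs20 (by norm_num [hhi])
  have hα : 10⁻¹ ^ 44 ≤ q₁ * (√3 / 2 * L2) - p₁ * (√3 / 2 * L1) := by
    rw [hq1, hp1]
    have := hb1.2
    norm_num [hlo, hS] at this hlo2 ⊢
    linarith
  have hβ : 10⁻¹ ^ 44 ≤ p₂ * (√3 / 2 * L1) - q₂ * (√3 / 2 * L2) := by
    rw [hq2, hp2]
    have := hb1.1
    norm_num [hhi, hS'] at this hhi2 ⊢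
    linarith
  have hpos : (0 : ℝ) < 10⁻¹ ^ 44 := by positivity
  have hα_log : 10⁻¹ ^ 44 ≤ q₁ * L2 - p₁ * L1 := by
    have e : q₁ * (√3 / 2 * L2) - p₁ * (√3 / 2 * L1) = √3 / 2 * (q₁ * L2 - p₁ * L1) := by ring
    rw [e] at hα
    nlinarith
  have hβ_log : 10⁻¹ ^ 44 ≤ p₂ * L1 - q₂ * L2 := by
    have e : p₂ * (√3 / 2 * L1) - q₂ * (√3 / 2 * L2) = √3 / 2 * (p₂ * L1 - q₂ * L2) := by ring
    rw [e] at hβ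
    nlinarith
  obtain ⟨x, hx⟩ : ∃ x : ℤ, x = B * 80109365805877194997228052260993167580473671 -
    A * 46021289670930093160137527707001297890133479 := ⟨_, rfl⟩
  obtain ⟨y, hy⟩ : ∃ y : ℤ, y = A * 22281864226920915218108295695542471791104714 -
    B * 38786092805191523573724972016119050970998067 := ⟨_, rfl⟩
  have hBxy : B = x * 22281864226920915218108295695542471791104714 +
      y * 46021289670930093160137527707001297890133479 := by
    rw [hx, hy]; ring
  have hAxy : A = x * 38786092805191523573724972016119050970998067 +
      y * 80109365805877194997228052260993167580473671 := by
    rw [hx, hy]; ring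
  have e : B * L2 - A * L1 = x * (q₁ * L2 - p₁ * L1) - y * (p₂ * L1 - q₂ * L2) := by
    rw [hBxy, hAxy]; push_cast; ring
  rw [e]
  clear_value p₁ q₁ p₂ q₂
  generalize q₁ * L2 - p₁ * L1 = α at hα_log
  generalize p₂ * L1 - q₂ * L2 = β at hβ_log
  generalize (10⁻¹ : ℝ) ^ 44 = c at *
  clear hAxy
  rcases le_or_gt x 0 with hx0 | hx0
  · have hy1 : 1 ≤ y := by omega
    have hx0' : (x : ℝ) ≤ 0 := by exact_mod_cast hx0
    have hy1' : (1 : ℝ) ≤ y := by exact_mod_cast hy1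
    refine le_trans ?_ (neg_le_abs _)
    linarith [mul_nonneg (neg_nonneg.mpr hx0') (hpos.le.trans hα_log),
      mul_le_mul_of_nonneg_right hy1' (hpos.le.trans hβ_log)]
  · have hy1 : y ≤ 0 := by omega
    have hx0' : (1 : ℝ) ≤ x := by exact_mod_cast hx0
    have hy1' : (y : ℝ) ≤ 0 := by exact_mod_cast hy1
    refine le_trans ?_ (le_abs_self _)
    linarith [mul_nonneg (neg_nonneg.mpr hy1') (hpos.le.trans hβ_log),
      mul_le_mul_of_nonneg_right hx0' (hpos.le.trans hα_log)]

/-- A form `x ^ 2 + x y + n y ^ 2` representing all the primes it can is excluded for large `n`, by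
playing the two real quadratic fields of discriminants 12 and 24 against each other. -/
theorem RepresentsPrimes.false_of_lt {n : ℕ} (h : RepresentsPrimes n) (hn6 : n % 6 = 5)
    (hn : 1000000 < n) (hp : (4 * n - 1).Prime) (hle : 4 * n - 1 ≤ 31 * 10 ^ 19) : False := by
  obtain ⟨d, hd⟩ : ∃ d, d = 4 * n - 1 := ⟨_, rfl⟩
  rw [← hd] at hp hle
  have : Fact d.Prime := ⟨hp⟩
  have hd4 : d % 4 = 3 := by omega
  obtain ⟨S, hS, hm12⟩ := tendsto_tsum_psi12_mul hd4 (by omega)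
  obtain ⟨T, hT, hm24⟩ := tendsto_tsum_psi24_mul hd4 (by omega)
  obtain ⟨hdiff, hhalf⟩ := product_estimates h (by omega) hn6 hn tendsto_tsum_psi12
    tendsto_tsum_psi24 hm12 hm24
  have hdR : (4000000 : ℝ) ≤ d := by exact_mod_cast (by omega : 4000000 ≤ d)
  have hdle : (d : ℝ) ≤ 31 * 10 ^ 19 := by exact_mod_cast hle
  have hd0 : (0 : ℝ) < d := by linarith
  have hsd : 0 < √(d : ℝ) := Real.sqrt_pos.mpr hd0
  have hsq : √(d : ℝ) ^ 2 = d := Real.sq_sqrt hd0.le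
  have hs1 : 2000 ≤ √(d : ℝ) := Real.le_sqrt_of_sq_le (by linarith)
  have hs2 : √(d : ℝ) ≤ 2 * 10 ^ 10 := by
    rw [Real.sqrt_le_left (by norm_num)]; norm_num; linarith
  have h3 : √3 ^ 2 = 3 := Real.sq_sqrt (by norm_num)
  have h6 : √6 ^ 2 = 6 := Real.sq_sqrt (by norm_num)
  have h12d : √((12 * d : ℕ) : ℝ) = 2 * √3 * √d := by
    rw [Real.sqrt_eq_iff_mul_self_eq (by positivity) (by positivity)]
    push_cast
    linear_combination -4 * √(d : ℝ) ^ 2 * h3 - 12 * hsq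
  have h24d : √((24 * d : ℕ) : ℝ) = 2 * √6 * √d := by
    rw [Real.sqrt_eq_iff_mul_self_eq (by positivity) (by positivity)]
    push_cast
    linear_combination -4 * √(d : ℝ) ^ 2 * h6 - 24 * hsq
  set L1 := Real.log (2 + √3) with hL1
  set L2 := Real.log (5 + 2 * √6) with hL2
  have hL2p : 0 < L2 := Real.log_pos (by linarith [Real.sqrt_nonneg 6])
  have e1 : L1 / √3 * (Real.pi * S / ((12 * d : ℕ) * √((12 * d : ℕ) : ℝ))) =
      Real.pi / (288 * (d * √d)) * (4 * S * L1) := by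
    rw [h12d]
    push_cast
    field_simp
    rw [h3]
    ring
  have e2 : L2 / √6 * (Real.pi * T / ((24 * d : ℕ) * √((24 * d : ℕ) : ℝ))) =
      Real.pi / (288 * (d * √d)) * (T * L2) := by
    rw [h24d]
    push_cast
    field_simp
    rw [h6]
    ring
  rw [e1, e2] at hdiff
  rw [e1] at hhalf
  set c := Real.pi / (288 * (d * √d)) with hc
  have hcpos : 0 < c := by positivity
  have hexp : Real.exp (-(Real.pi * √d / 24)) ≤ (2.7 ^ 250)⁻¹ := by
    rw [Real.exp_neg]
    refine inv_anti₀ (by norm_num) ?_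
    calc (2.7 : ℝ) ^ 250 ≤ Real.exp 1 ^ 250 :=
          pow_le_pow_left₀ (by norm_num) (by linarith [Real.exp_one_gt_d9]) _
      _ = Real.exp 250 := by rw [← Real.exp_nat_mul]; norm_num
      _ ≤ _ := Real.exp_le_exp.mpr (by nlinarith [Real.pi_gt_three])
  have hsmall : 2 * ((2.7 : ℝ) ^ 250)⁻¹ ≤ 10⁻¹ ^ 90 := by norm_num
  have hdiff' : |c * (4 * S * L1) - c * (T * L2)| ≤ 10⁻¹ ^ 90 := by linarith
  have hTpos : 0 < T := by
    have h1 := (abs_le.mp hdiff').2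
    have h2 : (10⁻¹ : ℝ) ^ 90 < 1 / 2 := by norm_num
    have h3 : 0 < c * (T * L2) := by linarith
    have h4 : 0 < T * L2 := pos_of_mul_pos_right h3 hcpos.le
    exact_mod_cast pos_of_mul_pos_left h4 hL2p.le
  have hTle : T < 6 * 10 ^ 43 := by
    refine lt_of_le_of_lt ((le_abs_self T).trans hT) ?_
    have h1 : ((24 * d : ℕ) : ℤ) ≤ 24 * (31 * 10 ^ 19) := by
      exact_mod_cast Nat.mul_le_mul_left 24 hle
    refine lt_of_le_of_lt (pow_le_pow_left₀ (Int.natCast_nonneg _) h1 2) (by norm_num)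
  have hlower := abs_linear_form_log_ge (A := 4 * S) hTpos hTle
  have e3 : |c * (4 * S * L1) - c * (T * L2)| = c * |T * L2 - ((4 * S : ℤ) : ℝ) * L1| := by
    rw [abs_sub_comm, ← mul_sub, abs_mul, abs_of_pos hcpos]
    push_cast
    rfl
  rw [e3] at hdiff'
  have hclow : 10⁻¹ ^ 40 ≤ c := by
    have h1 : (d : ℝ) * √d ≤ 31 * 10 ^ 19 * (2 * 10 ^ 10) :=
      mul_le_mul hdle hs2 hsd.le (by norm_num)
    rw [hc, le_div_iff₀ (by positivity)]
    nlinarith [Real.pi_gt_three]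
  have h1 := mul_le_mul hclow hlower (by positivity) hcpos.le
  have h2 := h1.trans hdiff'
  norm_num at h2

theorem IsFundamentalDiscriminant.mem_of_exponent_eq_one {D : ℤ} (hD : IsFundamentalDiscriminant D)
    (hle : -(31 * 10 ^ 19) ≤ D) (hneg : D < 0)
    (hexp : ∀ (K : Type) [Field K] [NumberField K], Module.finrank ℚ K = 2 →
      NumberField.discr K = D → Monoid.exponent (ClassGroup (𝓞 K)) = 1) :
    D ∈ ({-3, -4, -7, -8, -11, -19, -43, -67, -163} : Set ℤ) := by
  obtain ⟨K, _, _, hK, hdK⟩ := hD.exists_field hneg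
  have : IsPrincipalIdealRing (𝓞 K) := (exponent_classGroup_eq_one_iff K).mp (hexp K hK hdK)
  obtain ⟨ω, t, n, ht, hω, hdisc, hspan, hind⟩ := exists_integral_basis K hK
  rw [hdK] at hdisc
  rw [hdisc] at hneg
  have hnorm := fun {p : ℕ} (hp : p.Prime) {a : ℤ} (ha : (p : ℤ) ∣ a ^ 2 + t * a + n) =>
    exists_norm_eq_of_isPrincipalIdealRing hω hneg hspan hind hp ha
  rcases ht with rfl | rfl
  · have h2 : (2 : ℤ) ∣ n ^ 2 + 0 * n + n := by
      have := Int.even_mul_succ_self n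
      rw [show n ^ 2 + 0 * n + n = n * (n + 1) by ring]
      exact this.two_dvd
    obtain ⟨x, y, hxy⟩ := hnorm Nat.prime_two (a := n) (by exact_mod_cast h2)
    have hn2 : n ≤ 2 := by
      rcases eq_or_ne y 0 with rfl | hy
      · have hx : x * x = 2 := by push_cast at hxy; linarith
        have h1 : x < 2 := by nlinarith
        have h2 : -2 < x := by nlinarith
        interval_cases x <;> omega
      · have : 0 < y ^ 2 := by positivity
        push_cast at hxy
        nlinarith [sq_nonneg x]
    have hn0 : 0 < n := by linarith
    interval_cases n <;> simp [hdisc]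
  · have hn0 : 0 < n := by linarith
    lift n to ℕ using hn0.le
    have hR : RepresentsPrimes n := fun p hp a ha => by
      obtain ⟨x, y, hxy⟩ := hnorm hp (a := a) (by simpa using ha)
      exact ⟨x, y, by simpa using hxy⟩
    rcases hR.cases (by omega) with h | ⟨h1, h6, hp⟩
    · simp only [List.mem_cons, List.not_mem_nil, or_false] at h
      rcases h with rfl | rfl | rfl | rfl | rfl | rfl | rfl <;> simp [hdisc]
    · exact (hR.false_of_lt h6 h1 hp (by omega)).elim

theorem isFundamentalDiscriminant_of_mem {D : ℤ}
    (hD : D ∈ ({-3, -4, -7, -8, -11, -19, -43, -67, -163} : Set ℤ)) :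
    IsFundamentalDiscriminant D := by
  have hsf : ∀ p : ℕ, p.Prime → Squarefree (-p : ℤ) := fun p hp => by
    rw [← Int.squarefree_natAbs]; simpa using hp.prime.squarefree
  rcases hD with rfl | rfl | rfl | rfl | rfl | rfl | rfl | rfl | rfl
  · exact ⟨by norm_num, Or.inl ⟨by norm_num, hsf 3 (by norm_num)⟩⟩
  · exact ⟨by norm_num, Or.inr ⟨-1, by norm_num, by simp, by norm_num⟩⟩
  · exact ⟨by norm_num, Or.inl ⟨by norm_num, hsf 7 (by norm_num)⟩⟩
  · exact ⟨by norm_num, Or.inr ⟨-2, by norm_num, hsf 2 (by norm_num), by norm_num⟩⟩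
  · exact ⟨by norm_num, Or.inl ⟨by norm_num, hsf 11 (by norm_num)⟩⟩
  · exact ⟨by norm_num, Or.inl ⟨by norm_num, hsf 19 (by norm_num)⟩⟩
  · exact ⟨by norm_num, Or.inl ⟨by norm_num, hsf 43 (by norm_num)⟩⟩
  · exact ⟨by norm_num, Or.inl ⟨by norm_num, hsf 67 (by norm_num)⟩⟩
  · exact ⟨by norm_num, Or.inl ⟨by norm_num, hsf 163 (by norm_num)⟩⟩

theorem setOf_exponent_eq_one :
    {D : ℤ | IsFundamentalDiscriminant D ∧ -(31 * 10 ^ 19) ≤ D ∧ D < 0 ∧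
      ∀ (K : Type) [Field K] [NumberField K], Module.finrank ℚ K = 2 →
        NumberField.discr K = D →
          Monoid.exponent (ClassGroup (𝓞 K)) = 1} =
      {-3, -4, -7, -8, -11, -19, -43, -67, -163} := by
  ext D
  constructor
  · rintro ⟨hD, hle, hneg, hexp⟩
    exact hD.mem_of_exponent_eq_one hle hneg hexp
  · intro hD
    refine ⟨isFundamentalDiscriminant_of_mem hD, ?_, ?_, ?_⟩
    · rcases hD with rfl | rfl | rfl | rfl | rfl | rfl | rfl | rfl | rfl <;> norm_num
    · rcases hD with rfl | rfl | rfl | rfl | rfl | rfl | rfl | rfl | rfl <;> norm_num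
    · intro K _ _ hK hdK
      rw [exponent_classGroup_eq_one_iff]
      exact isPrincipalIdealRing_of_discr K hK (hdK ▸ hD)

/-- There are exactly 9 fundamental discriminants `D` with `−3.1·10^20 ≤ D < 0` such that
the class group of `ℚ(√D)` is trivial (i.e. has exponent 1), and among these the one of
largest absolute value is `D = −163`. -/
theorem count_exponent_one :
    {D : ℤ | IsFundamentalDiscriminant D ∧ -(31 * 10 ^ 19) ≤ D ∧ D < 0 ∧
      ∀ (K : Type) [Field K] [NumberField K], Module.finrank ℚ K = 2 →
        NumberField.discr K = D →
          Monoid.exponent (ClassGroup (𝓞 K)) = 1}.ncard = 9 ∧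
    (-163 : ℤ) ∈ {D : ℤ | IsFundamentalDiscriminant D ∧ -(31 * 10 ^ 19) ≤ D ∧ D < 0 ∧
      ∀ (K : Type) [Field K] [NumberField K], Module.finrank ℚ K = 2 →
        NumberField.discr K = D →
          Monoid.exponent (ClassGroup (𝓞 K)) = 1} ∧
    ∀ D ∈ {D : ℤ | IsFundamentalDiscriminant D ∧ -(31 * 10 ^ 19) ≤ D ∧ D < 0 ∧
      ∀ (K : Type) [Field K] [NumberField K], Module.finrank ℚ K = 2 →
        NumberField.discr K = D →
          Monoid.exponent (ClassGroup (𝓞 K)) = 1}, (-163 : ℤ) ≤ D := by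
  rw [setOf_exponent_eq_one]
  refine ⟨?_, by simp, ?_⟩
  · have h : ({-3, -4, -7, -8, -11, -19, -43, -67, -163} : Set ℤ) =
        (({-3, -4, -7, -8, -11, -19, -43, -67, -163} : Finset ℤ) : Set ℤ) := by simp
    rw [h, Set.ncard_coe_finset]
    decide
  · intro D hD
    rcases hD with rfl | rfl | rfl | rfl | rfl | rfl | rfl | rfl | rfl <;> norm_num
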